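/- There are exactly five edged embeddings of K_{3,3} into the torus up to equivalence. That is, the quotient of the set of all pairs (φ, {u,v}) — where φ is an embedding of K_{3,3} into T² and {u,v} is an edge of K_{3,3} — by the equivalence relation of edged equivalence has exactly five elements. -/

import Mathlib

/-- The torus `T² = (ℝ/ℤ) × (ℝ/ℤ)`. -/
abbrev Torus := UnitAddCircle × UnitAddCircle

/-- An embedding of a simple graph `G` into the torus: an injective map `vert` on vertices
together with, for each edge `e = {u,v}`, an injective continuous path from `vert u` to
`vert v` meeting the vertex images only at its endpoints, such that the paths of two
distinct edges meet only in images of common endpoints of the two edges. -/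
structure TorusEmbedding {V : Type} (G : SimpleGraph V) where
  vert : V → Torus
  vert_inj : Function.Injective vert
  edge : G.edgeSet → C(unitInterval, Torus)
  edge_ends : ∀ e : G.edgeSet, ∃ u v : V, (e : Sym2 V) = s(u, v) ∧
    edge e 0 = vert u ∧ edge e 1 = vert v
  edge_inj : ∀ e : G.edgeSet, Function.Injective (edge e)
  edge_meets_verts : ∀ (e : G.edgeSet) (t : unitInterval),
    edge e t ∈ Set.range vert → t = 0 ∨ t = 1
  edge_disjoint : ∀ e e' : G.edgeSet, e ≠ e' → ∀ t t' : unitInterval,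
    edge e t = edge e' t' →
      ∃ w : V, w ∈ (e : Sym2 V) ∧ w ∈ (e' : Sym2 V) ∧ edge e t = vert w

/-- The image of an embedding: the union of the images of all edge paths. -/
def TorusEmbedding.image {V : Type} {G : SimpleGraph V} (E : TorusEmbedding G) : Set Torus :=
  ⋃ e : G.edgeSet, Set.range (E.edge e)

/-- The complete bipartite graph `K_{3,3}`. -/
abbrev K33 : SimpleGraph (Fin 3 ⊕ Fin 3) := completeBipartiteGraph (Fin 3) (Fin 3)

/-- An edged embedding of `K_{3,3}` into the torus: an embedding together with a
highlighted edge. -/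
structure EdgedEmbedding where
  emb : TorusEmbedding K33
  e : K33.edgeSet

/-- The image of the path of the highlighted edge of an edged embedding. -/
def EdgedEmbedding.edgeImage (D : EdgedEmbedding) : Set Torus :=
  Set.range (D.emb.edge D.e)

/-- Equivalence of edged embeddings: a homeomorphism of the torus carrying the image of
one embedding onto the image of the other and the highlighted edge path onto the
highlighted edge path. -/
def EdgedEquiv (D₁ D₂ : EdgedEmbedding) : Prop :=
  ∃ h : Torus ≃ₜ Torus,
    h '' D₂.emb.image = D₁.emb.image ∧
    h '' D₂.edgeImage = D₁.edgeImage


section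
open Set Filter Topology Metric

def HasLog (K : Set ℂ) (f : ℂ → ℂ) : Prop :=
  ∃ g : ℂ → ℂ, ContinuousOn g K ∧ ∀ z ∈ K, Complex.exp (g z) = f z

def NS (K : Set ℂ) (p q : ℂ) : Prop := ∃ C ⊆ Kᶜ, IsPreconnected C ∧ p ∈ C ∧ q ∈ C

lemma HasLog.mono {K L : Set ℂ} {f} (h : HasLog L f) (hs : K ⊆ L) : HasLog K f := by
  obtain ⟨g, h1, h2⟩ := h; exact ⟨g, h1.mono hs, fun z hz => h2 z (hs hz)⟩

lemma HasLog.congr {K : Set ℂ} {f f'} (h : HasLog K f) (hs : ∀ z ∈ K, f z = f' z) : HasLog K f' := by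
  obtain ⟨g, h1, h2⟩ := h; exact ⟨g, h1, fun z hz => (h2 z hz).trans (hs z hz)⟩

lemma HasLog.mul {K : Set ℂ} {f f'} (h : HasLog K f) (h' : HasLog K f') :
    HasLog K (fun z => f z * f' z) := by
  obtain ⟨g, h1, h2⟩ := h; obtain ⟨g', h1', h2'⟩ := h'
  exact ⟨fun z => g z + g' z, h1.add h1', fun z hz => by rw [Complex.exp_add, h2 z hz, h2' z hz]⟩

lemma HasLog.inv {K : Set ℂ} {f} (h : HasLog K f) : HasLog K (fun z => (f z)⁻¹) := by
  obtain ⟨g, h1, h2⟩ := h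
  exact ⟨fun z => - g z, h1.neg, fun z hz => by rw [Complex.exp_neg, h2 z hz]⟩

lemma HasLog.const {K : Set ℂ} {c : ℂ} (h : c ≠ 0) : HasLog K (fun _ => c) :=
  ⟨fun _ => Complex.log c, continuousOn_const, fun _ _ => Complex.exp_log h⟩

lemma hasLog_homotopy {K : Set ℂ} (H : unitInterval → ℂ → ℂ)
    (hc : ContinuousOn (Function.uncurry H) (univ ×ˢ K)) (h0 : ∀ t, ∀ z ∈ K, H t z ≠ 0)
    (hl : HasLog K (H 0)) : HasLog K (H 1) := by
  classical
  obtain ⟨g, g1, g2⟩ := hl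
  let HH : C(unitInterval × K, {z : ℂ // z ≠ 0}) :=
    ⟨fun x => ⟨H x.1 x.2, h0 _ _ x.2.2⟩, by
      refine Continuous.subtype_mk ?_ _
      refine hc.comp_continuous (f := fun x : unitInterval × K => (x.1, (x.2 : ℂ))) (by fun_prop) ?_
      intro x; simp⟩
  let ff : C(K, ℂ) := ⟨fun x => g x, continuousOn_iff_continuous_domRestrict.1 g1⟩
  have H0 : ∀ a, HH (0, a) = (⟨_, (ff a).exp_ne_zero⟩ : {z : ℂ // z ≠ 0}) := by
    intro a; apply Subtype.ext; exact (g2 a a.2).symm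
  let L := Complex.isCoveringMap_exp.liftHomotopy HH ff H0
  have hL := Complex.isCoveringMap_exp.liftHomotopy_lifts HH ff H0
  refine ⟨fun z => if h : z ∈ K then L (1, ⟨z, h⟩) else 0, ?_, ?_⟩
  · rw [continuousOn_iff_continuous_domRestrict]
    have : Continuous fun a : K => L (1, a) := by fun_prop
    convert this using 2 with a
    simp
  · intro z hz
    simp only [hz, dif_pos]
    exact congrArg Subtype.val (congrFun hL (1, ⟨z, hz⟩))

lemma hasLog_contr {K : Set ℂ} (c : unitInterval → ℂ → ℂ) (x : ℂ) {φ : ℂ → ℂ}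
    (hc : ContinuousOn (Function.uncurry c) (univ ×ˢ K)) (hm : ∀ t, ∀ z ∈ K, c t z ∈ K)
    (h0 : ∀ z ∈ K, c 0 z = x) (h1 : ∀ z ∈ K, c 1 z = z)
    (hφ : ContinuousOn φ K) (hn : ∀ z ∈ K, φ z ≠ 0) : HasLog K φ := by
  rcases K.eq_empty_or_nonempty with rfl | ⟨y, hy⟩
  · exact ⟨0, by simp, by simp⟩
  have := hasLog_homotopy (K := K) (fun t z => φ (c t z)) ?_ (fun t z hz => hn _ (hm t z hz)) ?_
  · exact this.congr fun z hz => by rw [h1 z hz]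
  · exact hφ.comp hc fun ⟨t, z⟩ hz => hm t z hz.2
  · exact (HasLog.const (hn x (h0 y hy ▸ hm 0 y hy))).congr fun z hz => by rw [h0 z hz]

lemma hasLog_star {E : Type*} [NormedAddCommGroup E] [NormedSpace ℝ E] {S : Set E}
    (hS : IsCompact S) (hs : StarConvex ℝ 0 S) {f : E → ℂ} (hf : ContinuousOn f S)
    (hi : InjOn f S) {φ : ℂ → ℂ} (hφ : ContinuousOn φ (f '' S)) (hn : ∀ z ∈ f '' S, φ z ≠ 0) :
    HasLog (f '' S) φ := by
  have hinv : ContinuousOn (Function.invFunOn f S) (f '' S) := by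
    rw [continuousOn_iff_isClosed]
    intro t ht
    refine ⟨f '' (S ∩ t), ((hS.inter_right ht).image_of_continuousOn (hf.mono inter_subset_left)).isClosed, ?_⟩
    ext z; constructor
    · rintro ⟨h1, y, hy, rfl⟩
      rw [mem_preimage, hi.leftInvOn_invFunOn hy] at h1
      exact ⟨⟨y, ⟨hy, h1⟩, rfl⟩, y, hy, rfl⟩
    · rintro ⟨⟨y, ⟨hy, h1⟩, rfl⟩, -⟩
      refine ⟨?_, y, hy, rfl⟩
      rw [mem_preimage, hi.leftInvOn_invFunOn hy]; exact h1
  have hmem : ∀ z ∈ f '' S, ∀ t : unitInterval, (t : ℝ) • Function.invFunOn f S z ∈ S := by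
    rintro _ ⟨y, hy, rfl⟩ t
    rw [hi.leftInvOn_invFunOn hy]
    exact hs.smul_mem hy t.2.1 t.2.2
  refine hasLog_contr (fun t z => f ((t : ℝ) • Function.invFunOn f S z)) (f 0) ?_ ?_ ?_ ?_ hφ hn
  · refine hf.comp (ContinuousOn.smul (by fun_prop) (hinv.comp continuousOn_snd fun x hx => hx.2)) ?_
    intro x hx; exact hmem _ hx.2 _
  · intro t z hz; exact mem_image_of_mem _ (hmem z hz t)
  · intro z hz; simp
  · rintro _ ⟨y, hy, rfl⟩; simp [hi.leftInvOn_invFunOn hy]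

lemma hasLog_convex {K : Set ℂ} (hK : Convex ℝ K) {φ : ℂ → ℂ} (hφ : ContinuousOn φ K)
    (hn : ∀ z ∈ K, φ z ≠ 0) : HasLog K φ := by
  rcases K.eq_empty_or_nonempty with rfl | ⟨y, hy⟩
  · exact ⟨0, by simp, by simp⟩
  refine hasLog_contr (fun t z => AffineMap.lineMap y z (t : ℝ)) y ?_ ?_ ?_ ?_ hφ hn
  · simp only [AffineMap.lineMap_apply]; fun_prop
  · intro t z hz; exact hK.lineMap_mem hy hz t.2
  · intro z _; simp
  · intro z _; simp

lemma NS.symm {K p q} (h : NS K p q) : NS K q p := by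
  obtain ⟨C, a, b, c, d⟩ := h; exact ⟨C, a, b, d, c⟩

lemma NS.trans {K p q r} (h : NS K p q) (h' : NS K q r) : NS K p r := by
  obtain ⟨C, a, b, c, d⟩ := h; obtain ⟨C', a', b', c', d'⟩ := h'
  exact ⟨C ∪ C', union_subset a a', b.union q d c' b', .inl c, .inr d'⟩

lemma NS.mono {K L p q} (h : NS L p q) (hs : K ⊆ L) : NS K p q := by
  obtain ⟨C, a, b, c, d⟩ := h; exact ⟨C, a.trans (compl_subset_compl.2 hs), b, c, d⟩

lemma NS.joined {K p q} (hK : IsClosed K) (h : NS K p q) : JoinedIn Kᶜ p q := by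
  obtain ⟨C, a, b, c, d⟩ := h
  have hp : p ∈ Kᶜ := a c
  have ho : IsOpen (connectedComponentIn Kᶜ p) := hK.isOpen_compl.connectedComponentIn
  have hc : IsConnected (connectedComponentIn Kᶜ p) := isConnected_connectedComponentIn_iff.2 hp
  exact ((ho.isConnected_iff_isPathConnected.1 hc).joinedIn p (mem_connectedComponentIn hp) q
    (b.subset_connectedComponentIn c a d)).mono (connectedComponentIn_subset _ _)

lemma NS.mem_l {K p q} (h : NS K p q) : p ∉ K := by obtain ⟨C, a, b, c, d⟩ := h; exact a c
lemma NS.mem_r {K p q} (h : NS K p q) : q ∉ K := h.symm.mem_l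

lemma NS.iff_comp {K p q} : NS K p q ↔ p ∉ K ∧ q ∈ connectedComponentIn Kᶜ p := by
  constructor
  · intro h; have := h.mem_l; obtain ⟨C, a, b, c, d⟩ := h
    exact ⟨this, b.subset_connectedComponentIn c a d⟩
  · rintro ⟨h, h'⟩
    exact ⟨_, connectedComponentIn_subset _ _, isPreconnected_connectedComponentIn,
      mem_connectedComponentIn h, h'⟩

lemma NS.hasLog {K p q} (hK : IsClosed K) (h : NS K p q) : HasLog K (fun z => (z - p) / (z - q)) := by
  obtain ⟨c, hc⟩ := h.symm.joined hK
  have hne : ∀ t, ∀ z ∈ K, z - c t ≠ 0 := fun t z hz e => hc t (sub_eq_zero.1 e ▸ hz)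
  have hq : ∀ z ∈ K, z - q ≠ 0 := fun z hz e => h.mem_r (sub_eq_zero.1 e ▸ hz)
  have := hasLog_homotopy (K := K) (fun t z => (z - c t) / (z - q)) ?_ ?_ ?_
  · simpa using this
  · refine ContinuousOn.div (by fun_prop) (by fun_prop) fun x hx => hq _ hx.2
  · exact fun t z hz => div_ne_zero (hne t z hz) (hq z hz)
  · refine (HasLog.const one_ne_zero).congr fun z hz => ?_
    simp [div_self (hq z hz)]

lemma no_log_circle {p : ℂ} {r : ℝ} (hr : 0 < r) : ¬ HasLog (sphere p r) (fun z => z - p) := by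
  rintro ⟨g, g1, g2⟩
  have hm : ∀ t : ℝ, p + r * Complex.exp (t * Complex.I) ∈ sphere p r := by
    intro t; simp [Complex.norm_exp_ofReal_mul_I, abs_of_pos hr]
  have hcont : Continuous fun t : ℝ => g (p + r * Complex.exp (t * Complex.I)) - t * Complex.I :=
    (g1.comp_continuous (by fun_prop) hm).sub (by fun_prop)
  have hexp : ∀ t : ℝ, Complex.exp (g (p + r * Complex.exp (t * Complex.I)) - t * Complex.I) = r := by
    intro t
    rw [Complex.exp_sub, g2 _ (hm t)]; beta_reduce
    rw [add_sub_cancel_left, mul_div_assoc, div_self (Complex.exp_ne_zero _), mul_one]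
  have hconst : ∀ s t : ℝ, g (p + r * Complex.exp (s * Complex.I)) - s * Complex.I =
      g (p + r * Complex.exp (t * Complex.I)) - t * Complex.I := by
    intro s t
    have := Complex.isCoveringMap_exp.eq_of_comp_eq hcont (continuous_const (y := g (p + r * Complex.exp (t * Complex.I)) - t * Complex.I))
      (by ext s; simp [hexp]) t rfl
    exact congrFun this s
  have := hconst 0 (2 * Real.pi)
  have e : Complex.exp (((2 * Real.pi : ℝ) : ℂ) * Complex.I) = 1 := by
    push_cast; exact Complex.exp_two_pi_mul_I
  rw [e] at this
  simp only [Complex.ofReal_zero, zero_mul, Complex.exp_zero, sub_zero] at this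
  have h3 := sub_eq_self.1 this.symm
  simp at h3


lemma glue2 {X Y : Type*} [TopologicalSpace X] [TopologicalSpace Y] {K L : Set X} {f g : X → Y}
    (hK : IsClosed K) (hL : IsClosed L) (hf : ContinuousOn f K) (hg : ContinuousOn g L)
    (h : ∀ z ∈ K, z ∈ L → f z = g z) :
    ∃ F : X → Y, ContinuousOn F (K ∪ L) ∧ EqOn F f K ∧ EqOn F g L := by
  classical
  have h1 : EqOn (K.piecewise f g) f K := fun z hz => by simp [hz]
  have h2 : EqOn (K.piecewise f g) g L := fun z hz => by
    by_cases hk : z ∈ K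
    · simp [hk, h z hk hz]
    · simp [hk]
  exact ⟨_, (hf.congr h1).union_of_isClosed (hg.congr h2) hK hL, h1, h2⟩

lemma log_const {A : Set ℂ} {g g' : ℂ → ℂ} (hA : IsPreconnected A) (h : ContinuousOn g A)
    (h' : ContinuousOn g' A) (he : ∀ z ∈ A, Complex.exp (g z) = Complex.exp (g' z)) :
    ∃ c, Complex.exp c = 1 ∧ ∀ z ∈ A, g z = g' z + c := by
  rcases A.eq_empty_or_nonempty with rfl | ⟨y, hy⟩
  · exact ⟨0, by simp, by simp⟩
  refine ⟨g y - g' y, by rw [Complex.exp_sub, he y hy, div_self (Complex.exp_ne_zero _)], ?_⟩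
  have : PreconnectedSpace A := isPreconnected_iff_preconnectedSpace.1 hA
  have h3 := Complex.isCoveringMap_exp.eq_of_comp_eq (A := A) (g₁ := fun z => g z) (g₂ := fun z => g' z + (g y - g' y))
    (continuousOn_iff_continuous_domRestrict.1 h)
    ((continuousOn_iff_continuous_domRestrict.1 h').add continuous_const) ?_ ⟨y, hy⟩ (by simp)
  · exact fun z hz => congrFun h3 ⟨z, hz⟩
  · ext z; simp [Complex.exp_add, Complex.exp_sub, he y hy, he z z.2]

lemma HasLog.union {K L : Set ℂ} {f} (hK : IsClosed K) (hL : IsClosed L) (hc : IsPreconnected (K ∩ L))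
    (h : HasLog K f) (h' : HasLog L f) : HasLog (K ∪ L) f := by
  obtain ⟨g, h1, h2⟩ := h; obtain ⟨g', h1', h2'⟩ := h'
  obtain ⟨c, c1, c2⟩ := log_const hc (h1.mono inter_subset_left) (h1'.mono inter_subset_right)
    (fun z hz => by rw [h2 z hz.1, h2' z hz.2])
  obtain ⟨G, G1, G2, G3⟩ := glue2 hK hL h1 (h1'.add (continuousOn_const (c := c))) (fun z a b => c2 z ⟨a, b⟩)
  refine ⟨G, G1, ?_⟩
  rintro z (hz | hz)
  · rw [G2 hz, h2 z hz]
  · rw [G3 hz]; simp [Complex.exp_add, h2' z hz, c1]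

lemma conn_compl_closedBall (x : ℂ) (r : ℝ) : IsPreconnected (closedBall x r)ᶜ := by
  rcases le_or_gt r 0 with h | h
  · have hc : (closedBall x r).Countable := by
      refine (countable_singleton x).mono fun z hz => ?_
      have := mem_closedBall.1 hz
      exact dist_le_zero.1 (this.trans h)
    exact (hc.isConnected_compl_of_one_lt_rank (by simp)).isPreconnected
  have : (closedBall x r)ᶜ = (fun w => x + Complex.exp w) '' {w : ℂ | Real.log r < w.re} := by
    ext z; simp only [mem_compl_iff, mem_closedBall, not_le, mem_image, mem_ofPred_eq]
    constructor
    · intro hz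
      have h0 : z - x ≠ 0 := fun e => by rw [sub_eq_zero.1 e, dist_self] at hz; linarith
      refine ⟨Complex.log (z - x), ?_, by rw [Complex.exp_log h0]; ring⟩
      rw [Complex.log_re]; exact Real.log_lt_log h (by rwa [dist_eq_norm] at hz)
    · rintro ⟨w, hw, rfl⟩
      rw [dist_eq_norm, add_sub_cancel_left, Complex.norm_exp]
      exact (Real.log_lt_iff_lt_exp h).1 hw
  rw [this]
  refine (Convex.isPreconnected ?_).image _ (by fun_prop)
  exact convex_halfSpace_gt (f := Complex.re) ⟨fun _ _ => rfl, fun _ _ => by simp⟩ _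

lemma frontier_comp {K : Set ℂ} (hK : IsClosed K) (p : ℂ) : frontier (connectedComponentIn Kᶜ p) ⊆ K := by
  intro x hx
  by_contra hxK
  have ho : IsOpen (connectedComponentIn Kᶜ p) := hK.isOpen_compl.connectedComponentIn
  have ho' : IsOpen (connectedComponentIn Kᶜ x) := hK.isOpen_compl.connectedComponentIn
  rw [ho.frontier_eq] at hx
  obtain ⟨y, h1, h2⟩ := mem_closure_iff.1 hx.1 _ ho' (mem_connectedComponentIn hxK)
  rw [connectedComponentIn_eq h2, ← connectedComponentIn_eq h1] at hx
  exact hx.2 (mem_connectedComponentIn hxK)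

lemma ns_aux {K : Set ℂ} (hK : IsCompact K) {p q : ℂ}
    (h : HasLog K (fun z => (z - p) / (z - q))) (hq : q ∉ K) (hp : p ∉ K)
    (hb : Bornology.IsBounded (connectedComponentIn Kᶜ p)) : NS K p q := by
  classical
  by_contra hn
  set U := connectedComponentIn Kᶜ p with hU
  have hqU : q ∉ U := fun h => hn (NS.iff_comp.2 ⟨hp, h⟩)
  have ho : IsOpen U := hK.isClosed.isOpen_compl.connectedComponentIn
  have hpU : p ∈ U := mem_connectedComponentIn hp
  obtain ⟨g, g1, g2⟩ := h
  obtain ⟨G, hG⟩ := ContinuousMap.exists_restrict_eq hK.isClosed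
    (⟨fun x => g x, continuousOn_iff_continuous_domRestrict.1 g1⟩ : C(K, ℂ))
  have hG' : ∀ z ∈ K, G z = g z := fun z hz => congrArg (fun F : C(K, ℂ) => F ⟨z, hz⟩) hG
  have hF : Continuous (fun z => if z ∈ U then Complex.exp (G z) * (z - q) else z - p) := by
    refine Continuous.if (fun z hz => ?_) (by fun_prop) (by fun_prop)
    have hzK : z ∈ K := frontier_comp hK.isClosed p hz
    have h0 : z - q ≠ 0 := sub_ne_zero.2 fun e => hq (e ▸ hzK)
    rw [hG' z hzK, g2 z hzK, div_mul_cancel₀ _ h0]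
  have hF0 : ∀ z, (if z ∈ U then Complex.exp (G z) * (z - q) else z - p) ≠ 0 := by
    intro z; split_ifs with hz
    · refine mul_ne_zero (Complex.exp_ne_zero _) fun e => hqU ?_
      rwa [← sub_eq_zero.1 e]
    · exact fun e => hz (sub_eq_zero.1 e ▸ hpU)
  have := hasLog_convex convex_univ hF.continuousOn (fun z _ => hF0 z)
  obtain ⟨r, r0, hr⟩ := hb.subset_ball_lt 0 p
  refine no_log_circle (p := p) r0 ((this.mono (subset_univ _)).congr fun z hz => if_neg fun hz' => ?_)
  have := hr hz'
  rw [mem_ball, mem_sphere.1 hz] at this; exact lt_irrefl _ this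

lemma HasLog.ns {K : Set ℂ} (hK : IsCompact K) {p q : ℂ}
    (h : HasLog K (fun z => (z - p) / (z - q))) (hp : p ∉ K) (hq : q ∉ K) : NS K p q := by
  by_cases hb : Bornology.IsBounded (connectedComponentIn Kᶜ p)
  · exact ns_aux hK h hq hp hb
  by_cases hb' : Bornology.IsBounded (connectedComponentIn Kᶜ q)
  · exact (ns_aux hK (h.inv.congr fun z _ => inv_div _ _) hp hq hb').symm
  obtain ⟨r, r0, hr⟩ := hK.isBounded.subset_ball_lt 0 0
  have key : ∀ x, ¬ Bornology.IsBounded (connectedComponentIn Kᶜ x) → ∃ y ∈ connectedComponentIn Kᶜ x, y ∉ closedBall (0:ℂ) r := by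
    intro x hx; by_contra! hn; exact hx (isBounded_closedBall.subset hn)
  obtain ⟨y, y1, y2⟩ := key p hb
  obtain ⟨y', y1', y2'⟩ := key q hb'
  exact ((NS.iff_comp.2 ⟨hp, y1⟩).trans ⟨_, compl_subset_compl.2 (hr.trans ball_subset_closedBall),
    conn_compl_closedBall _ _, y2, y2'⟩).trans (NS.iff_comp.2 ⟨hq, y1'⟩).symm

/-- Janiszewski -/
lemma NS.union {K L : Set ℂ} (hK : IsCompact K) (hL : IsCompact L) (hc : IsPreconnected (K ∩ L)) {p q}
    (h : NS K p q) (h' : NS L p q) : NS (K ∪ L) p q :=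
  HasLog.ns (hK.union hL) ((h.hasLog hK.isClosed).union hK.isClosed hL.isClosed hc (h'.hasLog hL.isClosed))
    (by simp [h.mem_l, h'.mem_l]) (by simp [h.mem_r, h'.mem_r])

lemma ns_star {E : Type*} [NormedAddCommGroup E] [NormedSpace ℝ E] {S : Set E}
    (hS : IsCompact S) (hs : StarConvex ℝ 0 S) {f : E → ℂ} (hf : ContinuousOn f S)
    (hi : InjOn f S) {p q} (hp : p ∉ f '' S) (hq : q ∉ f '' S) : NS (f '' S) p q := by
  have h1 : ∀ z ∈ f '' S, z - p ≠ 0 := fun z hz e => hp (sub_eq_zero.1 e ▸ hz)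
  have h2 : ∀ z ∈ f '' S, z - q ≠ 0 := fun z hz e => hq (sub_eq_zero.1 e ▸ hz)
  exact HasLog.ns (hS.image_of_continuousOn hf) (hasLog_star hS hs hf hi
    (ContinuousOn.div (by fun_prop) (by fun_prop) h2) fun z hz => div_ne_zero (h1 z hz) (h2 z hz)) hp hq
end

section
open Set Filter Topology Metric

variable {E : Type*} [TopologicalSpace E]

def IsArc (A : Set E) (x y : E) : Prop := ∃ f : ℝ → E, ContinuousOn f (Icc 0 1) ∧
  InjOn f (Icc 0 1) ∧ f 0 = x ∧ f 1 = y ∧ f '' Icc 0 1 = A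

lemma isArc_map {f : ℝ → E} {a b : ℝ} (h : a < b) (hc : ContinuousOn f (Icc a b))
    (hi : InjOn f (Icc a b)) : IsArc (f '' Icc a b) (f a) (f b) := by
  have him : (fun t => (b - a) * t + a) '' Icc 0 1 = Icc a b := by
    have := image_affine_Icc' (sub_pos.2 h) a 0 1; simpa using this
  have hm : MapsTo (fun t => (b - a) * t + a) (Icc 0 1) (Icc a b) := fun t ht => him ▸ mem_image_of_mem _ ht
  refine ⟨f ∘ fun t => (b - a) * t + a, hc.comp (by fun_prop) hm, hi.comp ?_ hm, by simp, by simp, by rw [image_comp, him]⟩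
  intro s _ t _ e
  have : (b - a) * s = (b - a) * t := by simpa using e
  exact mul_left_cancel₀ (sub_pos.2 h).ne' this

lemma IsArc.symm {A : Set E} {x y : E} (h : IsArc A x y) : IsArc A y x := by
  obtain ⟨f, h1, h2, rfl, rfl, rfl⟩ := h
  have hm : MapsTo (fun t : ℝ => 1 - t) (Icc 0 1) (Icc 0 1) := fun t ht => ⟨by linarith [ht.2], by linarith [ht.1]⟩
  refine ⟨fun t => f (1 - t), h1.comp (by fun_prop) hm, fun s hs t ht e => ?_, by simp, by simp, ?_⟩
  · have := h2 (hm hs) (hm ht) e; dsimp at this; linarith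
  · ext z; constructor
    · rintro ⟨t, ht, rfl⟩; exact ⟨1 - t, hm ht, rfl⟩
    · rintro ⟨t, ht, rfl⟩; exact ⟨1 - t, hm ht, by simp⟩

lemma IsArc.compact {A : Set E} {x y : E} (h : IsArc A x y) : IsCompact A := by
  obtain ⟨f, h1, h2, rfl, rfl, rfl⟩ := h; exact isCompact_Icc.image_of_continuousOn h1
lemma IsArc.closed [T2Space E] {A : Set E} {x y : E} (h : IsArc A x y) : IsClosed A := h.compact.isClosed
lemma IsArc.conn {A : Set E} {x y : E} (h : IsArc A x y) : IsPreconnected A := by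
  obtain ⟨f, h1, h2, rfl, rfl, rfl⟩ := h; exact isPreconnected_Icc.image _ h1
lemma IsArc.left {A : Set E} {x y : E} (h : IsArc A x y) : x ∈ A := by
  obtain ⟨f, h1, h2, rfl, rfl, rfl⟩ := h; exact ⟨0, by simp, rfl⟩
lemma IsArc.right {A : Set E} {x y : E} (h : IsArc A x y) : y ∈ A := h.symm.left
lemma IsArc.ne {A : Set E} {x y : E} (h : IsArc A x y) : x ≠ y := by
  obtain ⟨f, h1, h2, rfl, rfl, rfl⟩ := h
  intro e; have := h2 (by simp) (by simp) e; norm_num at this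

lemma IsArc.ns {A : Set ℂ} {x y : ℂ} (h : IsArc A x y) {p q} (hp : p ∉ A) (hq : q ∉ A) : NS A p q := by
  obtain ⟨f, h1, h2, rfl, rfl, rfl⟩ := h
  exact ns_star isCompact_Icc ((convex_Icc 0 1).starConvex (by simp)) h1 h2 hp hq

lemma IsArc.diff_conn {A : Set E} {x y : E} (h : IsArc A x y) : IsPreconnected (A \ {x, y}) := by
  obtain ⟨f, h1, h2, rfl, rfl, rfl⟩ := h
  have : f '' Icc 0 1 \ {f 0, f 1} = f '' Ioo 0 1 := by
    ext z; constructor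
    · rintro ⟨⟨t, ht, rfl⟩, hz⟩
      refine ⟨t, ⟨lt_of_le_of_ne ht.1 ?_, lt_of_le_of_ne ht.2 ?_⟩, rfl⟩ <;> rintro rfl <;> simp at hz
    · rintro ⟨t, ht, rfl⟩
      refine ⟨⟨t, Ioo_subset_Icc_self ht, rfl⟩, ?_⟩
      rintro (e | e)
      · exact ht.1.ne' (h2 (Ioo_subset_Icc_self ht) (by simp) e)
      · exact ht.2.ne (h2 (Ioo_subset_Icc_self ht) (by simp) e)
  rw [this]
  exact isPreconnected_Ioo.image _ (h1.mono Ioo_subset_Icc_self)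

lemma IsArc.mid {A : Set E} {x y : E} (h : IsArc A x y) : (A \ {x, y}).Nonempty := by
  obtain ⟨f, h1, h2, rfl, rfl, rfl⟩ := h
  have hh : (1/2 : ℝ) ∈ Icc (0:ℝ) 1 := by constructor <;> norm_num
  refine ⟨f (1/2), ⟨1/2, hh, rfl⟩, ?_⟩
  rintro (e | e)
  · have := h2 hh (by simp) e; norm_num at this
  · have := h2 hh (by simp) e; norm_num at this

lemma IsArc.subset_closure {A : Set E} {x y : E} (h : IsArc A x y) : A ⊆ closure (A \ {x, y}) := by
  have h' := h
  obtain ⟨f, h1, h2, rfl, rfl, rfl⟩ := h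
  rintro _ ⟨t, ht, rfl⟩
  have : t ∈ closure (Ioo (0:ℝ) 1) := by rwa [closure_Ioo (by norm_num)]
  have h3 := ((h1 t ht).mono Ioo_subset_Icc_self).mem_closure_image this
  refine closure_mono ?_ h3
  rintro _ ⟨t, ht, rfl⟩
  refine ⟨⟨t, Ioo_subset_Icc_self ht, rfl⟩, ?_⟩
  rintro (e | e)
  · exact ht.1.ne' (h2 (Ioo_subset_Icc_self ht) (by simp) e)
  · exact ht.2.ne (h2 (Ioo_subset_Icc_self ht) (by simp) e)

lemma IsArc.concat {A B : Set E} {x y z : E} (h : IsArc A x y) (h' : IsArc B y z) (hd : A ∩ B ⊆ {y}) :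
    IsArc (A ∪ B) x z := by
  obtain ⟨f, h1, h2, rfl, rfl, rfl⟩ := h
  obtain ⟨g, h1', h2', e, rfl, rfl⟩ := h'
  have hm : MapsTo (fun t : ℝ => t - 1) (Icc 1 2) (Icc 0 1) := fun t ht => ⟨by linarith [ht.1], by linarith [ht.2]⟩
  obtain ⟨F, F1, F2, F3⟩ := glue2 (isClosed_Icc (a := (0:ℝ)) (b := 1)) (isClosed_Icc (a := (1:ℝ)) (b := 2)) h1
    (h1'.comp (by fun_prop : ContinuousOn (fun t : ℝ => t - 1) _) hm) (by
      intro t a b; have : t = 1 := le_antisymm a.2 b.1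
      subst this; simp [e])
  have hI : Icc (0:ℝ) 1 ∪ Icc 1 2 = Icc 0 2 := Icc_union_Icc_eq_Icc (by norm_num) (by norm_num)
  rw [hI] at F1
  have hB : F '' Icc 1 2 = g '' Icc 0 1 := by
    rw [F3.image_eq, image_comp]; congr 1; simp; norm_num
  have key : ∀ s ∈ Icc (0:ℝ) 1, ∀ t ∈ Icc (1:ℝ) 2, F s = F t → s = t := by
    intro s hs t ht e'
    have h3 : F s = f 1 := hd ⟨by rw [F2 hs]; exact ⟨s, hs, rfl⟩, by rw [e', ← hB]; exact ⟨t, ht, rfl⟩⟩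
    have h4 : s = 1 := h2 hs (by simp) (by rw [← F2 hs, h3])
    have h5 : t - 1 = 0 := h2' (hm ht) (by simp) (by rw [e, ← h3, e', F3 ht]; rfl)
    linarith
  have hi : InjOn F (Icc 0 2) := by
    intro s hs t ht e'
    rcases le_total s 1 with a | a <;> rcases le_total t 1 with b | b
    · exact h2 ⟨hs.1, a⟩ ⟨ht.1, b⟩ (by rw [← F2 ⟨hs.1, a⟩, ← F2 ⟨ht.1, b⟩, e'])
    · exact key _ ⟨hs.1, a⟩ _ ⟨b, ht.2⟩ e'
    · exact (key _ ⟨ht.1, b⟩ _ ⟨a, hs.2⟩ e'.symm).symm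
    · have := h2' (hm ⟨a, hs.2⟩) (hm ⟨b, ht.2⟩) (by have := e'; rwa [F3 ⟨a, hs.2⟩, F3 ⟨b, ht.2⟩] at this)
      dsimp at this; linarith
  have := isArc_map (by norm_num) F1 hi
  rw [← hI, image_union, F2.image_eq, hB, F2 (by simp : (0:ℝ) ∈ Icc (0:ℝ) 1), F3 (by norm_num : (2:ℝ) ∈ Icc (1:ℝ) 2)] at this
  convert this using 1
  simp; norm_num

lemma IsArc.split {A : Set E} {x y w : E} (h : IsArc A x y) (hw : w ∈ A) (hx : w ≠ x) (hy : w ≠ y) :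
    ∃ B C, IsArc B x w ∧ IsArc C w y ∧ B ∪ C = A ∧ B ∩ C = {w} := by
  obtain ⟨f, h1, h2, rfl, rfl, rfl⟩ := h
  obtain ⟨t, ht, rfl⟩ := hw
  have t0 : 0 < t := lt_of_le_of_ne ht.1 (by rintro rfl; exact hx rfl)
  have t1 : t < 1 := lt_of_le_of_ne ht.2 (by rintro rfl; exact hy rfl)
  have s1 : Icc 0 t ⊆ Icc (0:ℝ) 1 := Icc_subset_Icc_right t1.le
  have s2 : Icc t 1 ⊆ Icc (0:ℝ) 1 := Icc_subset_Icc_left t0.le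
  refine ⟨_, _, isArc_map t0 (h1.mono s1) (h2.mono s1), isArc_map t1 (h1.mono s2) (h2.mono s2), ?_, ?_⟩
  · rw [← image_union, Icc_union_Icc_eq_Icc t0.le t1.le]
  · rw [← h2.image_inter s1 s2, Icc_inter_Icc_eq_singleton t0.le t1.le, image_singleton]

lemma IsArc.first_hit {A : Set E} {x y S} (h : IsArc A x y) (hS : IsClosed S) (hn : (A ∩ S).Nonempty) (hx : x ∉ S) :
    ∃ w ∈ S, ∃ B ⊆ A, IsArc B x w ∧ B ∩ S = {w} := by
  obtain ⟨f, h1, h2, rfl, rfl, rfl⟩ := h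
  have hc : IsCompact (Icc (0:ℝ) 1 ∩ f ⁻¹' S) := by
    obtain ⟨u, hu, e⟩ := continuousOn_iff_isClosed.1 h1 S hS
    rw [inter_comm, e, inter_comm]; exact isCompact_Icc.inter_right hu
  obtain ⟨_, ⟨t, ht, rfl⟩, hz⟩ := hn
  obtain ⟨m, ⟨hm, hmS⟩, hmin⟩ := hc.exists_isLeast ⟨t, ht, hz⟩
  have m0 : 0 < m := lt_of_le_of_ne hm.1 (by rintro rfl; exact hx hmS)
  have s1 : Icc 0 m ⊆ Icc (0:ℝ) 1 := Icc_subset_Icc_right hm.2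
  refine ⟨f m, hmS, f '' Icc 0 m, image_mono s1, isArc_map m0 (h1.mono s1) (h2.mono s1), ?_⟩
  ext z; constructor
  · rintro ⟨⟨s, hs, rfl⟩, hs'⟩
    have := hmin ⟨s1 hs, hs'⟩
    rw [le_antisymm hs.2 this]; rfl
  · rintro rfl; exact ⟨⟨m, ⟨m0.le, le_rfl⟩, rfl⟩, hmS⟩

lemma isArc_segment {x y : ℂ} (h : x ≠ y) : IsArc (segment ℝ x y) x y := by
  refine ⟨AffineMap.lineMap x y, AffineMap.lineMap_continuous.continuousOn, (AffineMap.lineMap_injective ℝ h).injOn,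
    by simp, by simp, (segment_eq_image_lineMap ℝ x y).symm⟩

lemma IsArc.attach {c : Set ℂ} {y w w' : ℂ} (h : IsArc c y w) (hy : y ∉ segment ℝ w w') :
    ∃ c', IsArc c' y w' ∧ c' ⊆ c ∪ segment ℝ w w' := by
  obtain ⟨v, hv, B, hB, hBa, hBS⟩ := h.first_hit (S := segment ℝ w w')
    (by rw [segment_eq_image_lineMap]; exact (isCompact_Icc.image AffineMap.lineMap_continuous).isClosed) ⟨w, h.right, left_mem_segment _ _ _⟩ hy
  by_cases e : v = w'
  · subst e; exact ⟨B, hBa, hB.trans subset_union_left⟩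
  have hs : segment ℝ v w' ⊆ segment ℝ w w' := (convex_segment w w').segment_subset hv (right_mem_segment _ _ _)
  exact ⟨_, hBa.concat (isArc_segment e) fun z hz => hBS ▸ ⟨hz.1, hs hz.2⟩, union_subset_union hB hs⟩

lemma exists_arc {U : Set ℂ} (hU : IsOpen U) (hc : IsPreconnected U) {y u : ℂ} (hy : y ∉ U) (hu : u ∈ U)
    (hs : segment ℝ u y \ {y} ⊆ U) {w} (hw : w ∈ U) : ∃ c, IsArc c y w ∧ c ⊆ insert y U := by
  have step : ∀ w ∈ U, ∃ V, IsOpen V ∧ w ∈ V ∧ ∀ a ∈ V, ∀ b ∈ V,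
      (∃ c, IsArc c y a ∧ c ⊆ insert y U) → ∃ c, IsArc c y b ∧ c ⊆ insert y U := by
    intro w hw
    obtain ⟨r, r0, hr⟩ := Metric.isOpen_iff.1 hU w hw
    refine ⟨ball w r, isOpen_ball, mem_ball_self r0, fun a ha b hb ⟨c, c1, c2⟩ => ?_⟩
    have hab := ((convex_ball w r).segment_subset ha hb).trans hr
    obtain ⟨c', h1, h2⟩ := c1.attach (w' := b) (fun h => hy (hab h))
    exact ⟨c', h1, h2.trans (union_subset c2 (hab.trans (subset_insert _ _)))⟩
  by_contra hn
  let X := {a | ∃ c, IsArc c y a ∧ c ⊆ insert y U}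
  have h1 : IsOpen (U ∩ X) := by
    rw [isOpen_iff_mem_nhds]; rintro a ⟨ha, hX⟩
    obtain ⟨V, V1, V2, V3⟩ := step a ha
    filter_upwards [V1.mem_nhds V2, hU.mem_nhds ha] with b hb hb'
    exact ⟨hb', V3 a V2 b hb hX⟩
  have h2 : IsOpen (U \ X) := by
    rw [isOpen_iff_mem_nhds]; rintro a ⟨ha, hX⟩
    obtain ⟨V, V1, V2, V3⟩ := step a ha
    filter_upwards [V1.mem_nhds V2, hU.mem_nhds ha] with b hb hb'
    exact ⟨hb', fun hb'' => hX (V3 b hb a V2 hb'')⟩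
  have hne : y ≠ u := fun e => hy (e ▸ hu)
  obtain ⟨z, -, z1, z2⟩ := hc (U ∩ X) (U \ X) h1 h2 (fun z hz => (em (z ∈ X)).imp (fun h => ⟨hz, h⟩) (fun h => ⟨hz, h⟩))
    ⟨u, hu, hu, segment ℝ y u, isArc_segment hne, fun z hz => by
      by_cases e : z = y
      · exact .inl e
      · exact .inr (hs ⟨segment_symm ℝ y u ▸ hz, e⟩)⟩ ⟨w, hw, hw, hn⟩
  exact z2.2 z1.2
end

section
open Set Filter Topology Metric

variable {E : Type*} [TopologicalSpace E]

def IsJC (J : Set E) : Prop := ∃ γ : UnitAddCircle → E, Continuous γ ∧ Function.Injective γ ∧ range γ = J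

def JS (J : Set E) (a b : E) (A B : Set E) : Prop := IsArc A a b ∧ IsArc B a b ∧ A ∩ B = {a, b} ∧ A ∪ B = J

lemma JS.swap {J : Set E} {a b A B} (h : JS J a b A B) : JS J a b B A :=
  ⟨h.2.1, h.1, inter_comm A B ▸ h.2.2.1, union_comm A B ▸ h.2.2.2⟩
lemma JS.rev {J : Set E} {a b A B} (h : JS J a b A B) : JS J b a A B :=
  ⟨h.1.symm, h.2.1.symm, pair_comm a b ▸ h.2.2.1, h.2.2.2⟩

lemma JS.jordan {J : Set E} {a b A B} (h : JS J a b A B) : IsJC J := by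
  obtain ⟨⟨f, f1, f2, rfl, rfl, rfl⟩, hB, hi, rfl⟩ := h
  obtain ⟨g, g1, g2, e0, e1, rfl⟩ := hB.symm
  have hm1 : MapsTo (fun t : ℝ => 2 * t) (Icc 0 (1/2)) (Icc 0 1) := fun t ht => ⟨by linarith [ht.1], by linarith [ht.2]⟩
  have hm2 : MapsTo (fun t : ℝ => 2 * t - 1) (Icc (1/2) 1) (Icc 0 1) := fun t ht => ⟨by linarith [ht.1], by linarith [ht.2]⟩
  obtain ⟨F, F1, F2, F3⟩ := glue2 (isClosed_Icc (a := (0:ℝ)) (b := 1/2)) (isClosed_Icc (a := (1/2:ℝ)) (b := 1))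
    (f1.comp (by fun_prop : ContinuousOn (fun t : ℝ => 2 * t) _) hm1)
    (g1.comp (by fun_prop : ContinuousOn (fun t : ℝ => 2 * t - 1) _) hm2) (by
      intro t a b; have : t = 1/2 := le_antisymm a.2 b.1
      subst this; simp [e0])
  have F2' : ∀ t ∈ Icc (0:ℝ) (1/2), F t = f (2 * t) := fun t ht => F2 ht
  have F3' : ∀ t ∈ Icc (1/2:ℝ) 1, F t = g (2 * t - 1) := fun t ht => F3 ht
  rw [Icc_union_Icc_eq_Icc (by norm_num) (by norm_num)] at F1
  have key : ∀ s ∈ Ico (0:ℝ) 1, ∀ t ∈ Ico (0:ℝ) 1, s ≤ 1/2 → 1/2 ≤ t → F s = F t → s = t := by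
    intro s hs t ht a b e
    rw [F2' s ⟨hs.1, a⟩, F3' t ⟨b, ht.2.le⟩] at e
    have h1 := hm1 (⟨hs.1, a⟩ : s ∈ Icc _ _)
    have h2 := hm2 (⟨b, ht.2.le⟩ : t ∈ Icc _ _)
    have h3 : f (2 * s) ∈ ({f 0, f 1} : Set E) := hi ▸ ⟨⟨_, h1, rfl⟩, ⟨_, h2, e.symm⟩⟩
    rcases h3 with h3 | h3
    · have := g2 h2 (by simp) (by rw [← e, h3, e1] : g (2*t-1) = g 1)
      linarith [ht.2]
    · have h4 := g2 h2 (by simp) (by rw [← e, h3, e0] : g (2*t-1) = g 0)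
      have h5 := f2 h1 (by simp) h3
      linarith
  have hinj : ∀ s ∈ Ico (0:ℝ) 1, ∀ t ∈ Ico (0:ℝ) 1, F s = F t → s = t := by
    intro s hs t ht e
    rcases le_total s (1/2) with a | a <;> rcases le_total t (1/2) with b | b
    · rw [F2' s ⟨hs.1, a⟩, F2' t ⟨ht.1, b⟩] at e
      linarith [f2 (hm1 (⟨hs.1, a⟩ : s ∈ Icc _ _)) (hm1 (⟨ht.1, b⟩ : t ∈ Icc _ _)) e]
    · exact key s hs t ht a b e
    · exact (key t ht s hs b a e.symm).symm
    · rw [F3' s ⟨a, hs.2.le⟩, F3' t ⟨b, ht.2.le⟩] at e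
      linarith [g2 (hm2 (⟨a, hs.2.le⟩ : s ∈ Icc _ _)) (hm2 (⟨b, ht.2.le⟩ : t ∈ Icc _ _)) e]
  have hF1 : F 1 = f 0 := by rw [F3' 1 (by norm_num), ← e1]; norm_num
  have hF0 : F 0 = f 0 := by rw [F2' 0 (by norm_num)]; norm_num
  have hsur : ∀ x : UnitAddCircle, ∃ t ∈ Ico (0:ℝ) 1, (t : UnitAddCircle) = x := by
    intro x; have := AddCircle.coe_image_Ico_eq (1:ℝ) 0
    rw [zero_add] at this
    have h : x ∈ (fun t : ℝ => (t : UnitAddCircle)) '' Ico 0 1 := by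
      rw [show (fun t : ℝ => (t : UnitAddCircle)) '' Ico 0 1 = univ from this]; trivial
    exact h
  have hap : ∀ t ∈ Ico (0:ℝ) 1, AddCircle.liftIco 1 0 F (t : UnitAddCircle) = F t :=
    fun t ht => AddCircle.liftIco_zero_coe_apply ht
  refine ⟨AddCircle.liftIco 1 0 F, AddCircle.liftIco_continuous (by rw [zero_add, hF1, hF0]) (by simpa using F1), ?_, ?_⟩
  · intro x y e
    obtain ⟨s, hs, rfl⟩ := hsur x; obtain ⟨t, ht, rfl⟩ := hsur y
    rw [hap s hs, hap t ht] at e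
    rw [hinj s hs t ht e]
  · ext z; constructor
    · rintro ⟨x, rfl⟩
      obtain ⟨s, hs, rfl⟩ := hsur x
      rw [hap s hs]
      rcases le_total s (1/2) with a | a
      · left; rw [F2' s ⟨hs.1, a⟩]; exact ⟨_, hm1 ⟨hs.1, a⟩, rfl⟩
      · right; rw [F3' s ⟨a, hs.2.le⟩]; exact ⟨_, hm2 ⟨a, hs.2.le⟩, rfl⟩
    · have h0 : F 0 ∈ range (AddCircle.liftIco 1 0 F) := ⟨_, hap 0 (by norm_num)⟩
      rintro (⟨t, ht, rfl⟩ | ⟨t, ht, rfl⟩)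
      · refine ⟨((t / 2 : ℝ) : UnitAddCircle), ?_⟩
        rw [hap _ ⟨by linarith [ht.1], by linarith [ht.2]⟩, F2' _ ⟨by linarith [ht.1], by linarith [ht.2]⟩]; congr 1; ring
      · rcases eq_or_lt_of_le ht.2 with rfl | h1
        · rwa [e1, ← hF0]
        refine ⟨(((t + 1) / 2 : ℝ) : UnitAddCircle), ?_⟩
        rw [hap _ ⟨by linarith [ht.1], by linarith [ht.2]⟩, F3' _ ⟨by linarith [ht.1], by linarith [ht.2]⟩]; congr 1; ring

lemma js_param {γ : UnitAddCircle → E} (hc : Continuous γ) (hi : Function.Injective γ) {s t : ℝ} (h1 : s < t) (h2 : t < s + 1) :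
    JS (range γ) (γ s) (γ t) ((fun u : ℝ => γ u) '' Icc s t) ((fun u : ℝ => γ u) '' Icc t (s + 1)) := by
  have hcc : Continuous fun u : ℝ => γ u := hc.comp (AddCircle.continuous_mk' 1)
  have e : ((s + 1 : ℝ) : UnitAddCircle) = s := by simp
  have i1 : InjOn (fun u : ℝ => γ u) (Icc s t) := fun u hu v hv h =>
    (AddCircle.coe_eq_coe_iff_of_mem_Ico (p := 1) (a := s) ⟨hu.1, hu.2.trans_lt h2⟩ ⟨hv.1, hv.2.trans_lt h2⟩).1 (hi h)
  have i2 : InjOn (fun u : ℝ => γ u) (Icc t (s + 1)) := fun u hu v hv h =>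
    (AddCircle.coe_eq_coe_iff_of_mem_Ioc (p := 1) (a := s) ⟨h1.trans_le hu.1, hu.2⟩ ⟨h1.trans_le hv.1, hv.2⟩).1 (hi h)
  refine ⟨isArc_map h1 hcc.continuousOn i1, ?_, ?_, ?_⟩
  · have := isArc_map h2 hcc.continuousOn i2
    simp only [e] at this; exact this.symm
  · ext z; constructor
    · rintro ⟨⟨u, hu, rfl⟩, ⟨v, hv, h⟩⟩
      rcases eq_or_lt_of_le hv.2 with rfl | h3
      · left; simp only [e] at h; exact h.symm
      · have := (AddCircle.coe_eq_coe_iff_of_mem_Ico (p := 1) (a := s) ⟨hu.1, hu.2.trans_lt h2⟩ ⟨h1.le.trans hv.1, h3⟩).1 (hi h.symm)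
        right; subst this; rw [le_antisymm hu.2 hv.1]; rfl
    · rintro (rfl | rfl)
      · exact ⟨⟨s, ⟨le_rfl, h1.le⟩, rfl⟩, ⟨s + 1, ⟨h2.le, le_rfl⟩, by simp only [e]⟩⟩
      · exact ⟨⟨t, ⟨h1.le, le_rfl⟩, rfl⟩, ⟨t, ⟨le_rfl, h2.le⟩, rfl⟩⟩
  · have h := AddCircle.coe_image_Icc_eq (1:ℝ) s
    rw [← image_union, Icc_union_Icc_eq_Icc h1.le h2.le, ← image_univ, ← h, image_image]

lemma IsJC.compact {J : Set E} (h : IsJC J) : IsCompact J := by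
  obtain ⟨γ, h1, h2, rfl⟩ := h; exact isCompact_range h1
lemma IsJC.closed [T2Space E] {J : Set E} (h : IsJC J) : IsClosed J := h.compact.isClosed

lemma IsJC.split {J : Set E} (h : IsJC J) {a b} (ha : a ∈ J) (hb : b ∈ J) (hab : a ≠ b) : ∃ A B, JS J a b A B := by
  obtain ⟨γ, h1, h2, rfl⟩ := h
  obtain ⟨x, rfl⟩ := ha; obtain ⟨y, rfl⟩ := hb
  obtain ⟨s, rfl⟩ := QuotientAddGroup.mk_surjective x
  have := AddCircle.coe_image_Ico_eq (1:ℝ) s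
  have h : y ∈ (fun t : ℝ => (t : UnitAddCircle)) '' Ico s (s + 1) := by
    rw [show (fun t : ℝ => (t : UnitAddCircle)) '' Ico s (s + 1) = univ from this]; trivial
  obtain ⟨t, ht, rfl⟩ := h
  refine ⟨_, _, js_param h1 h2 (lt_of_le_of_ne ht.1 ?_) ht.2⟩
  rintro rfl; exact hab rfl

lemma IsJC.near {J : Set ℂ} (h : IsJC J) {x} (hx : x ∈ J) {ε : ℝ} (hε : 0 < ε) :
    ∃ a b A B, JS J a b A B ∧ x ∈ A ∧ x ∉ B ∧ A ⊆ ball x ε := by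
  obtain ⟨γ, h1, h2, rfl⟩ := h
  obtain ⟨x, rfl⟩ := hx
  obtain ⟨s, rfl⟩ := QuotientAddGroup.mk_surjective x
  have hcc : Continuous fun u : ℝ => γ u := h1.comp (AddCircle.continuous_mk' 1)
  obtain ⟨δ, d0, hd⟩ := Metric.continuous_iff.1 hcc s ε hε
  set r := min (δ / 2) (1/4)
  have r0 : 0 < r := by positivity
  have r1 : r ≤ 1/4 := min_le_right _ _
  have r2 : r ≤ δ/2 := min_le_left _ _
  have hjs := js_param h1 h2 (s := s - r) (t := s + r) (by linarith) (by linarith)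
  have hxA : γ s ∈ (fun u : ℝ => γ u) '' Icc (s - r) (s + r) := ⟨s, ⟨by linarith, by linarith⟩, rfl⟩
  refine ⟨_, _, _, _, hjs, hxA, fun hxB => ?_, ?_⟩
  · have h3 : γ s ∈ ({γ ↑(s - r), γ ↑(s + r)} : Set ℂ) := hjs.2.2.1 ▸ ⟨hxA, hxB⟩
    rcases h3 with h3 | h3
    · have := (AddCircle.coe_eq_coe_iff_of_mem_Ico (p := 1) (a := s - r) (x := s) (y := s - r) ⟨by linarith, by linarith⟩ ⟨by linarith, by linarith⟩).1 (h2 h3)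
      linarith
    · have := (AddCircle.coe_eq_coe_iff_of_mem_Ico (p := 1) (a := s - r) (x := s) (y := s + r) ⟨by linarith, by linarith⟩ ⟨by linarith, by linarith⟩).1 (h2 h3)
      linarith
  · rintro _ ⟨u, hu, rfl⟩
    exact hd u (by rw [Real.dist_eq, abs_lt]; constructor <;> linarith [hu.1, hu.2])
end

section
open Set Filter Topology Metric

lemma IsArc.log {A : Set ℂ} {a b : ℂ} (h : IsArc A a b) : HasLog Aᶜ (fun z => (z - a) / (z - b)) := by
  obtain ⟨f, f1, f2, f3, f4, f5⟩ := h.symm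
  have hm : ∀ t : unitInterval, f t ∈ A := fun t => f5 ▸ ⟨t, t.2, rfl⟩
  have hn : ∀ x ∈ A, ∀ z ∈ Aᶜ, z - x ≠ 0 := fun x hx z hz => sub_ne_zero.2 fun e => hz (e ▸ hx)
  have hb : b ∈ A := h.right
  have := hasLog_homotopy (K := Aᶜ) (fun t z => (z - f t) / (z - b)) ?_ ?_ ?_
  · simpa [f4] using this
  · refine ContinuousOn.div ?_ (by fun_prop) fun x hx => hn b hb _ hx.2
    refine continuousOn_snd.sub ?_
    exact f1.comp (by fun_prop) fun x _ => x.1.2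
  · exact fun t z hz => div_ne_zero (hn _ (hm t) z hz) (hn b hb z hz)
  · refine (HasLog.const one_ne_zero).congr fun z hz => ?_
    simp only [Icc.coe_zero, f3]
    rw [div_self (hn b hb z hz)]

lemma conn_frontier {X : Type*} [TopologicalSpace X] {C U : Set X} (h : IsPreconnected C) {p q} (hp : p ∈ C) (hpU : p ∈ U)
    (hq : q ∈ C) (hqU : q ∉ U) : ∃ z ∈ C, z ∈ frontier U := by
  by_contra! hn
  have h1 : p ∈ interior U := by_contra fun h' => hn p hp ⟨subset_closure hpU, h'⟩
  have h2 : q ∈ (closure U)ᶜ := fun h' => hn q hq ⟨h', fun h => hqU (interior_subset h)⟩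
  obtain ⟨z, -, z1, z2⟩ := h _ _ isOpen_interior isClosed_closure.isOpen_compl (fun z hz => by
    by_cases h' : z ∈ closure U
    · exact .inl (by_contra fun h'' => hn z hz ⟨h', h''⟩)
    · exact .inr h') ⟨p, hp, h1⟩ ⟨q, hq, h2⟩
  exact z2 (subset_closure (interior_subset z1))

lemma JS.sep {J : Set ℂ} {a b A B} (h : JS J a b A B) : ∃ p ∉ J, ∃ q ∉ J, ¬ NS J p q := by
  by_contra! hc
  obtain ⟨hA, hB, hi, hu⟩ := h
  have hpre : IsPreconnected Jᶜ := isPreconnected_of_forall_pair fun p hp q hq => by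
    obtain ⟨C, a, b, c, d⟩ := hc p hp q hq; exact ⟨C, a, c, d, b⟩
  obtain ⟨g, g1, g2⟩ := hA.log
  obtain ⟨k, k1, k2⟩ := hB.log
  have hJA : Jᶜ ⊆ Aᶜ := compl_subset_compl.2 (hu ▸ subset_union_left)
  have hJB : Jᶜ ⊆ Bᶜ := compl_subset_compl.2 (hu ▸ subset_union_right)
  obtain ⟨c, c1, c2⟩ := log_const hpre (g1.mono hJA) (k1.mono hJB) fun z hz => by
    rw [g2 z (hJA hz), k2 z (hJB hz)]
  have hl : HasLog {a, b}ᶜ (fun z => (z - a) / (z - b)) := by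
    classical
    let F : ℂ → ℂ := fun z => if z ∈ Aᶜ then g z else k z + c
    have F1 : EqOn F g Aᶜ := fun z hz => if_pos hz
    have F2 : EqOn F (fun z => k z + c) Bᶜ := fun z hz => by
      by_cases h : z ∈ Aᶜ
      · rw [F1 h]; exact c2 z (by rw [← hu]; rintro (h' | h'); exacts [h h', hz h'])
      · exact if_neg h
    have he : ({a, b}ᶜ : Set ℂ) = Aᶜ ∪ Bᶜ := by rw [← hi, compl_inter]
    refine ⟨F, ?_, ?_⟩
    · rw [he]
      exact (g1.congr F1).union_of_isOpen ((k1.add continuousOn_const).congr F2) hA.closed.isOpen_compl hB.closed.isOpen_compl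
    · rw [he]; rintro z (hz | hz)
      · rw [F1 hz, g2 z hz]
      · rw [F2 hz]; simp only [Complex.exp_add, c1, k2 z hz, mul_one]
  have hab : 0 < dist b a := dist_pos.2 hA.ne.symm
  have hsub : sphere a (dist b a / 2) ⊆ {a, b}ᶜ := by
    intro z hz; rw [mem_sphere] at hz
    rintro (rfl | rfl)
    · rw [dist_self] at hz; linarith
    · linarith
  have h2 : HasLog (sphere a (dist b a / 2)) (fun z => z - b) := by
    refine (hasLog_convex (convex_closedBall a (dist b a / 2)) (by fun_prop) ?_).mono sphere_subset_closedBall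
    intro z hz; rw [mem_closedBall] at hz
    exact sub_ne_zero.2 fun e => by rw [e] at hz; linarith
  refine no_log_circle (half_pos hab) (((hl.mono hsub).mul h2).congr fun z hz => ?_)
  exact div_mul_cancel₀ _ (sub_ne_zero.2 fun e => hsub hz (by simp [e]))

lemma IsJC.two {J : Set ℂ} (h : IsJC J) : ∃ a ∈ J, ∃ b ∈ J, a ≠ b := by
  obtain ⟨γ, h1, h2, rfl⟩ := h
  refine ⟨γ 0, ⟨_, rfl⟩, γ ((1/2 : ℝ)), ⟨_, rfl⟩, fun e => ?_⟩
  have := (AddCircle.coe_eq_coe_iff_of_mem_Ico (p := 1) (a := 0) (x := (0:ℝ)) (y := 1/2) (by norm_num) (by norm_num)).1 (by simpa using h2 e)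
  norm_num at this

lemma IsJC.sep {J : Set ℂ} (h : IsJC J) : ∃ p ∉ J, ∃ q ∉ J, ¬ NS J p q := by
  obtain ⟨a, ha, b, hb, hab⟩ := h.two
  obtain ⟨A, B, h'⟩ := h.split ha hb hab
  exact h'.sep

lemma IsJC.subset_closure {J : Set ℂ} (h : IsJC J) {p} (hp : p ∉ J) : J ⊆ closure (connectedComponentIn Jᶜ p) := by
  intro x hx; by_contra hn
  set U := connectedComponentIn Jᶜ p
  obtain ⟨ε, e0, he⟩ := Metric.isOpen_iff.1 isClosed_closure.isOpen_compl x hn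
  obtain ⟨a, b, A, B, hjs, -, -, hA⟩ := h.near hx e0
  have hfB : frontier U ⊆ B := fun z hz => by
    have h1 : z ∈ J := frontier_comp h.closed p hz
    rw [← hjs.2.2.2] at h1
    exact h1.resolve_left fun h2 => he (hA h2) (frontier_subset_closure hz)
  have hBJ : B ⊆ J := hjs.2.2.2 ▸ subset_union_right
  obtain ⟨q, hq, hqU⟩ : ∃ q ∉ J, q ∉ U := by
    by_contra! hc
    obtain ⟨q, hq, r, hr, hn⟩ := h.sep
    exact hn ((NS.iff_comp.2 ⟨hp, hc q hq⟩).symm.trans (NS.iff_comp.2 ⟨hp, hc r hr⟩))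
  obtain ⟨C, c1, c2, c3, c4⟩ := hjs.2.1.ns (fun h => hp (hBJ h)) (fun h => hq (hBJ h))
  obtain ⟨z, z1, z2⟩ := conn_frontier c2 c3 (mem_connectedComponentIn hp) c4 hqU
  exact c1 z1 (hfB z2)

lemma access {K : Set ℂ} (hK : IsClosed K) {p x : ℂ} (hx : x ∈ K) (hc : x ∈ closure (connectedComponentIn Kᶜ p)) {O : Set ℂ} (hO : IsOpen O) (hxO : x ∈ O) :
    ∃ u ∈ connectedComponentIn Kᶜ p, ∃ y ∈ K, y ∈ O ∧ segment ℝ u y \ {y} ⊆ connectedComponentIn Kᶜ p := by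
  obtain ⟨ε, e0, hO⟩ := Metric.isOpen_iff.1 hO x hxO
  obtain ⟨u, hu, hd⟩ := Metric.mem_closure_iff.1 hc (ε / 2) (half_pos e0)
  obtain ⟨y, hy, h2⟩ := hK.exists_infDist_eq_dist ⟨x, hx⟩ u
  have h3 : dist u y ≤ dist u x := h2 ▸ infDist_le_dist_of_mem hx
  have h4 : ball u (dist u y) ⊆ Kᶜ := fun z hz hzK => by
    have := infDist_le_dist_of_mem (x := u) hzK
    rw [mem_ball'] at hz; linarith
  have huy : 0 < dist u y := dist_pos.2 fun e => connectedComponentIn_subset _ _ hu (e ▸ hy)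
  have h5 : ball u (dist u y) ⊆ connectedComponentIn Kᶜ p := by
    rw [connectedComponentIn_eq hu]
    exact (convex_ball u _).isPreconnected.subset_connectedComponentIn (mem_ball_self huy) h4
  refine ⟨u, hu, y, hy, hO ?_, fun z hz => h5 ?_⟩
  · rw [mem_ball]; rw [dist_comm x u] at hd
    linarith [dist_triangle y u x, dist_comm u y]
  · obtain ⟨⟨a, b, ha, hb, hab, rfl⟩, hne⟩ := hz
    have : a ≠ 0 := by rintro rfl; apply hne; simp [show b = 1 by linarith]
    have ha' : 0 < a := lt_of_le_of_ne ha this.symm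
    rw [mem_ball, dist_eq_norm, show a • u + b • y - u = b • (y - u) by
      rw [show a = 1 - b by linarith, sub_smul, one_smul, smul_sub]; abel, norm_smul, Real.norm_of_nonneg hb, ← dist_eq_norm, dist_comm y u]
    nlinarith

lemma IsJC.chord {J : Set ℂ} (h : IsJC J) {p} (hp : p ∉ J) {O₁ O₂ : Set ℂ} (h1 : IsOpen O₁) (h2 : IsOpen O₂)
    (hd : Disjoint O₁ O₂) (n1 : (J ∩ O₁).Nonempty) (n2 : (J ∩ O₂).Nonempty) :
    ∃ y ∈ O₁, ∃ z ∈ O₂, y ∈ J ∧ z ∈ J ∧ ∃ c, IsArc c y z ∧ c \ {y, z} ⊆ connectedComponentIn Jᶜ p := by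
  obtain ⟨x1, hx1, ho1⟩ := n1
  obtain ⟨x2, hx2, ho2⟩ := n2
  obtain ⟨u, hu, y, hy, hyO, hs⟩ := access h.closed hx1 (h.subset_closure hp hx1) h1 ho1
  obtain ⟨v, hv, z, hz, hzO, ht⟩ := access h.closed hx2 (h.subset_closure hp hx2) h2 ho2
  have hU := connectedComponentIn_subset Jᶜ p
  obtain ⟨c, c1, c2⟩ := exists_arc h.closed.isOpen_compl.connectedComponentIn isPreconnected_connectedComponentIn
    (fun h => hU h hy) hu hs hv
  have hyz : y ≠ z := fun e => hd.le_bot ⟨hyO, e ▸ hzO⟩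
  obtain ⟨c', d1, d2⟩ := c1.attach (w' := z) fun hh => hU (ht ⟨hh, hyz⟩) hy
  refine ⟨y, hyO, z, hzO, hy, hz, c', d1, fun w hw => ?_⟩
  rcases d2 hw.1 with h3 | h3
  · exact (c2 h3).resolve_left fun e => hw.2 (.inl e)
  · exact ht ⟨h3, fun e => hw.2 (.inr e)⟩

lemma comp_disj {K : Set ℂ} {p r x : ℂ} (hp : x ∈ connectedComponentIn Kᶜ p) (hr : x ∈ connectedComponentIn Kᶜ r) : NS K p r := by
  have h1 := connectedComponentIn_eq hp
  have hpK := connectedComponentIn_nonempty_iff.1 ⟨x, hp⟩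
  have hrK := connectedComponentIn_nonempty_iff.1 ⟨x, hr⟩
  exact (NS.iff_comp.2 ⟨hpK, hp⟩).trans (NS.iff_comp.2 ⟨hrK, hr⟩).symm

lemma bridge {J : Set ℂ} (h : IsJC J) {p q r : ℂ} (hp : p ∉ J) (hq : q ∉ J) (hpr : ¬ NS J p r) (hqr : ¬ NS J q r)
    {y z A B c} (hjs : JS J y z A B) (hc : IsArc c y z) (hcr : c \ {y, z} ⊆ connectedComponentIn Jᶜ r) : NS (A ∪ c) p q := by
  obtain ⟨b, hb, hbn⟩ := hjs.2.1.mid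
  have hbJ : b ∈ J := hjs.2.2.2 ▸ .inr hb
  have key : ∀ p ∉ J, ¬ NS J p r → NS (A ∪ c) p b := by
    intro p hp hpr
    refine ⟨insert b (connectedComponentIn Jᶜ p), ?_, ?_, .inr (mem_connectedComponentIn hp), .inl rfl⟩
    · rintro w (rfl | hw)
      · rintro (hA | hc')
        · exact hbn (hjs.2.2.1 ▸ ⟨hA, hb⟩)
        · exact connectedComponentIn_subset _ _ (hcr ⟨hc', hbn⟩) hbJ
      · have hwJ := connectedComponentIn_subset _ _ hw
        rintro (hA | hc')
        · exact hwJ (hjs.2.2.2 ▸ .inl hA)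
        · refine hpr (comp_disj hw (hcr ⟨hc', ?_⟩))
          rintro (rfl | rfl)
          · exact hwJ (hjs.2.2.2 ▸ .inl hjs.1.left)
          · exact hwJ (hjs.2.2.2 ▸ .inl hjs.1.right)
    · exact isPreconnected_connectedComponentIn.subset_closure (subset_insert _ _)
        (insert_subset (h.subset_closure hp hbJ) subset_closure)
  exact (key p hp hpr).trans (key q hq hqr).symm

lemma IsJC.two_comps {J : Set ℂ} (h : IsJC J) {p q r} (hp : p ∉ J) (hq : q ∉ J) (hr : r ∉ J) (hpr : ¬ NS J p r)
    (hqr : ¬ NS J q r) : NS J p q := by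
  obtain ⟨a, ha, b, hb, hab⟩ := h.two
  obtain ⟨O₁, O₂, o1, o2, a1, b2, hd⟩ := t2_separation hab
  obtain ⟨y, hy, z, hz, hyJ, hzJ, c, hc, hcr⟩ := h.chord hr o1 o2 hd ⟨a, ha, a1⟩ ⟨b, hb, b2⟩
  obtain ⟨A, B, hjs⟩ := h.split hyJ hzJ fun e => hd.le_bot ⟨hy, e ▸ hz⟩
  have h1 := bridge h hp hq hpr hqr hjs hc hcr
  have h2 := bridge h hp hq hpr hqr hjs.swap hc hcr
  refine (h1.union (hjs.1.compact.union hc.compact) (hjs.2.1.compact.union hc.compact) ?_ h2).mono ?_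
  · rw [← inter_union_distrib_right, hjs.2.2.1, union_eq_self_of_subset_left]
    · exact hc.conn
    · rintro x (rfl | rfl); exacts [hc.left, hc.right]
  · rw [← hjs.2.2.2]; exact union_subset_union subset_union_left subset_union_left

def ext (K : Set ℂ) : Set ℂ := {p | p ∉ K ∧ ¬ Bornology.IsBounded (connectedComponentIn Kᶜ p)}
def ins (K : Set ℂ) : Set ℂ := {p | p ∉ K ∧ Bornology.IsBounded (connectedComponentIn Kᶜ p)}

lemma ns_far {K : Set ℂ} {R : ℝ} (hR : K ⊆ closedBall 0 R) {p q : ℂ} (hp : R < ‖p‖) (hq : R < ‖q‖) : NS K p q :=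
  ⟨_, compl_subset_compl.2 hR, conn_compl_closedBall 0 R, by simpa using hp, by simpa using hq⟩

lemma ns_comp {K : Set ℂ} {p q} (h : NS K p q) : connectedComponentIn Kᶜ p = connectedComponentIn Kᶜ q :=
  connectedComponentIn_eq (NS.iff_comp.1 h).2

lemma far_ext {K : Set ℂ} {R : ℝ} (hR : K ⊆ closedBall 0 R) {p : ℂ} (hp : R < ‖p‖) : p ∈ ext K := by
  refine ⟨fun h => absurd (hp.trans_le (by simpa using hR h)) (lt_irrefl _), fun hb => ?_⟩
  obtain ⟨S, hS⟩ := hb.subset_closedBall 0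
  set M : ℝ := max (max R S) 0 + 1
  have hM : ‖(M : ℂ)‖ = M := by rw [Complex.norm_real, Real.norm_of_nonneg]; positivity
  have h1 : R < ‖(M:ℂ)‖ := by rw [hM]; linarith [le_max_left (max R S) 0, le_max_left R S]
  have := hS ((NS.iff_comp.1 (ns_far hR hp h1)).2)
  rw [mem_closedBall_zero_iff, hM] at this
  linarith [le_max_left (max R S) 0, le_max_right R S]

lemma NS.ext {K : Set ℂ} {p q} (h : NS K p q) (hp : p ∈ ext K) : q ∈ ext K := ⟨h.mem_r, ns_comp h ▸ hp.2⟩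
lemma NS.ins {K : Set ℂ} {p q} (h : NS K p q) (hp : p ∈ ins K) : q ∈ ins K := ⟨h.mem_r, ns_comp h ▸ hp.2⟩

lemma ext_far {K : Set ℂ} {R : ℝ} (hR : K ⊆ closedBall 0 R) {p q : ℂ} (hp : p ∈ ext K) (hq : R < ‖q‖) : NS K p q := by
  have : ¬ connectedComponentIn Kᶜ p ⊆ closedBall 0 R := fun h => hp.2 (isBounded_closedBall.subset h)
  obtain ⟨r, h1, h2⟩ := not_subset.1 this
  exact (NS.iff_comp.2 ⟨hp.1, h1⟩).trans (ns_far hR (by simpa using h2) hq)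

lemma exists_far {K : Set ℂ} (hK : IsCompact K) : ∃ R q, K ⊆ closedBall 0 R ∧ R < ‖(q : ℂ)‖ := by
  obtain ⟨R, hR⟩ := hK.isBounded.subset_closedBall 0
  refine ⟨R, ((|R| + 1 : ℝ) : ℂ), hR, ?_⟩
  rw [Complex.norm_real, Real.norm_of_nonneg (by positivity)]; linarith [le_abs_self R]

lemma ext_ns {K : Set ℂ} (hK : IsCompact K) {p q} (hp : p ∈ ext K) (hq : q ∈ ext K) : NS K p q := by
  obtain ⟨R, r, hR, hr⟩ := exists_far hK
  exact (ext_far hR hp hr).trans (ext_far hR hq hr).symm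

lemma ext_union {K L : Set ℂ} (hK : IsCompact K) (hL : IsCompact L) (hc : IsPreconnected (K ∩ L)) :
    ext (K ∪ L) = ext K ∩ ext L := by
  obtain ⟨R, r, hR, hr⟩ := exists_far (hK.union hL)
  have hRK := subset_union_left.trans hR
  have hRL := subset_union_right.trans hR
  ext p; constructor
  · intro h
    have := ext_far hR h hr
    exact ⟨(this.mono subset_union_left).symm.ext (far_ext hRK hr), (this.mono subset_union_right).symm.ext (far_ext hRL hr)⟩
  · rintro ⟨h1, h2⟩
    exact (NS.union hK hL hc (ext_far hRK h1 hr) (ext_far hRL h2 hr)).symm.ext (far_ext hR hr)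

lemma comp_ext {K : Set ℂ} (hK : IsCompact K) {p} (hp : p ∈ ext K) : connectedComponentIn Kᶜ p = ext K := by
  ext q; constructor
  · exact fun h => (NS.iff_comp.2 ⟨hp.1, h⟩).ext hp
  · exact fun h => (NS.iff_comp.1 (ext_ns hK hp h)).2

lemma ext_nonempty {K : Set ℂ} (hK : IsCompact K) : (ext K).Nonempty := by
  obtain ⟨R, r, hR, hr⟩ := exists_far hK; exact ⟨r, far_ext hR hr⟩
lemma ext_conn {K : Set ℂ} (hK : IsCompact K) : IsPreconnected (ext K) := by
  obtain ⟨p, hp⟩ := ext_nonempty hK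
  rw [← comp_ext hK hp]; exact isPreconnected_connectedComponentIn
lemma ext_open {K : Set ℂ} (hK : IsCompact K) : IsOpen (ext K) := by
  obtain ⟨p, hp⟩ := ext_nonempty hK
  rw [← comp_ext hK hp]; exact hK.isClosed.isOpen_compl.connectedComponentIn
lemma ext_or_ins {K : Set ℂ} {p} (h : p ∉ K) : p ∈ ext K ∨ p ∈ ins K := by
  by_cases h' : Bornology.IsBounded (connectedComponentIn Kᶜ p)
  exacts [.inr ⟨h, h'⟩, .inl ⟨h, h'⟩]
lemma ins_not_ext {K : Set ℂ} {p} (h : p ∈ ins K) : p ∉ ext K := fun h' => h'.2 h.2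

lemma IsJC.ins_nonempty {J : Set ℂ} (h : IsJC J) : (ins J).Nonempty := by
  obtain ⟨p, hp, q, hq, hn⟩ := h.sep
  by_contra hc
  rw [not_nonempty_iff_eq_empty] at hc
  have : ∀ p ∉ J, p ∈ ext J := fun p hp => (ext_or_ins hp).resolve_right (by simp [hc])
  exact hn (ext_ns h.compact (this p hp) (this q hq))

lemma IsJC.ins_ns {J : Set ℂ} (h : IsJC J) {p q} (hp : p ∈ ins J) (hq : q ∈ ins J) : NS J p q := by
  obtain ⟨r, hr⟩ := ext_nonempty h.compact
  exact h.two_comps hp.1 hq.1 hr.1 (fun hh => ins_not_ext hp (hh.symm.ext hr)) (fun hh => ins_not_ext hq (hh.symm.ext hr))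

lemma IsJC.comp_ins {J : Set ℂ} (h : IsJC J) {p} (hp : p ∈ ins J) : connectedComponentIn Jᶜ p = ins J := by
  ext q; constructor
  · exact fun h' => (NS.iff_comp.2 ⟨hp.1, h'⟩).ins hp
  · exact fun h' => (NS.iff_comp.1 (h.ins_ns hp h')).2

lemma IsJC.ins_conn {J : Set ℂ} (h : IsJC J) : IsPreconnected (ins J) := by
  obtain ⟨p, hp⟩ := h.ins_nonempty
  rw [← h.comp_ins hp]; exact isPreconnected_connectedComponentIn
lemma IsJC.ins_open {J : Set ℂ} (h : IsJC J) : IsOpen (ins J) := by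
  obtain ⟨p, hp⟩ := h.ins_nonempty
  rw [← h.comp_ins hp]; exact h.closed.isOpen_compl.connectedComponentIn
lemma IsJC.ins_bdd {J : Set ℂ} (h : IsJC J) : Bornology.IsBounded (ins J) := by
  obtain ⟨p, hp⟩ := h.ins_nonempty
  rw [← h.comp_ins hp]; exact hp.2
lemma IsJC.cl_ins {J : Set ℂ} (h : IsJC J) : J ⊆ closure (ins J) := by
  obtain ⟨p, hp⟩ := h.ins_nonempty
  rw [← h.comp_ins hp]; exact h.subset_closure hp.1
lemma IsJC.cl_ext {J : Set ℂ} (h : IsJC J) : J ⊆ closure (ext J) := by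
  obtain ⟨p, hp⟩ := ext_nonempty h.compact
  rw [← comp_ext h.compact hp]; exact h.subset_closure hp.1

def cl (J : Set ℂ) : Set ℂ := J ∪ ins J
lemma cl_eq (J : Set ℂ) : cl J = (ext J)ᶜ := by
  ext p; constructor
  · rintro (h | h) h'
    exacts [h'.1 h, ins_not_ext h h']
  · intro h; by_cases hp : p ∈ J
    exacts [.inl hp, .inr ((ext_or_ins hp).resolve_left h)]
lemma IsJC.cl_closed {J : Set ℂ} (h : IsJC J) : IsClosed (cl J) := by
  rw [cl_eq]; exact (ext_open h.compact).isClosed_compl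
lemma IsJC.cl_closure {J : Set ℂ} (h : IsJC J) : cl J = closure (ins J) :=
  (union_subset h.cl_ins _root_.subset_closure).antisymm (closure_minimal subset_union_right h.cl_closed)
lemma IsJC.cl_compact {J : Set ℂ} (h : IsJC J) : IsCompact (cl J) := by
  rw [h.cl_closure]; exact h.ins_bdd.isCompact_closure
end

section
open Set Filter Topology Metric

lemma JS.chord {J : Set ℂ} {y z A B c} (h : JS J y z A B) (hc : IsArc c y z) (hd : c \ {y, z} ⊆ Jᶜ) : JS (A ∪ c) y z A c := by
  refine ⟨h.1, hc, ?_, rfl⟩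
  ext w; constructor
  · rintro ⟨h1, h2⟩; by_contra hn; exact hd ⟨h2, hn⟩ (h.2.2.2 ▸ .inl h1)
  · rintro (rfl | rfl); exacts [⟨h.1.left, hc.left⟩, ⟨h.1.right, hc.right⟩]

lemma JS.inter_chord {J : Set ℂ} {y z A B c} (h : JS J y z A B) (hc : IsArc c y z) : (A ∪ c) ∩ (B ∪ c) = c := by
  rw [← inter_union_distrib_right, h.2.2.1, union_eq_self_of_subset_left]
  rintro x (rfl | rfl); exacts [hc.left, hc.right]

lemma insert_ns {K S : Set ℂ} (hS : IsPreconnected S) (hK : S ⊆ Kᶜ) {x p} (hx : x ∈ closure S) (hxK : x ∉ K) (hp : p ∈ S) : NS K x p :=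
  ⟨insert x S, insert_subset hxK hK, hS.subset_closure (subset_insert _ _) (insert_subset hx subset_closure), .inl rfl, .inr hp⟩

lemma cross {J : Set ℂ} {y z A B c a b d r} (h : JS J y z A B) (hc : IsArc c y z) (hd : IsArc d a b)
    (ha : a ∈ A) (ha' : a ∉ ({y, z} : Set ℂ)) (hb : b ∈ B) (hb' : b ∉ ({y, z} : Set ℂ))
    (hcr : c \ {y, z} ⊆ connectedComponentIn Jᶜ r) (hdr : d \ {a, b} ⊆ connectedComponentIn Jᶜ r) : (c ∩ d).Nonempty := by
  by_contra hn
  have hJ := h.jordan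
  have hU := connectedComponentIn_subset Jᶜ r
  have haJ : a ∈ J := h.2.2.2 ▸ .inl ha
  have hbJ : b ∈ J := h.2.2.2 ▸ .inr hb
  have hcd : ∀ x ∈ c, x ∉ d := fun x h1 h2 => hn ⟨x, h1, h2⟩
  have haB : a ∉ B := fun hh => ha' (h.2.2.1 ▸ ⟨ha, hh⟩)
  have hbA : b ∉ A := fun hh => hb' (h.2.2.1 ▸ ⟨hh, hb⟩)
  have hcJ : c ⊆ J ∪ connectedComponentIn Jᶜ r := fun x hx => by
    by_cases hxy : x ∈ ({y, z} : Set ℂ)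
    · left; rw [← h.2.2.1] at hxy; exact h.2.2.2 ▸ .inl hxy.1
    · exact .inr (hcr ⟨hx, hxy⟩)
  obtain ⟨p, hp, hpr⟩ : ∃ p ∉ J, ¬ NS J p r := by
    by_contra! hcon
    obtain ⟨p, hp, q, hq, hh⟩ := hJ.sep
    exact hh ((hcon p hp).trans (hcon q hq).symm)
  have key : ∀ A B a b, JS J y z A B → b ∈ J → b ∉ A → b ∈ d → d \ {a, b} ⊆ connectedComponentIn Jᶜ r → IsArc d a b → ∀ m ∈ d \ {a, b}, NS (A ∪ c) m p := by
    intro A B a b h hb hbA hbd hdr hd m hm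
    have hbc : b ∉ A ∪ c := by rintro (h1 | h1); exacts [hbA h1, hcd b h1 hbd]
    refine (insert_ns hd.diff_conn ?_ (hd.subset_closure hbd) hbc hm).symm.trans (insert_ns isPreconnected_connectedComponentIn ?_ (hJ.subset_closure hp hb) hbc (mem_connectedComponentIn hp))
    · rintro x hx (h1 | h1)
      · exact hU (hdr hx) (h.2.2.2 ▸ .inl h1)
      · exact hcd x h1 hx.1
    · rintro x hx (h1 | h1)
      · exact connectedComponentIn_subset _ _ hx (h.2.2.2 ▸ .inl h1)
      · rcases hcJ h1 with h2 | h2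
        · exact connectedComponentIn_subset _ _ hx h2
        · exact hpr (comp_disj hx h2)
  obtain ⟨m, hm⟩ := hd.mid
  have k1 := key A B a b h hbJ hbA hd.right hdr hd m hm
  have k2 := key B A b a h.swap haJ haB hd.left (pair_comm a b ▸ hdr) hd.symm m (pair_comm a b ▸ hm)
  have := (k1.union (h.1.compact.union hc.compact) (h.2.1.compact.union hc.compact) (by rw [h.inter_chord hc]; exact hc.conn) k2).mono
    (h.2.2.2 ▸ union_subset_union subset_union_left subset_union_left : J ⊆ _)
  exact hpr (this.symm.trans (NS.iff_comp.2 ⟨connectedComponentIn_nonempty_iff.1 ⟨m, hdr hm⟩, hdr hm⟩).symm)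

lemma sub_comp {J S : Set ℂ} (hS : IsPreconnected S) (h : S ⊆ Jᶜ) {p} (hp : p ∈ S) : S ⊆ connectedComponentIn Jᶜ p :=
  hS.subset_connectedComponentIn hp h

lemma ext_mono {K L : Set ℂ} (hL : IsCompact L) (h : K ⊆ L) : ext L ⊆ ext K := fun p hp => by
  obtain ⟨R, q, hR, hq⟩ := exists_far hL
  exact ((ext_far hR hp hq).mono h).symm.ext (far_ext (h.trans hR) hq)

/-- a connected set in the complement touching ext is in ext -/
lemma ext_of_conn {K S : Set ℂ} (hS : IsPreconnected S) (h : S ⊆ Kᶜ) {p} (hp : p ∈ S) (hpe : p ∈ ext K) : S ⊆ ext K :=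
  fun q hq => (show NS K p q from ⟨S, h, hS, hp, hq⟩).ext hpe
lemma ins_of_conn {K S : Set ℂ} (hS : IsPreconnected S) (h : S ⊆ Kᶜ) {p} (hp : p ∈ S) (hpe : p ∈ ins K) : S ⊆ ins K :=
  fun q hq => (show NS K p q from ⟨S, h, hS, hp, hq⟩).ins hpe

section theta
variable {J A B c : Set ℂ} {y z : ℂ} (h : JS J y z A B) (hc : IsArc c y z) (hd : c \ {y, z} ⊆ ins J)

include h hc hd
lemma th_J1 : JS (A ∪ c) y z A c := h.chord hc fun _ hx => (hd hx).1
lemma th_c : c ⊆ cl J := fun x hx => by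
  by_cases hxy : x ∈ ({y, z} : Set ℂ)
  · left; rw [← h.2.2.1] at hxy; exact h.2.2.2 ▸ .inl hxy.1
  · exact .inr (hd ⟨hx, hxy⟩)
lemma th_ext : ext J = ext (A ∪ c) ∩ ext (B ∪ c) := by
  have hJ := h.jordan
  have h1 := (th_J1 h hc hd).jordan.compact
  have h2 := (th_J1 h.swap hc hd).jordan.compact
  rw [← ext_union h1 h2 (by rw [h.inter_chord hc]; exact hc.conn)]
  have hu : A ∪ c ∪ (B ∪ c) = J ∪ c := by rw [← h.2.2.2]; ext; simp; tauto
  rw [hu]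
  have hk : IsCompact (J ∪ c) := hJ.compact.union hc.compact
  refine subset_antisymm ?_ (ext_mono hk subset_union_left)
  obtain ⟨p, hp⟩ := ext_nonempty hk
  refine ext_of_conn (ext_conn hJ.compact) ?_ (ext_mono hk subset_union_left hp) hp
  rintro x hx (h3 | h3)
  · exact hx.1 h3
  · have := th_c h hc hd h3; rw [cl_eq] at this; exact this hx
lemma th_cl : cl J = cl (A ∪ c) ∪ cl (B ∪ c) := by
  rw [cl_eq, cl_eq, cl_eq, th_ext h hc hd, compl_inter]
lemma th_A : A \ {y, z} ⊆ ext (B ∪ c) := by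
  intro x hx
  have hxJ : x ∈ J := h.2.2.2 ▸ .inl hx.1
  have hn : x ∉ B ∪ c := by
    rintro (h1 | h1)
    · exact hx.2 (h.2.2.1 ▸ ⟨hx.1, h1⟩)
    · exact (hd ⟨h1, hx.2⟩).1 hxJ
  refine (ext_or_ins hn).resolve_right fun h2 => ?_
  obtain ⟨w, w1, w2⟩ := mem_closure_iff.1 (h.jordan.cl_ext hxJ) _ (th_J1 h.swap hc hd).jordan.ins_open h2
  rw [th_ext h hc hd] at w2
  exact ins_not_ext w1 w2.2
lemma th_sub : ins (A ∪ c) ⊆ (B ∪ c)ᶜ := by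
  rintro x hx (h1 | h1)
  · by_cases hxy : x ∈ ({y, z} : Set ℂ)
    · exact hx.1 (.inl (h.2.2.1 ▸ hxy : x ∈ A ∩ B).1)
    · exact ins_not_ext hx (th_A h.swap hc hd ⟨h1, hxy⟩)
  · exact hx.1 (.inr h1)
lemma th_disj : Disjoint (ins (A ∪ c)) (ins (B ∪ c)) := by
  rw [disjoint_left]; intro x h1 h2
  have j1 := (th_J1 h hc hd).jordan
  have j2 := (th_J1 h.swap hc hd).jordan
  have e : ins (A ∪ c) ⊆ ins (B ∪ c) := ins_of_conn j1.ins_conn (th_sub h hc hd) h1 h2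
  obtain ⟨a, ha⟩ := h.1.mid
  have : a ∈ cl (B ∪ c) := j2.cl_closure ▸ closure_mono e (j1.cl_ins (.inl ha.1))
  rw [cl_eq] at this; exact this (th_A h hc hd ha)
lemma th_inter : cl (A ∪ c) ∩ cl (B ∪ c) = c := by
  refine subset_antisymm ?_ fun x hx => ⟨.inl (.inr hx), .inl (.inr hx)⟩
  rintro x ⟨h1 | h1, h2 | h2⟩
  · exact h.inter_chord hc ▸ ⟨h1, h2⟩
  · exact absurd h1 (th_sub h.swap hc hd h2)
  · exact absurd h2 (th_sub h hc hd h1)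
  · exact absurd h2 (disjoint_left.1 (th_disj h hc hd) h1)
lemma th_ins1 : ins (A ∪ c) ⊆ ins J := fun x hx => by
  have h1 : x ∈ cl J := th_cl h hc hd ▸ .inl (.inr hx)
  refine h1.resolve_left fun h2 => ?_
  rw [← h.2.2.2] at h2
  rcases h2 with h2 | h2
  exacts [hx.1 (.inl h2), th_sub h hc hd hx (.inl h2)]
lemma th_ins : ins J \ c = ins (A ∪ c) ∪ ins (B ∪ c) := by
  refine subset_antisymm ?_ (union_subset (fun x hx => ⟨th_ins1 h hc hd hx, fun h => hx.1 (.inr h)⟩)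
    (fun x hx => ⟨th_ins1 h.swap hc hd hx, fun h => hx.1 (.inr h)⟩))
  rintro x ⟨h1, h2⟩
  have h3 : x ∈ cl J := .inr h1
  rw [th_cl h hc hd] at h3
  rcases h3 with (h3 | h3) | (h3 | h3)
  · exact absurd (h.2.2.2 ▸ (.inl (h3.resolve_right h2)) : x ∈ J) h1.1
  · exact .inl h3
  · exact absurd (h.2.2.2 ▸ (.inr (h3.resolve_right h2)) : x ∈ J) h1.1
  · exact .inr h3
end theta

structure PK (a b : Fin 3 → ℂ) (e : Fin 3 → Fin 3 → Set ℂ) : Prop where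
  arc : ∀ i j, IsArc (e i j) (a i) (b j)
  dis : ∀ i j i' j', (i, j) ≠ (i', j') → ∀ x ∈ e i j, x ∈ e i' j' → (i = i' ∧ x = a i) ∨ (j = j' ∧ x = b j)
  ai : Function.Injective a
  bi : Function.Injective b
  ab : ∀ i j, a i ≠ b j

def PK.J (e : Fin 3 → Fin 3 → Set ℂ) : Set ℂ := e 0 1 ∪ (e 2 1 ∪ e 2 0) ∪ (e 0 2 ∪ (e 1 2 ∪ e 1 0))

lemma PK.js {a b e} (h : PK a b e) : JS (PK.J e) (a 0) (b 0) (e 0 1 ∪ (e 2 1 ∪ e 2 0)) (e 0 2 ∪ (e 1 2 ∪ e 1 0)) := by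
  have hA := fun i j hij => h.ai.ne (a₁ := i) (a₂ := j) hij
  have hB := fun i j hij => h.bi.ne (a₁ := i) (a₂ := j) hij
  have key : ∀ i j : Fin 3, i ≠ 0 → j ≠ 0 → IsArc (e 0 j ∪ (e i j ∪ e i 0)) (a 0) (b 0) := by
    intro i j hi hj
    refine (h.arc 0 j).concat ((h.arc i j).symm.concat (h.arc i 0) ?_) ?_
    · rintro x ⟨h1, h2⟩
      rcases h.dis i j i 0 (by simp [hj]) x h1 h2 with h3 | h3
      exacts [h3.2, absurd h3.1 hj]
    · rintro x ⟨h1, h2 | h2⟩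
      · rcases h.dis 0 j i j (by simp [hi.symm]) x h1 h2 with h3 | h3
        exacts [absurd h3.1 hi.symm, h3.2]
      · rcases h.dis 0 j i 0 (by simp [hj]) x h1 h2 with h3 | h3
        exacts [absurd h3.1 hi.symm, absurd h3.1 hj]
  refine ⟨key 2 1 (by decide) (by decide), key 1 2 (by decide) (by decide), ?_, rfl⟩
  refine subset_antisymm ?_ ?_
  · rintro x ⟨h1 | h1 | h1, h2 | h2 | h2⟩ <;>
    · have := h.dis _ _ _ _ (by decide) x h1 h2
      simp at this
      try simp [this]
  · rintro x (rfl | rfl)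
    · exact ⟨.inl (h.arc 0 1).left, .inl (h.arc 0 2).left⟩
    · exact ⟨.inr (.inr (h.arc 2 0).right), .inr (.inr (h.arc 1 0).right)⟩

lemma PK.off {a b e} (h : PK a b e) (i : Fin 3) : e i i \ {a i, b i} ⊆ (PK.J e)ᶜ := by
  rintro x ⟨h1, h2⟩ h3
  rcases h3 with (h3 | h3 | h3) | (h3 | h3 | h3) <;>
  · have := h.dis _ _ _ _ (by fin_cases i <;> decide) x h1 h3
    refine h2 ?_
    simp only [mem_insert_iff, mem_singleton_iff]; tauto

lemma PK.two {a b e} (h : PK a b e) {r} (h0 : e 0 0 \ {a 0, b 0} ⊆ connectedComponentIn (PK.J e)ᶜ r)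
    (h1 : e 1 1 \ {a 1, b 1} ⊆ connectedComponentIn (PK.J e)ᶜ r) : False := by
  obtain ⟨x, x1, x2⟩ := cross h.js.rev (h.arc 0 0).symm (h.arc 1 1).symm (.inl (h.arc 0 1).right)
    (by simp [h.bi.eq_iff, (h.ab 0 1).symm]) (.inr (.inr (h.arc 1 0).left)) (by simp [h.ai.eq_iff, h.ab 1 0])
    (pair_comm (b 0) _ ▸ h0) (pair_comm (b 1) _ ▸ h1)
  have := h.dis _ _ _ _ (by decide) x x1 x2
  simp at this

lemma PK.perm {a b e} (h : PK a b e) (σ : Equiv.Perm (Fin 3)) : PK (a ∘ σ) (b ∘ σ) (fun i j => e (σ i) (σ j)) where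
  arc i j := h.arc _ _
  dis i j i' j' hn x h1 h2 := by
    have := h.dis (σ i) (σ j) (σ i') (σ j') (by simpa [σ.injective.eq_iff] using hn) x h1 h2
    simpa [σ.injective.eq_iff] using this
  ai := h.ai.comp σ.injective
  bi := h.bi.comp σ.injective
  ab i j := h.ab _ _

lemma PK.Jperm (e) (σ : Equiv.Perm (Fin 3)) : PK.J (fun i j => e (σ i) (σ j)) = PK.J e := by
  have : ∀ e, PK.J e = ⋃ i, ⋃ j, {x | i ≠ j ∧ x ∈ e i j} := by
    intro e; ext x; simp [PK.J, Fin.exists_fin_succ]; tauto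
  rw [this, this]; ext x; simp only [mem_iUnion]
  constructor
  · rintro ⟨i, j, h⟩; exact ⟨σ i, σ j, fun h' => h.1 (σ.injective h'), h.2⟩
  · rintro ⟨i, j, h⟩; exact ⟨σ.symm i, σ.symm j, fun h' => h.1 (σ.symm.injective h'), by simpa using h.2⟩

theorem PK.false {a b e} (h : PK a b e) : False := by
  have hJ := h.js.jordan
  obtain ⟨p, hp⟩ := hJ.ins_nonempty
  obtain ⟨q, hq⟩ := ext_nonempty hJ.compact
  have key : ∀ r, ∀ i j : Fin 3, i ≠ j → e i i \ {a i, b i} ⊆ connectedComponentIn (PK.J e)ᶜ r →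
      e j j \ {a j, b j} ⊆ connectedComponentIn (PK.J e)ᶜ r → False := by
    intro r i j hij hi hj
    obtain ⟨σ, h0, h1⟩ : ∃ σ : Equiv.Perm (Fin 3), σ 0 = i ∧ σ 1 = j := by
      clear hi hj; revert i j; decide
    have := (h.perm σ).two (r := r)
    simp only [PK.Jperm, Function.comp, h0, h1] at this
    exact this hi hj
  have hs : ∀ i, e i i \ {a i, b i} ⊆ connectedComponentIn (PK.J e)ᶜ p ∨ e i i \ {a i, b i} ⊆ connectedComponentIn (PK.J e)ᶜ q := by
    intro i
    obtain ⟨m, hm⟩ := (h.arc i i).mid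
    rcases ext_or_ins (h.off i hm) with h1 | h1
    · right; rw [comp_ext hJ.compact hq]; exact ext_of_conn (h.arc i i).diff_conn (h.off i) hm h1
    · left; rw [hJ.comp_ins hp]; exact ins_of_conn (h.arc i i).diff_conn (h.off i) hm h1
  rcases hs 0 with h0 | h0 <;> rcases hs 1 with h1 | h1 <;> rcases hs 2 with h2 | h2
  all_goals first
    | exact key _ 0 1 (by decide) h0 h1
    | exact key _ 0 2 (by decide) h0 h2
    | exact key _ 1 2 (by decide) h1 h2
end

section
open Set Filter Topology Metric

/-- uniform local connectivity -/
lemma IsJC.ulc {J : Set ℂ} (h : IsJC J) {x} (hx : x ∈ J) {ε : ℝ} (hε : 0 < ε) :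
    ∃ δ > 0, δ ≤ ε ∧ ∀ p ∈ ins J ∩ ball x δ, ∀ q ∈ ins J ∩ ball x δ, ∃ C ⊆ ins J ∩ ball x ε, IsPreconnected C ∧ p ∈ C ∧ q ∈ C := by
  obtain ⟨a, b, A, B, hjs, hxA, hxB, hA⟩ := h.near hx hε
  obtain ⟨δ, d0, hd⟩ := Metric.isOpen_iff.1 hjs.2.1.closed.isOpen_compl x hxB
  refine ⟨min δ ε, lt_min d0 hε, min_le_right _ _, fun p hp q hq => ?_⟩
  have hb : ∀ p ∈ ball x (min δ ε), p ∈ ball x δ ∧ p ∈ ball x ε := fun p hp =>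
    ⟨ball_subset_ball (min_le_left _ _) hp, ball_subset_ball (min_le_right _ _) hp⟩
  have h2 : NS (sphere x ε ∪ B) p q := by
    refine ⟨ball x (min δ ε), ?_, (convex_ball _ _).isPreconnected, hp.2, hq.2⟩
    rintro z hz (h1 | h1)
    · have := (hb z hz).2; rw [mem_sphere] at h1; rw [mem_ball] at this; linarith
    · exact hd (hb z hz).1 h1
  have hi : J ∩ (sphere x ε ∪ B) = B := by
    rw [← hjs.2.2.2]; ext z; constructor
    · rintro ⟨h1 | h1, h2 | h2⟩
      · have := hA h1; rw [mem_sphere] at h2; rw [mem_ball] at this; linarith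
      all_goals assumption
    · exact fun h => ⟨.inr h, .inr h⟩
  obtain ⟨C, c1, c2, c3, c4⟩ := (h.ins_ns hp.1 hq.1).union h.compact ((isCompact_sphere x ε).union hjs.2.1.compact)
    (by rw [hi]; exact hjs.2.1.conn) h2
  refine ⟨C, fun z hz => ⟨ins_of_conn c2 (fun w hw hwJ => c1 hw (.inl hwJ)) c3 hp.1 hz, ?_⟩, c2, c3, c4⟩
  by_contra hn
  obtain ⟨w, w1, w2⟩ := conn_frontier c2 c3 (hb p hp.2).2 hz hn
  exact c1 w1 (.inr (.inl (frontier_ball_subset_sphere w2)))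

lemma arc_in_open {U : Set ℂ} (hU : IsOpen U) {C : Set ℂ} (hC : IsPreconnected C) (hCU : C ⊆ U) {y w} (hy : y ∈ C) (hw : w ∈ C) (hne : w ≠ y) :
    ∃ c, IsArc c y w ∧ c ⊆ U := by
  have step : ∀ w ∈ U, ∃ V, IsOpen V ∧ w ∈ V ∧ ∀ a ∈ V, ∀ b ∈ V,
      (a = y ∨ ∃ c, IsArc c y a ∧ c ⊆ U) → (b = y ∨ ∃ c, IsArc c y b ∧ c ⊆ U) := by
    intro w hw
    obtain ⟨r, r0, hr⟩ := Metric.isOpen_iff.1 hU w hw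
    by_cases hwy : w = y
    · subst hwy
      refine ⟨ball w r, isOpen_ball, mem_ball_self r0, fun a ha b hb _ => ?_⟩
      by_cases e : b = w
      · exact .inl e
      · exact .inr ⟨_, isArc_segment (Ne.symm e), ((convex_ball w r).segment_subset (mem_ball_self r0) hb).trans hr⟩
    · have hwy' : 0 < dist w y := dist_pos.2 hwy
      refine ⟨ball w (min r (dist w y)), isOpen_ball, mem_ball_self (lt_min r0 hwy'), fun a ha b hb hX => ?_⟩
      have hyn : y ∉ ball w (min r (dist w y)) := fun h => by
        rw [mem_ball, dist_comm] at h; exact absurd (h.trans_le (min_le_right _ _)) (lt_irrefl _)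
      have hab := (convex_ball w _).segment_subset ha hb
      rcases hX with rfl | ⟨c, c1, c2⟩
      · exact absurd ha hyn
      · obtain ⟨c', h1, h2⟩ := c1.attach (w' := b) (fun h => hyn (hab h))
        exact .inr ⟨c', h1, h2.trans (union_subset c2 (hab.trans ((ball_subset_ball (min_le_left _ _)).trans hr)))⟩
  by_contra hn
  let X := {a | a = y ∨ ∃ c, IsArc c y a ∧ c ⊆ U}
  have h1 : IsOpen (U ∩ X) := by
    rw [isOpen_iff_mem_nhds]; rintro a ⟨ha, hX⟩
    obtain ⟨V, V1, V2, V3⟩ := step a ha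
    filter_upwards [V1.mem_nhds V2, hU.mem_nhds ha] with b hb hb'
    exact ⟨hb', V3 a V2 b hb hX⟩
  have h2 : IsOpen (U \ X) := by
    rw [isOpen_iff_mem_nhds]; rintro a ⟨ha, hX⟩
    obtain ⟨V, V1, V2, V3⟩ := step a ha
    filter_upwards [V1.mem_nhds V2, hU.mem_nhds ha] with b hb hb'
    exact ⟨hb', fun hb'' => hX (V3 b hb a V2 hb'')⟩
  obtain ⟨z, -, z1, z2⟩ := hC (U ∩ X) (U \ X) h1 h2 (fun z hz => (em (z ∈ X)).imp (fun h => ⟨hCU hz, h⟩) (fun h => ⟨hCU hz, h⟩))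
    ⟨y, hy, hCU hy, .inl rfl⟩ ⟨w, hw, hCU hw, fun h => hn (h.resolve_left hne)⟩
  exact z2.2 z1.2

lemma inf_concat {D : ℕ → Set ℂ} {h : ℕ → ℂ} {x : ℂ} (hD : ∀ n, IsArc (D n) (h n) (h (n + 1)))
    (hd : ∀ m n, m < n → D m ∩ D n ⊆ {h n}) (hsm : ∀ ε > 0, ∃ N : ℕ, ∀ n ≥ N, D n ⊆ ball x ε) (hx : ∀ n, x ∉ D n) :
    IsArc (insert x (⋃ n, D n)) (h 0) x := by
  choose f f1 f2 f3 f4 f5 using hD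
  let H : ℝ → ℂ := fun t => f ⌊t⌋₊ (t - ⌊t⌋₊)
  have hfl : ∀ t : ℝ, 0 ≤ t → t - ⌊t⌋₊ ∈ Icc (0:ℝ) 1 := fun t ht =>
    ⟨sub_nonneg.2 (Nat.floor_le ht), by linarith [Nat.lt_floor_add_one t]⟩
  have hHD : ∀ t : ℝ, 0 ≤ t → H t ∈ D ⌊t⌋₊ := fun t ht => f5 _ ▸ ⟨_, hfl t ht, rfl⟩
  have hHn : ∀ n : ℕ, ∀ t ∈ Icc (n:ℝ) (n + 1), H t = f n (t - n) := by
    intro n t ht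
    rcases eq_or_lt_of_le ht.2 with rfl | h1
    · have : ⌊(n:ℝ) + 1⌋₊ = n + 1 := by exact_mod_cast Nat.floor_natCast (R := ℝ) (n + 1)
      simp only [H, this]; push_cast; simp [f3, f4]
    · have : ⌊t⌋₊ = n := by rw [Nat.floor_eq_iff (le_trans (Nat.cast_nonneg n) ht.1)]; exact ⟨ht.1, h1⟩
      simp only [H, this]
  have hHc : ∀ n : ℕ, ContinuousOn H (Icc 0 n) := by
    intro n; induction n with
    | zero => simp
    | succ n ih =>
      have : ContinuousOn H (Icc (n:ℝ) (n + 1)) := by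
        refine ((f1 n).comp (f := fun t : ℝ => t - n) (by fun_prop) ?_).congr (hHn n)
        intro t ht; exact ⟨by linarith [ht.1], by linarith [ht.2]⟩
      have h2 := ih.union_of_isClosed this isClosed_Icc isClosed_Icc
      rw [Icc_union_Icc_eq_Icc (Nat.cast_nonneg n) (by linarith)] at h2
      push_cast; exact h2
  have hHi : ∀ s t : ℝ, 0 ≤ s → s < t → H s ≠ H t := by
    intro s t hs hst e
    have ht := hs.trans hst.le
    rcases eq_or_lt_of_le (Nat.floor_mono hst.le) with hf | hf
    · have : s - ⌊s⌋₊ = t - ⌊s⌋₊ := f2 _ (hfl s hs) (by simpa [hf] using hfl t ht) (by simpa [H, hf] using e)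
      linarith
    · have h1 : H s ∈ D ⌊s⌋₊ ∩ D ⌊t⌋₊ := ⟨hHD s hs, e ▸ hHD t ht⟩
      have h2 : H s = h ⌊t⌋₊ := hd _ _ hf h1
      have h3 : h ⌊t⌋₊ ∈ D ⌊s⌋₊ := h2 ▸ h1.1
      rcases eq_or_lt_of_le (Nat.succ_le_of_lt hf) with h4 | h4
      · have : f ⌊s⌋₊ (s - ⌊s⌋₊) = f ⌊s⌋₊ 1 := by rw [f4]; simpa [H, ← h4] using h2
        have := f2 _ (hfl s hs) (by simp) this
        linarith [Nat.lt_floor_add_one s]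
      · obtain ⟨k, hk⟩ : ∃ k, ⌊t⌋₊ = k + 1 := ⟨⌊t⌋₊ - 1, by omega⟩
        have h5 : h (k + 1) ∈ D k := f5 k ▸ ⟨1, by simp, f4 k⟩
        have h6 : h (k + 1) = h k := hd ⌊s⌋₊ k (by omega) ⟨hk ▸ h3, h5⟩
        have : (1:ℝ) = 0 := f2 k (by simp) (by simp) (by rw [f4, f3, h6])
        norm_num at this
  let K : ℝ → ℂ := fun s => if s < 1 then H (s / (1 - s)) else x
  have hK : ∀ s, s < 1 → K s = H (s / (1 - s)) := fun s hs => if_pos hs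
  have hK1 : K 1 = x := if_neg (lt_irrefl _)
  have hq : ∀ s : ℝ, 0 ≤ s → s < 1 → 0 ≤ s / (1 - s) := fun s h0 h1 => div_nonneg h0 (by linarith)
  have hxH : ∀ t : ℝ, 0 ≤ t → H t ≠ x := fun t ht e => hx _ (e ▸ hHD t ht)
  have hmono : ∀ s t : ℝ, 0 ≤ s → s < t → t < 1 → s / (1 - s) < t / (1 - t) := fun s t h0 h1 h2 => by
    rw [div_lt_div_iff₀ (by linarith) (by linarith)]; nlinarith
  have hKi : ∀ s ∈ Icc (0:ℝ) 1, ∀ t ∈ Icc (0:ℝ) 1, s < t → K s ≠ K t := by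
    intro s hs t ht hst
    rw [hK s (hst.trans_le ht.2)]
    rcases eq_or_lt_of_le ht.2 with rfl | h1
    · rw [hK1]; exact hxH _ (hq s hs.1 hst)
    · rw [hK t h1]; exact hHi _ _ (hq s hs.1 (hst.trans h1)) (hmono s t hs.1 hst h1)
  refine ⟨K, ?_, ?_, ?_, hK1, ?_⟩
  · intro s hs
    rcases eq_or_lt_of_le hs.2 with rfl | h1
    · rw [Metric.continuousWithinAt_iff]
      intro ε hε
      obtain ⟨N, hN⟩ := hsm ε hε
      refine ⟨1 / (N + 2), by positivity, fun {t} ht hd => ?_⟩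
      rw [hK1]
      rcases eq_or_lt_of_le ht.2 with rfl | h2
      · rw [hK1, dist_self]; exact hε
      · rw [hK t h2, ← mem_ball]
        refine hN _ ?_ (hHD _ (hq t ht.1 h2))
        rw [ge_iff_le, Nat.le_floor_iff (hq t ht.1 h2), le_div_iff₀ (by linarith)]
        rw [Real.dist_eq, abs_lt, lt_div_iff₀' (by positivity)] at hd
        have h3 := hd.1
        rw [neg_lt, lt_div_iff₀' (by positivity)] at h3
        nlinarith
    · obtain ⟨N, hN⟩ := exists_nat_gt (s / (1 - s))
      have hc : ContinuousWithinAt H (Ici 0) (s / (1 - s)) := by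
        refine (hHc N _ ⟨hq s hs.1 h1, hN.le⟩).mono_of_mem_nhdsWithin ?_
        rw [← Ici_inter_Iic]
        exact inter_mem_nhdsWithin _ (Iic_mem_nhds hN)
      have hc2 : ContinuousWithinAt (fun s : ℝ => H (s / (1 - s))) (Icc 0 1 ∩ Iio 1) s := by
        refine hc.comp (f := fun s : ℝ => s / (1 - s)) ?_ fun t ht => hq t ht.1.1 ht.2
        exact (continuousAt_id.div (by fun_prop) (by simp; linarith)).continuousWithinAt
      refine ((hc2.congr (fun t ht => hK t ht.2) (hK s h1)).mono_of_mem_nhdsWithin ?_)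
      exact inter_mem_nhdsWithin _ (Iio_mem_nhds h1)
  · intro s hs t ht e
    rcases lt_trichotomy s t with h1 | h1 | h1
    exacts [absurd e (hKi s hs t ht h1), h1, absurd e.symm (hKi t ht s hs h1)]
  · rw [hK 0 (by norm_num)]; simp [H, f3]
  · ext z; constructor
    · rintro ⟨t, ht, rfl⟩
      rcases eq_or_lt_of_le ht.2 with rfl | h2
      · exact .inl hK1
      · rw [hK t h2]; exact .inr (mem_iUnion.2 ⟨_, hHD _ (hq t ht.1 h2)⟩)
    · rintro (rfl | hz)
      · exact ⟨1, by simp, hK1⟩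
      · obtain ⟨n, hn⟩ := mem_iUnion.1 hz
        rw [← f5] at hn
        obtain ⟨t, ht, rfl⟩ := hn
        have hp : (0:ℝ) ≤ t + n := add_nonneg ht.1 (Nat.cast_nonneg n)
        have hlt : (t + n) / (1 + (t + n)) < 1 := by rw [div_lt_one (by linarith)]; linarith
        refine ⟨(t + n) / (1 + (t + n)), ⟨by positivity, hlt.le⟩, ?_⟩
        rw [hK _ hlt]
        have : (t + n) / (1 + (t + n)) / (1 - (t + n) / (1 + (t + n))) = t + n := by
          have : 1 + (t + n) ≠ 0 := by positivity
          field_simp; simp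
        rw [this, hHn n _ ⟨by linarith [ht.1], by linarith [ht.2]⟩]; simp
end

section
open Set Filter Topology Metric

lemma IsJC.acc {J : Set ℂ} (hJ : IsJC J) {x p} (hx : x ∈ J) (hp : p ∈ ins J) : ∃ c, IsArc c x p ∧ c ⊆ insert x (ins J) := by
  have hxi : x ∉ ins J := fun h => h.1 hx
  have hw : ∀ ε > 0, ∃ w ∈ ins J, w ∈ ball x ε := fun ε hε => by
    obtain ⟨w, w1, w2⟩ := Metric.mem_closure_iff.1 (hJ.cl_closure ▸ Or.inl hx : x ∈ closure (ins J)) ε hε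
    exact ⟨w, w1, by rwa [mem_ball, dist_comm]⟩
  choose δ δ0 δl hδ using fun ε : Ioi (0:ℝ) => hJ.ulc hx ε.2
  let P : Set ℂ × Set ℂ × ℂ × ℂ × Ioi (0:ℝ) → Prop := fun (C, d, h, w, r) =>
    IsClosed C ∧ h ∈ C ∧ C ∩ ball x r = ∅ ∧ C ⊆ ins J ∧ IsArc d h w ∧ d ⊆ ins J ∧ C ∩ d ⊆ {h} ∧ w ∈ ball x (δ r)
  have step : ∀ s : {s // P s}, ∃ s' : {s // P s}, ∃ D, IsArc D s.1.2.2.1 s'.1.2.2.1 ∧ D ⊆ s.1.2.1 ∧ s'.1.1 = s.1.1 ∪ D ∧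
      s'.1.2.1 ⊆ ball x s.1.2.2.2.2 ∧ (s'.1.2.2.2.2 : ℝ) ≤ s.1.2.2.2.2 / 2 := by
    rintro ⟨⟨C, d, h, w, r⟩, C1, hC, Cr, CJ, hd, dJ, Cd, hwr⟩
    obtain ⟨ρ, ρ0, hρ⟩ := Metric.isOpen_iff.1 (C1.union hd.closed).isOpen_compl x (fun h => hxi (h.elim (fun h => CJ h) (fun h => dJ h)))
    have r0 : (0:ℝ) < r := r.2
    let r' : Ioi (0:ℝ) := ⟨min ρ (r / 2), lt_min ρ0 (by linarith)⟩
    obtain ⟨w1, h1, h2⟩ := hw (min (δ r') (δ r)) (lt_min (δ0 _) (δ0 _))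
    have h3 : w1 ∈ ball x (δ r') := ball_subset_ball (min_le_left _ _) h2
    have h4 : w1 ∉ C ∪ d := hρ (ball_subset_ball ((δl r').trans (min_le_left _ _)) h3)
    obtain ⟨C0, c1, c2, c3, c4⟩ := hδ r w1 ⟨h1, ball_subset_ball (min_le_right _ _) h2⟩ w ⟨dJ hd.right, hwr⟩
    obtain ⟨e, e1, e2⟩ := arc_in_open (hJ.ins_open.inter isOpen_ball) c2 c1 c3 c4 (fun e => h4 (.inr (e ▸ hd.right)))
    obtain ⟨h', i1, d', i2, i3, i4⟩ := e1.first_hit hd.closed ⟨w, e1.right, hd.right⟩ (fun h => h4 (.inr h))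
    have hb : h' ∈ ball x r := (e2 (i2 i3.right)).2
    have hCb : ∀ z ∈ C, z ∉ ball x r := fun z hz hz' => by have : z ∈ C ∩ ball x r := ⟨hz, hz'⟩; rw [Cr] at this; exact this
    obtain ⟨D, D1, D2⟩ : ∃ D, IsArc D h h' ∧ D ⊆ d := by
      by_cases hh : h' = w
      · exact ⟨d, hh ▸ hd, le_rfl⟩
      · obtain ⟨B, _, b1, _, b3, _⟩ := hd.split i1 (fun e => hCb h hC (e ▸ hb)) hh
        exact ⟨B, b1, b3 ▸ subset_union_left⟩
    refine ⟨⟨⟨C ∪ D, d', h', w1, r'⟩, C1.union D1.closed, .inr D1.right, ?_, union_subset CJ (D2.trans dJ), i3.symm, fun z hz => (e2 (i2 hz)).1, ?_, h3⟩,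
      D, D1, D2, rfl, fun z hz => (e2 (i2 hz)).2, min_le_right _ _⟩
    · rw [eq_empty_iff_forall_notMem]
      rintro z ⟨z1, z2⟩
      exact hρ (ball_subset_ball (min_le_left _ _) z2) (z1.imp_right (fun h => D2 h))
    · rintro z ⟨z1 | z1, z2⟩
      · exact absurd (e2 (i2 z2)).2 (hCb z z1)
      · rw [← i4]; exact ⟨z2, D2 z1⟩
  choose nx D D1 D2 D3 D4 D5 using step
  have hpx : 0 < dist p x := dist_pos.2 (fun e => hxi (e ▸ hp))
  let r0 : Ioi (0:ℝ) := ⟨dist p x, hpx⟩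
  obtain ⟨w, w1, w2⟩ := hw (δ r0) (δ0 r0)
  have hpr : p ∉ ball x r0 := fun h => lt_irrefl (dist p x) (mem_ball.1 h)
  obtain ⟨d, d1, d2⟩ := arc_in_open hJ.ins_open hJ.ins_conn le_rfl hp w1 (fun e => hpr (e ▸ ball_subset_ball (δl r0) w2))
  let s0 : {s // P s} := ⟨⟨{p}, d, p, w, r0⟩, isClosed_singleton, rfl, by simpa [r0] using le_rfl, by simpa using hp, d1, d2, inter_subset_left, w2⟩
  let s : ℕ → {s // P s} := fun n => nx^[n] s0
  have hs : ∀ n, s (n + 1) = nx (s n) := fun n => Function.iterate_succ_apply' nx n s0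
  have hr : ∀ n, ((s n).1.2.2.2.2 : ℝ) ≤ dist p x / 2 ^ n := by
    intro n; induction n with
    | zero => simp [s, s0, r0]
    | succ n ih => rw [hs, pow_succ, ← div_div]; exact (D5 _).trans (by linarith)
  have hCm : ∀ m n, m < n → D (s m) ⊆ (s n).1.1 := by
    intro m n hmn; induction n, hmn using Nat.le_induction with
    | base => rw [hs, D3]; exact subset_union_right
    | succ n _ ih => rw [hs, D3]; exact ih.trans subset_union_left
  have hDi : ∀ n, D (s n) ⊆ ins J := fun n => (D2 _).trans (s n).2.2.2.2.2.2.1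
  refine ⟨insert x (⋃ n, D (s n)), (inf_concat (h := fun n => (s n).1.2.2.1) (fun n => ?_) (fun m n hmn => ?_) (fun ε hε => ?_) fun n h => hxi (hDi n h)).symm,
    insert_subset_insert (iUnion_subset hDi)⟩
  · have := D1 (s n); rwa [← hs] at this
  · exact (inter_subset_inter (hCm m n hmn) (D2 _)).trans (s n).2.2.2.2.2.2.2.1
  · obtain ⟨N, hN⟩ := ((tendsto_const_nhds.div_atTop (tendsto_pow_atTop_atTop_of_one_lt (one_lt_two (α := ℝ)))).eventually (gt_mem_nhds hε) : ∀ᶠ n : ℕ in atTop, dist p x / 2 ^ n < ε).exists_forall_of_atTop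
    refine ⟨N + 1, fun n hn => ?_⟩
    obtain ⟨k, rfl⟩ : ∃ k, n = k + 1 := ⟨n - 1, by omega⟩
    refine (D2 _).trans ?_
    rw [hs]
    exact (D4 _).trans (ball_subset_ball ((hr k).trans (hN k (by omega)).le))

lemma IsJC.chord_at {J : Set ℂ} (hJ : IsJC J) {y z} (hy : y ∈ J) (hz : z ∈ J) (hne : y ≠ z) :
    ∃ c, IsArc c y z ∧ c \ {y, z} ⊆ ins J := by
  obtain ⟨p, hp⟩ := hJ.ins_nonempty
  obtain ⟨c, c1, c2⟩ := hJ.acc hy hp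
  obtain ⟨d, d1, d2⟩ := hJ.acc hz hp
  have hyd : y ∉ d := fun h => (d2 h).elim hne (fun h => h.1 hy)
  obtain ⟨w, w1, B, B1, B2, B3⟩ := c1.first_hit d1.closed ⟨p, c1.right, d1.right⟩ hyd
  have hwz : w ≠ z := by
    rintro rfl; exact (c2 (B1 B2.right)).elim (fun h => hne h.symm) (fun h => h.1 hz)
  obtain ⟨D, D1, D2⟩ : ∃ D, IsArc D w z ∧ D ⊆ d := by
    by_cases hh : w = p
    · exact ⟨d, hh ▸ d1.symm, le_rfl⟩
    · obtain ⟨E, _, b1, _, b3, _⟩ := d1.split w1 hwz hh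
      exact ⟨E, b1.symm, b3 ▸ subset_union_left⟩
  refine ⟨B ∪ D, B2.concat D1 (B3 ▸ inter_subset_inter_right _ D2), ?_⟩
  rintro q ⟨h1 | h1, h2⟩
  · exact (c2 (B1 h1)).resolve_left (fun e => h2 (.inl e))
  · exact (d2 (D2 h1)).resolve_left (fun e => h2 (.inr e))
end

section
open Set Filter Topology Metric

lemma IsArc.image {E F : Type*} [TopologicalSpace E] [TopologicalSpace F] {A : Set E} {x y} (h : IsArc A x y) {f : E → F} (hf : ContinuousOn f A)
    (hi : InjOn f A) : IsArc (f '' A) (f x) (f y) := by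
  obtain ⟨g, h1, h2, rfl, rfl, rfl⟩ := h
  exact ⟨f ∘ g, hf.comp h1 (mapsTo_image _ _), hi.comp h2 (mapsTo_image _ _), rfl, rfl, image_comp _ _ _⟩

lemma JS.image {E F : Type*} [TopologicalSpace E] [TopologicalSpace F] {J A B : Set E} {x y} (h : JS J x y A B) {f : E → F} (hf : ContinuousOn f J)
    (hi : InjOn f J) : JS (f '' J) (f x) (f y) (f '' A) (f '' B) := by
  obtain ⟨h1, h2, h3, rfl⟩ := h
  refine ⟨h1.image (hf.mono subset_union_left) (hi.mono subset_union_left), h2.image (hf.mono subset_union_right) (hi.mono subset_union_right), ?_, (image_union _ _ _).symm⟩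
  rw [← hi.image_inter subset_union_left subset_union_right, h3, image_pair]

lemma IsJC.image {E F : Type*} [TopologicalSpace E] [TopologicalSpace F] {J : Set E} (h : IsJC J) {f : E → F} (hf : ContinuousOn f J)
    (hi : InjOn f J) : IsJC (f '' J) := by
  obtain ⟨γ, h1, h2, rfl⟩ := h
  exact ⟨f ∘ γ, hf.comp_continuous h1 mem_range_self, fun s t e => h2 (hi (mem_range_self _) (mem_range_self _) e), range_comp _ _⟩

abbrev pj (b : Bool) (G : Set (Bool → ℂ)) : Set ℂ := (fun p => p b) '' G
def Valid (G : Set (Bool → ℂ)) : Prop := IsJC G ∧ ∀ b, InjOn (fun p : Bool → ℂ => p b) G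

lemma Valid.jc {G} (h : Valid G) (b) : IsJC (pj b G) := h.1.image (by fun_prop) (h.2 b)

structure Sbd (G : Set (Bool → ℂ)) (S : Set (Set (Bool → ℂ))) : Prop where
  fin : S.Finite
  val : ∀ i ∈ S, Valid i
  sub : ∀ i ∈ S, ∀ b, cl (pj b i) ⊆ cl (pj b G)
  cov : ∀ b, ∀ x ∈ cl (pj b G), ∃ i ∈ S, x ∈ cl (pj b i)
  link : ∀ b, ∀ i ∈ S, ∀ j ∈ S, i ≠ j → ∀ x ∈ cl (pj b i), x ∈ cl (pj b j) → ∃ p ∈ i, p ∈ j ∧ p b = x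
  inh : ∀ b, ∀ p ∈ G, ∀ i ∈ S, p b ∈ cl (pj b i) → p ∈ i

lemma Sbd.self {G} (h : Valid G) : Sbd G {G} where
  fin := finite_singleton _
  val := by rintro _ rfl; exact h
  sub := by rintro _ rfl b; exact le_rfl
  cov := fun b x hx => ⟨G, rfl, hx⟩
  link := by rintro b _ rfl _ rfl h; exact absurd rfl h
  inh := by rintro b p hp _ rfl _; exact hp

lemma Sbd.trans {G S} (h : Sbd G S) {T : Set (Bool → ℂ) → Set (Set (Bool → ℂ))} (hT : ∀ i ∈ S, Sbd i (T i)) : Sbd G (⋃ i ∈ S, T i) where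
  fin := h.fin.biUnion fun i hi => (hT i hi).fin
  val := by simp only [mem_iUnion]; rintro j ⟨i, hi, hj⟩; exact (hT i hi).val j hj
  sub := by simp only [mem_iUnion]; rintro j ⟨i, hi, hj⟩ b; exact ((hT i hi).sub j hj b).trans (h.sub i hi b)
  cov := fun b x hx => by
    obtain ⟨i, hi, hx⟩ := h.cov b x hx
    obtain ⟨j, hj, hx⟩ := (hT i hi).cov b x hx
    exact ⟨j, mem_biUnion hi hj, hx⟩
  link := by
    simp only [mem_iUnion]; rintro b k ⟨i, hi, hk⟩ l ⟨j, hj, hl⟩ hne x h1 h2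
    by_cases hij : i = j
    · subst hij; exact (hT i hi).link b k hk l hl hne x h1 h2
    · obtain ⟨p, p1, p2, rfl⟩ := h.link b i hi j hj hij x ((hT i hi).sub k hk b h1) ((hT j hj).sub l hl b h2)
      exact ⟨p, (hT i hi).inh b p p1 k hk h1, (hT j hj).inh b p p2 l hl h2, rfl⟩
  inh := by
    simp only [mem_iUnion]; rintro b p hp k ⟨i, hi, hk⟩ h1
    exact (hT i hi).inh b p (h.inh b p hp i hi ((hT i hi).sub k hk b h1)) k hk h1

lemma arc_pair {c : Bool → Set ℂ} {p q : Bool → ℂ} (h : ∀ b, IsArc (c b) (p b) (q b)) :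
    ∃ C, IsArc C p q ∧ ∀ b, pj b C = c b ∧ InjOn (fun p : Bool → ℂ => p b) C := by
  choose f f1 f2 f3 f4 f5 using h
  refine ⟨(fun t b => f b t) '' Icc (0:ℝ) 1, ⟨fun t b => f b t, continuousOn_pi.2 f1, fun s hs t ht e => f2 true hs ht (congrFun e true), funext f3, funext f4, rfl⟩, fun b => ⟨?_, ?_⟩⟩
  · rw [pj, image_image, ← f5]
  · rintro _ ⟨s, hs, rfl⟩ _ ⟨t, ht, rfl⟩ e
    simp only [f2 b hs ht e]

lemma Valid.cutC {G} (h : Valid G) {p q C} {c : Bool → Set ℂ} (hp : p ∈ G) (hq : q ∈ G) (C1 : IsArc C p q)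
    (C2 : ∀ b, pj b C = c b ∧ InjOn (fun p : Bool → ℂ => p b) C) (c2 : ∀ b, c b \ {p b, q b} ⊆ ins (pj b G)) {A B} (hj : JS G p q A B) :
    Sbd G {A ∪ C, B ∪ C} ∧ (∀ b, pj b (A ∪ C) = pj b A ∪ c b) ∧ ∀ b, pj b (B ∪ C) = pj b B ∪ c b := by
  have c1 : ∀ b, IsArc (c b) (p b) (q b) := fun b => by rw [← (C2 b).1]; exact C1.image (by fun_prop) (C2 b).2
  have hjb := fun b => hj.image (f := fun p : Bool → ℂ => p b) (by fun_prop) (h.2 b)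
  have key : ∀ {A B}, JS G p q A B → Valid (A ∪ C) ∧ ∀ b, pj b (A ∪ C) = pj b A ∪ c b := by
    intro A B hj
    have hA : A ⊆ G := hj.2.2.2 ▸ subset_union_left
    have k : ∀ b, ∀ x ∈ A, ∀ y ∈ C, x b = y b → x = y ∧ (x = p ∨ x = q) := by
      intro b x hx y hy e
      have h1 : x b ∈ c b := (C2 b).1 ▸ ⟨y, hy, e.symm⟩
      have h2 : x b = p b ∨ x b = q b := by
        by_contra hn; exact (c2 b ⟨h1, hn⟩).1 ⟨x, hA hx, rfl⟩
      rcases h2 with h2 | h2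
      · have := h.2 b (hA hx) hp h2
        exact ⟨this.trans ((C2 b).2 C1.left hy (h2.symm.trans e)), .inl this⟩
      · have := h.2 b (hA hx) hq h2
        exact ⟨this.trans ((C2 b).2 C1.right hy (h2.symm.trans e)), .inr this⟩
    have : JS (A ∪ C) p q A C := ⟨hj.1, C1, subset_antisymm (fun x hx => (k true x hx.1 x hx.2 rfl).2) (by
      rintro x (rfl | rfl); exacts [⟨hj.1.left, C1.left⟩, ⟨hj.1.right, C1.right⟩]), rfl⟩
    refine ⟨⟨this.jordan, fun b => ?_⟩, fun b => by rw [← (C2 b).1, ← image_union]⟩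
    rintro x (hx | hx) y (hy | hy) e
    exacts [h.2 b (hA hx) (hA hy) e, (k b x hx y hy e).1, (k b y hy x hx e.symm).1.symm, (C2 b).2 hx hy e]
  have key2 : ∀ {A B}, JS G p q A B → ∀ b, ∀ r ∈ G, r b ∈ cl (pj b (A ∪ C)) → r ∈ A ∪ C := by
    intro A B hj b r hr hc
    have hjb := hj.image (f := fun p : Bool → ℂ => p b) (by fun_prop) (h.2 b)
    rw [(key hj).2, cl_eq] at hc
    rw [← hj.2.2.2] at hr
    refine hr.imp_right fun hB => ?_
    by_contra hn
    refine hc (th_A hjb.swap (c1 b) (c2 b) ⟨⟨r, hB, rfl⟩, ?_⟩)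
    rintro (e | e)
    · exact hn (h.2 b (hj.2.2.2 ▸ .inr hB) hp e ▸ C1.left)
    · exact hn (h.2 b (hj.2.2.2 ▸ .inr hB) hq e ▸ C1.right)
  have k1 := key hj
  have k2 := key hj.swap
  have hi : ∀ b, ∀ x ∈ cl (pj b (A ∪ C)), x ∈ cl (pj b (B ∪ C)) → ∃ p ∈ A ∪ C, p ∈ B ∪ C ∧ p b = x := by
    intro b x h1 h2
    rw [k1.2] at h1; rw [k2.2] at h2
    have : x ∈ c b := th_inter (hjb b) (c1 b) (c2 b) ▸ ⟨h1, h2⟩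
    rw [← (C2 b).1] at this
    obtain ⟨p, hp, rfl⟩ := this
    exact ⟨p, .inr hp, .inr hp, rfl⟩
  refine ⟨⟨by simp, ?_, ?_, ?_, ?_, ?_⟩, k1.2, k2.2⟩
  · rintro _ (rfl | rfl); exacts [k1.1, k2.1]
  · rintro _ (rfl | rfl) b <;> rw [th_cl (hjb b) (c1 b) (c2 b)]
    · rw [k1.2]; exact subset_union_left
    · rw [k2.2]; exact subset_union_right
  · intro b x hx
    rw [th_cl (hjb b) (c1 b) (c2 b)] at hx
    rcases hx with hx | hx
    · exact ⟨_, .inl rfl, by rwa [k1.2]⟩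
    · exact ⟨_, .inr rfl, by rwa [k2.2]⟩
  · rintro b _ (rfl | rfl) _ (rfl | rfl) hne x h1 h2
    · exact absurd rfl hne
    · exact hi b x h1 h2
    · obtain ⟨p, h1, h2, h3⟩ := hi b x h2 h1; exact ⟨p, h2, h1, h3⟩
    · exact absurd rfl hne
  · rintro b p hp _ (rfl | rfl) h'
    exacts [key2 hj b p hp h', key2 hj.swap b p hp h']

lemma Valid.cut {G} (h : Valid G) {p q} (hp : p ∈ G) (hq : q ∈ G) (hpq : p ≠ q) {b₀ c₀} (hc : IsArc c₀ (p b₀) (q b₀)) (hd : c₀ \ {p b₀, q b₀} ⊆ ins (pj b₀ G)) :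
    ∃ G₁ G₂, Sbd G {G₁, G₂} ∧ ins (pj b₀ G) \ c₀ = ins (pj b₀ G₁) ∪ ins (pj b₀ G₂) ∧ (∀ i ∈ ({G₁, G₂} : Set _), c₀ ⊆ pj b₀ i ∧ pj b₀ i ⊆ pj b₀ G ∪ c₀) := by
  have hne : ∀ b, p b ≠ q b := fun b e => hpq (h.2 b hp hq e)
  have : ∀ b, ∃ c, IsArc c (p b) (q b) ∧ c \ {p b, q b} ⊆ ins (pj b G) ∧ (b = b₀ → c = c₀) := fun b => by
    by_cases e : b = b₀
    · subst e; exact ⟨c₀, hc, hd, fun _ => rfl⟩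
    · obtain ⟨c, h1, h2⟩ := (h.jc b).chord_at ⟨p, hp, rfl⟩ ⟨q, hq, rfl⟩ (hne b); exact ⟨c, h1, h2, fun h => absurd h e⟩
  choose c c1 c2 c3 using this
  have c4 := c3 b₀ rfl
  obtain ⟨C, C1, C2⟩ := arc_pair c1
  obtain ⟨A, B, hj⟩ := h.1.split hp hq hpq
  have hjb := fun b => hj.image (f := fun p : Bool → ℂ => p b) (by fun_prop) (h.2 b)
  obtain ⟨k0, k1, k2⟩ := h.cutC hp hq C1 C2 c2 hj
  refine ⟨A ∪ C, B ∪ C, k0, ?_, ?_⟩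
  · rw [k1, k2, c4]; exact th_ins (hjb b₀) hc hd
  · rintro _ (rfl | rfl)
    · rw [k1, c4]; exact ⟨subset_union_right, union_subset_union_left _ (image_mono (hj.2.2.2 ▸ subset_union_left))⟩
    · rw [k2, c4]; exact ⟨subset_union_right, union_subset_union_left _ (image_mono (hj.2.2.2 ▸ subset_union_right))⟩

lemma refine_list {ι : Type*} {Inv : Set (Bool → ℂ) → Prop} {p : ι → Set (Bool → ℂ) → Prop} (hI : ∀ i, Inv i → Valid i)
    (hst : ∀ t i, Inv i → ∃ S, Sbd i S ∧ ∀ j ∈ S, Inv j ∧ p t j)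
    (hm : ∀ t i j, Inv i → Inv j → p t i → (∀ b, cl (pj b j) ⊆ cl (pj b i)) → p t j) (l : List ι) :
    ∀ G, Inv G → ∃ S, Sbd G S ∧ ∀ j ∈ S, Inv j ∧ ∀ t ∈ l, p t j := by
  induction l with
  | nil => exact fun G hG => ⟨{G}, Sbd.self (hI G hG), by rintro _ rfl; exact ⟨hG, by simp⟩⟩
  | cons t l ih =>
    intro G hG
    obtain ⟨S, h1, h2⟩ := hst t G hG
    choose! T T1 T2 using fun i (hi : i ∈ S) => ih i (h2 i hi).1
    refine ⟨_, h1.trans T1, ?_⟩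
    simp only [mem_iUnion]; rintro j ⟨i, hi, hj⟩
    refine ⟨(T2 i hi j hj).1, fun s hs => ?_⟩
    rcases List.mem_cons.1 hs with rfl | hs
    · exact hm s i j (h2 i hi).1 (T2 i hi j hj).1 (h2 i hi).2 ((T1 i hi).sub j hj)
    · exact (T2 i hi j hj).2 s hs

lemma IsJC.ins_mono {J J' : Set ℂ} (hJ : IsJC J) (hJ' : IsJC J') (h : cl J' ⊆ cl J) : ins J' ⊆ ins J := by
  intro x hx
  refine (h (.inr hx)).resolve_left fun hxJ => ?_
  obtain ⟨y, y1, y2⟩ := mem_closure_iff.1 (hJ.cl_ext hxJ) _ hJ'.ins_open hx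
  have := h (.inr y1)
  rw [cl_eq] at this; exact this y2
end

section
open Set Filter Topology Metric

lemma IsJC.conn {E : Type*} [TopologicalSpace E] {J : Set E} (h : IsJC J) : IsPreconnected J := by
  obtain ⟨γ, h1, h2, rfl⟩ := h; exact isPreconnected_range h1

lemma ball_ext {K : Set ℂ} (hK : IsCompact K) {y u : ℂ} {η : ℝ} (h0 : 0 < η) (h : K ⊆ ball y η) (hu : u ∉ ball y η) : u ∈ ext K := by
  obtain ⟨r, hr, hK'⟩ := exists_pos_lt_subset_ball h0 hK.isClosed h
  obtain ⟨R, q, hR, hq⟩ := exists_far ((isCompact_closedBall y r).union hK)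
  have h1 : q ∈ ext K := far_ext (subset_union_right.trans hR) hq
  refine ext_of_conn (conn_compl_closedBall y r) (compl_subset_compl.2 (hK'.trans ball_subset_closedBall)) (p := q) (fun h => ?_) h1 (fun h => hu ?_)
  · have := hR (.inl h); rw [mem_closedBall_zero_iff] at this; linarith
  · exact closedBall_subset_ball hr.2 h

lemma small_chord {J y z A B c} {η : ℝ} (hJ : JS J y z A B) (hc : IsArc c y z) (hd : c \ {y, z} ⊆ ins J) (h0 : 0 < η) (h : A ∪ c ⊆ ball y η) {u v : ℂ}
    (hu : u ∈ ins J) (hv : v ∈ ins J) (hu' : u ∉ ball y η) (hv' : v ∉ ball y η) : NS (J ∪ c) u v := by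
  have key : ∀ u ∈ ins J, u ∉ ball y η → u ∈ ins (B ∪ c) := fun u hu hu' => by
    have : u ∈ ins J \ c := ⟨hu, fun h' => hu' (h (.inr h'))⟩
    rw [th_ins hJ hc hd] at this
    exact this.resolve_left fun h' => ins_not_ext h' (ball_ext (hJ.1.compact.union hc.compact) h0 h hu')
  refine ⟨ins (B ∪ c), ?_, (th_J1 hJ.swap hc hd).jordan.ins_conn, key u hu hu', key v hv hv'⟩
  rintro x hx (h1 | h1)
  · rw [← hJ.2.2.2] at h1
    exact h1.elim (fun h => th_sub hJ.swap hc hd hx (.inl h)) fun h => hx.1 (.inl h)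
  · exact hx.1 (.inr h1)

lemma IsJC.small_arc {J : Set ℂ} (h : IsJC J) {η : ℝ} (h0 : 0 < η) :
    ∃ δ > 0, δ ≤ η ∧ ∀ y ∈ J, ∀ z ∈ J, y ≠ z → dist y z < δ → ∃ A B, JS J y z A B ∧ A ⊆ ball y η := by
  obtain ⟨γ, h1, h2, rfl⟩ := h
  have : CompactSpace (range γ) := isCompact_iff_compactSpace.1 (isCompact_range h1)
  let e := (h1.isClosedEmbedding h2).toIsEmbedding.toHomeomorph
  have he : ∀ s, (e s : ℂ) = γ s := fun s => rfl
  obtain ⟨α, α0, hα⟩ := Metric.uniformContinuous_iff.1 (CompactSpace.uniformContinuous_of_continuous h1) η h0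
  obtain ⟨δ, δ0, hδ⟩ := Metric.uniformContinuous_iff.1 (CompactSpace.uniformContinuous_of_continuous e.symm.continuous) (min α (1/2)) (lt_min α0 (by norm_num))
  refine ⟨min δ η, lt_min δ0 h0, min_le_right _ _, ?_⟩
  have key : ∀ x r : ℝ, 0 < r → r < min α (1/2) → ∃ A B, JS (range γ) (γ x) (γ (x + r : ℝ)) A B ∧ ∀ t ∈ A, ∃ s ∈ Icc x (x + r), γ (s : ℝ) = t := by
    intro x r r0 hr
    exact ⟨_, _, js_param h1 h2 (by linarith) (by linarith [min_le_right α (1/2)]), fun t ⟨s, hs, e⟩ => ⟨s, hs, e⟩⟩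
  have hball : ∀ x s : ℝ, |s - x| < min α (1/2) → γ (s : ℝ) ∈ ball (γ x) η := fun x s hs => by
    refine hα ?_
    rw [dist_eq_norm, ← AddCircle.coe_sub]
    erw [UnitAddCircle.norm_eq]
    exact (by simpa using round_le (s - x) 0 : _ ≤ |s - x|).trans_lt (hs.trans_le (min_le_left _ _))
  rintro _ ⟨s, rfl⟩ _ ⟨t, rfl⟩ hne hd
  have hst : dist s t < min α (1/2) := by
    have := @hδ (e s) (e t) (by rw [Subtype.dist_eq]; exact hd.trans_le (min_le_left _ _))
    simpa using this
  obtain ⟨x, rfl⟩ := QuotientAddGroup.mk_surjective s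
  obtain ⟨r, hr, rfl⟩ : ∃ r : ℝ, |r| < min α (1/2) ∧ t = ((x + r : ℝ) : UnitAddCircle) := by
    obtain ⟨y, rfl⟩ := QuotientAddGroup.mk_surjective t
    rw [dist_comm, dist_eq_norm, ← QuotientAddGroup.mk_sub] at hst
    erw [UnitAddCircle.norm_eq] at hst
    refine ⟨_, hst, ?_⟩
    rw [show x + (y - x - (round (y - x) : ℤ)) = y - ((round (y - x) : ℤ) : ℝ) by ring]
    exact QuotientAddGroup.eq.2 ⟨-round (y - x), by simp; ring⟩
  rcases lt_trichotomy r 0 with h | h | h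
  · obtain ⟨A, B, h3, h4⟩ := key (x + r) (-r) (by linarith) (by rwa [← abs_of_neg h])
    rw [show x + r + -r = x by ring] at h3 h4
    refine ⟨A, B, h3.rev, fun z hz => ?_⟩
    obtain ⟨s, hs, rfl⟩ := h4 z hz
    refine hball x s (lt_of_le_of_lt ?_ hr)
    rw [abs_of_nonpos (by linarith [hs.2]), abs_of_neg h]; linarith [hs.1]
  · subst h; simp at hne
  · obtain ⟨A, B, h3, h4⟩ := key x r h (by rwa [← abs_of_pos h])
    refine ⟨A, B, h3, fun z hz => ?_⟩
    obtain ⟨s, hs, rfl⟩ := h4 z hz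
    refine hball x s (lt_of_le_of_lt ?_ hr)
    rw [abs_of_nonneg (by linarith [hs.1]), abs_of_pos h]; linarith [hs.2]

def FC (O : Set ℝ) (a b : ℝ) : Prop := a < b ∧ Ioo a b ⊆ O ∧ a ∉ O ∧ b ∉ O

lemma fc_ex {O : Set ℝ} (hO : IsOpen O) {R : ℝ} (hR : ∀ t ∈ O, |t| < R) {t} (ht : t ∈ O) : ∃ a b, FC O a b ∧ t ∈ Ioo a b := by
  have hR0 := hR t ht
  have h1 : IsClosed (Oᶜ ∩ Iic t) := hO.isClosed_compl.inter isClosed_Iic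
  have h2 : IsClosed (Oᶜ ∩ Ici t) := hO.isClosed_compl.inter isClosed_Ici
  have n1 : (Oᶜ ∩ Iic t).Nonempty := ⟨-R, fun h => absurd (hR _ h) (by simp [le_abs_self]), by have := abs_lt.1 hR0; simp; linarith⟩
  have n2 : (Oᶜ ∩ Ici t).Nonempty := ⟨R, fun h => absurd (hR _ h) (by simp [le_abs_self]), by have := abs_lt.1 hR0; simp; linarith⟩
  have b1 : BddAbove (Oᶜ ∩ Iic t) := ⟨t, fun x hx => hx.2⟩
  have b2 : BddBelow (Oᶜ ∩ Ici t) := ⟨t, fun x hx => hx.2⟩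
  have m1 := h1.csSup_mem n1 b1
  have m2 := h2.csInf_mem n2 b2
  have l1 := lt_of_le_of_ne (mem_Iic.1 m1.2) (fun e => by have h := m1.1; rw [e] at h; exact h ht)
  have l2 := lt_of_le_of_ne (mem_Ici.1 m2.2) (fun e => by have h := m2.1; rw [← e] at h; exact h ht)
  refine ⟨_, _, ⟨l1.trans l2, fun x hx => ?_, m1.1, m2.1⟩, l1, l2⟩
  by_contra hn
  rcases le_total x t with h | h
  · exact absurd hx.1 (not_lt.2 (le_csSup b1 ⟨hn, h⟩))
  · exact absurd hx.2 (not_lt.2 (csInf_le b2 ⟨hn, h⟩))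

lemma fc_eq {O : Set ℝ} {a b a' b' t} (h : FC O a b) (h' : FC O a' b') (ht : t ∈ Ioo a b) (ht' : t ∈ Ioo a' b') : a = a' ∧ b = b' := by
  have : ∀ {a b a' b'}, FC O a b → FC O a' b' → t ∈ Ioo a b → t ∈ Ioo a' b' → a' ≤ a ∧ b ≤ b' := fun {a b a' b'} h h' ht ht' =>
    ⟨not_lt.1 fun l => h'.2.2.1 (h.2.1 ⟨l, ht'.1.trans ht.2⟩), not_lt.1 fun l => h'.2.2.2 (h.2.1 ⟨ht.1.trans ht'.2, l⟩)⟩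
  exact ⟨le_antisymm (this h' h ht' ht).1 (this h h' ht ht').1, le_antisymm (this h h' ht ht').2 (this h' h ht' ht).2⟩

section line
variable {ℓ : ℝ → ℂ} {φ : ℂ → ℝ} {k : ℝ}

lemma fc_ends (hl : Isometry ℓ) {J : Set ℂ} (hJ : IsJC J) {a b} (h : FC (ℓ ⁻¹' ins J) a b) : ℓ a ∈ J ∧ ℓ b ∈ J := by
  have : ∀ x ∈ Icc a b, ℓ x ∈ cl J := fun x hx => by
    rw [hJ.cl_closure]; rw [← closure_Ioo h.1.ne] at hx
    exact closure_mono (image_subset_iff.2 h.2.1) (image_closure_subset_closure_image hl.continuous ⟨x, hx, rfl⟩)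
  exact ⟨(this a (left_mem_Icc.2 h.1.le)).resolve_right h.2.2.1, (this b (right_mem_Icc.2 h.1.le)).resolve_right h.2.2.2⟩

lemma line_bdd (hl : Isometry ℓ) {S : Set ℂ} (hS : Bornology.IsBounded S) : ∃ R, ∀ t, ℓ t ∈ S → |t| < R := by
  obtain ⟨R, hR⟩ := hS.subset_ball (ℓ 0)
  refine ⟨R, fun t ht => ?_⟩
  have := hR ht
  rwa [mem_ball, hl.dist_eq, Real.dist_eq, sub_zero] at this

lemma fc_arc (hl : Isometry ℓ) {a b} (h : a < b) : IsArc (ℓ '' Icc a b) (ℓ a) (ℓ b) := isArc_map h hl.continuous.continuousOn hl.injective.injOn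

lemma fc_chord {J : Set ℂ} {a b} (h : FC (ℓ ⁻¹' ins J) a b) : ℓ '' Icc a b \ {ℓ a, ℓ b} ⊆ ins J := by
  rintro _ ⟨⟨t, ht, rfl⟩, hn⟩
  exact h.2.1 ⟨lt_of_le_of_ne ht.1 fun e => hn (.inl (e ▸ rfl)), lt_of_le_of_ne ht.2 fun e => hn (.inr (e ▸ rfl))⟩

lemma leaf (hl : Isometry ℓ) (hφ : ∀ x y, |φ x - φ y| ≤ dist x y) (hz : ∀ z, φ z = k ↔ ∃ r, ℓ r = z) {J K : Set ℂ} (hJ : IsJC J) (hK : IsJC K)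
    (hKJ : ins K ⊆ ins J) {δ η : ℝ} (h0 : 0 < η) (hδη : δ ≤ η)
    (hδ : ∀ y ∈ J, ∀ z ∈ J, y ≠ z → dist y z < δ → ∃ A B, JS J y z A B ∧ A ⊆ ball y η)
    (hs : ∀ a b, FC (ℓ ⁻¹' ins J) a b → ∀ t ∈ Ioo a b, ℓ t ∈ ins K → b - a < δ) {u v} (hu : u ∈ ins K) (hv : v ∈ ins K) (hu' : φ u < k - η) (hv' : k + η < φ v) : False := by
  have hφc : Continuous φ := by
    have : LipschitzWith 1 φ := LipschitzWith.of_dist_le_mul fun x y => by simpa [Real.dist_eq] using hφ x y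
    exact this.continuous
  have huv : v ≠ u := by rintro rfl; linarith
  obtain ⟨Γ, Γ1, Γ2⟩ := arc_in_open hK.ins_open hK.ins_conn le_rfl hu hv huv
  obtain ⟨R, hR⟩ := line_bdd hl hJ.cl_compact.isBounded
  have cT : ∀ S : Set ℂ, IsClosed S → S ⊆ cl J → IsCompact (ℓ ⁻¹' S) := fun S hS hSJ =>
    (isCompact_Icc (a := -R) (b := R)).of_isClosed_subset (hS.preimage hl.continuous) fun t ht => abs_le.1 (hR t (hSJ ht)).le
  have hfc : ∀ t ∈ ℓ ⁻¹' Γ, ∃ a b, FC (ℓ ⁻¹' ins J) a b ∧ t ∈ Ioo a b := fun t ht =>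
    fc_ex (hJ.ins_open.preimage hl.continuous) (fun t ht => hR t (.inr ht)) (hKJ (Γ2 ht))
  choose! a b h1 h2 using hfc
  obtain ⟨F, F1, F2⟩ := (cT Γ Γ1.closed (fun z hz => .inr (hKJ (Γ2 hz)))).elim_nhds_subcover (fun t => Ioo (a t) (b t)) fun t ht => Ioo_mem_nhds (h2 t ht).1 (h2 t ht).2
  let σ := fun t => ℓ '' Icc (a t) (b t)
  let M := J ∪ ℓ '' (ℓ ⁻¹' cl J \ ⋃ t ∈ F, Ioo (a t) (b t))
  have hM : IsCompact M := hJ.compact.union (((cT _ hJ.cl_closed le_rfl).diff (isOpen_biUnion fun _ _ => isOpen_Ioo)).image hl.continuous)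
  have hσ : ∀ t ∈ F, NS (J ∪ σ t) u v := fun t ht => by
    have f1 := h1 t (F1 t ht)
    have f2 := fc_ends hl hJ f1
    have f3 := hs _ _ f1 t (h2 t (F1 t ht)) (Γ2 (F1 t ht))
    obtain ⟨A, B, hAB, hA⟩ := hδ _ f2.1 _ f2.2 (hl.injective.ne f1.1.ne) (by rw [hl.dist_eq, Real.dist_eq, abs_sub_comm, abs_of_pos (sub_pos.2 f1.1)]; exact f3)
    have hk : φ (ℓ (a t)) = k := (hz _).2 ⟨_, rfl⟩
    refine small_chord hAB (fc_arc hl f1.1) (fc_chord f1) h0 (union_subset hA ?_) (hKJ hu) (hKJ hv) (fun h => ?_) (fun h => ?_)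
    · rintro _ ⟨s, hs, rfl⟩
      rw [mem_ball, hl.dist_eq, Real.dist_eq, abs_of_nonneg (sub_nonneg.2 hs.1)]; linarith [hs.2]
    · have := (hφ u (ℓ (a t))).trans_lt h; rw [hk, abs_lt] at this; linarith
    · have := (hφ v (ℓ (a t))).trans_lt h; rw [hk, abs_lt] at this; linarith
  have key : ∀ F' ⊆ F, IsCompact (M ∪ ⋃ t ∈ F', σ t) ∧ NS (M ∪ ⋃ t ∈ F', σ t) u v := by
    classical
    intro F'; induction F' using Finset.induction_on with
    | empty =>
      intro _; simp only [Finset.notMem_empty, iUnion_of_empty, iUnion_empty, union_empty]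
      refine ⟨hM, Γ, ?_, Γ1.conn, Γ1.left, Γ1.right⟩
      rintro z hz (h | ⟨t, ⟨_, ht⟩, rfl⟩)
      · exact (hKJ (Γ2 hz)).1 h
      · exact ht (F2 hz)
    | insert t F' ht ih =>
      intro hF
      obtain ⟨c1, c2⟩ := ih ((Finset.subset_insert _ _).trans hF)
      have htF := hF (Finset.mem_insert_self t F')
      have f1 := h1 t (F1 t htF)
      have heq : (M ∪ ⋃ s ∈ insert t F', σ s) = (M ∪ ⋃ s ∈ F', σ s) ∪ (J ∪ σ t) := by
        rw [Finset.set_biUnion_insert]; ext z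
        have : z ∈ J → z ∈ M := fun h => .inl h
        simp only [mem_union]; tauto
      have c3 : IsCompact (J ∪ σ t) := hJ.compact.union (fc_arc hl f1.1).compact
      rw [heq]; refine ⟨c1.union c3, ?_⟩
      by_cases hex : ∃ s ∈ F', a s = a t ∧ b s = b t
      · obtain ⟨s, hs, e1, e2⟩ := hex
        rw [union_eq_self_of_subset_right]
        · exact c2
        · refine union_subset (fun z hz => .inl (.inl hz)) fun z hz => .inr (mem_biUnion hs ?_)
          simpa only [σ, e1, e2] using hz
      refine c2.union c1 c3 ?_ (hσ t htF)
      convert hJ.conn using 1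
      refine subset_antisymm ?_ fun z hz => ⟨.inl (.inl hz), .inl hz⟩
      rintro z ⟨hz, hz' | ⟨r, hr, rfl⟩⟩
      · exact hz'
      · by_cases e1 : r = a t
        · rw [e1]; exact (fc_ends hl hJ f1).1
        by_cases e2 : r = b t
        · rw [e2]; exact (fc_ends hl hJ f1).2
        have hrt : r ∈ Ioo (a t) (b t) := ⟨lt_of_le_of_ne hr.1 (Ne.symm e1), lt_of_le_of_ne hr.2 e2⟩
        rcases hz with (hz | ⟨r', ⟨_, h4⟩, e⟩) | hz
        · exact hz
        · obtain rfl := hl.injective e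
          exact absurd (mem_biUnion htF hrt) h4
        · obtain ⟨s, hs, r', hr', e⟩ := mem_iUnion₂.1 hz
          obtain rfl := hl.injective e
          have f2 := h1 s (F1 s (hF (Finset.mem_insert_of_mem hs)))
          have hro := f1.2.1 hrt
          have hrs : r' ∈ Ioo (a s) (b s) := ⟨lt_of_le_of_ne hr'.1 fun e => f2.2.2.1 (e ▸ hro), lt_of_le_of_ne hr'.2 fun e => f2.2.2.2 (e ▸ hro)⟩
          exact absurd ⟨s, hs, fc_eq f2 f1 hrs hrt⟩ hex
  obtain ⟨C, C1, C2, C3, C4⟩ := (key F subset_rfl).2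
  obtain ⟨z, z1, z2⟩ := C2.intermediate_value C3 C4 hφc.continuousOn (show k ∈ Icc (φ u) (φ v) by constructor <;> linarith)
  obtain ⟨r, rfl⟩ := (hz z).1 z2
  have hr : ℓ r ∈ ins J := ins_of_conn C2 (fun w hw hwJ => C1 hw (.inl (.inl hwJ))) C3 (hKJ hu) z1
  by_cases h : r ∈ ⋃ t ∈ F, Ioo (a t) (b t)
  · obtain ⟨s, hs, h⟩ := mem_iUnion₂.1 h
    exact C1 z1 (.inr (mem_biUnion hs ⟨r, Ioo_subset_Icc_self h, rfl⟩))
  · exact C1 z1 (.inl (.inr ⟨r, ⟨.inr hr, h⟩, rfl⟩))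

lemma stepB (hl : Isometry ℓ) (hφ : ∀ x y, |φ x - φ y| ≤ dist x y) (hz : ∀ z, φ z = k ↔ ∃ r, ℓ r = z) (b₀ : Bool) {η : ℝ} (h0 : 0 < η) {G} (hG : Valid G) :
    ∃ S, Sbd G S ∧ ∀ i ∈ S, Valid i ∧ ∀ u ∈ ins (pj b₀ i), ∀ v ∈ ins (pj b₀ i), φ u < k - η → ¬ k + η < φ v := by
  have hJ := hG.jc b₀
  set J := pj b₀ G
  obtain ⟨δ, δ0, δ1, hδ⟩ := hJ.small_arc h0
  obtain ⟨R, hR⟩ := line_bdd hl hJ.ins_bdd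
  obtain ⟨N, hN⟩ := exists_nat_gt (R / (δ / 2) + 1)
  let Inv : Set (Bool → ℂ) → Prop := fun i => Valid i ∧ ins (pj b₀ i) ⊆ ins J ∧
    ∀ a b, FC (ℓ ⁻¹' ins J) a b → (∃ t ∈ Ioo a b, ℓ t ∈ ins (pj b₀ i)) → ℓ '' Ioo a b ⊆ ins (pj b₀ i)
  have hst : ∀ (m : ℤ) i, Inv i → ∃ S, Sbd i S ∧ ∀ j ∈ S, Inv j ∧ ℓ (m * (δ / 2)) ∉ ins (pj b₀ j) := by
    intro m i hi
    obtain ⟨i1, i2, i3⟩ := hi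
    by_cases hin : ℓ (m * (δ / 2)) ∈ ins (pj b₀ i)
    swap
    · exact ⟨{i}, Sbd.self i1, by rintro _ rfl; exact ⟨⟨i1, i2, i3⟩, hin⟩⟩
    obtain ⟨a, b, hab, ht⟩ := fc_ex (hJ.ins_open.preimage hl.continuous) hR (i2 hin)
    have hsub := i3 a b hab ⟨_, ht, hin⟩
    have hab' : FC (ℓ ⁻¹' ins (pj b₀ i)) a b := ⟨hab.1, image_subset_iff.1 hsub, fun h => hab.2.2.1 (i2 h), fun h => hab.2.2.2 (i2 h)⟩
    obtain ⟨⟨p, hp, ep⟩, ⟨q, hq, eq⟩⟩ := fc_ends hl (i1.jc b₀) hab'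
    simp only at ep eq
    have hpq : p ≠ q := by rintro rfl; exact hab.1.ne (hl.injective (ep.symm.trans eq))
    obtain ⟨G₁, G₂, g1, g2, g3⟩ := i1.cut hp hq hpq (b₀ := b₀) (c₀ := ℓ '' Icc a b) (by rw [ep, eq]; exact fc_arc hl hab.1) (by rw [ep, eq]; exact fc_chord hab')
    refine ⟨_, g1, fun j hj => ?_⟩
    have j1 := g1.val j hj
    have j2 : ins (pj b₀ j) ⊆ ins (pj b₀ i) := (i1.jc b₀).ins_mono (j1.jc b₀) (g1.sub j hj b₀)
    refine ⟨⟨j1, j2.trans i2, ?_⟩, fun h => h.1 ((g3 j hj).1 ⟨_, Ioo_subset_Icc_self ht, rfl⟩)⟩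
    rintro a' b' hab2 ⟨t', ht', hti'⟩
    have s1 := i3 a' b' hab2 ⟨t', ht', j2 hti'⟩
    refine ins_of_conn (isPreconnected_Ioo.image _ hl.continuous.continuousOn) ?_ ⟨t', ht', rfl⟩ hti'
    rintro _ ⟨r, hr, rfl⟩ hrj
    rcases (g3 j hj).2 hrj with h | ⟨r', hr', e⟩
    · exact (s1 ⟨r, hr, rfl⟩).1 h
    · obtain rfl := hl.injective e
      have hro := hab2.2.1 hr
      have hrs : r' ∈ Ioo a b := ⟨lt_of_le_of_ne hr'.1 fun e => hab.2.2.1 (e ▸ hro), lt_of_le_of_ne hr'.2 fun e => hab.2.2.2 (e ▸ hro)⟩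
      obtain ⟨rfl, rfl⟩ := fc_eq hab hab2 hrs hr
      exact hti'.1 ((g3 j hj).1 ⟨t', Ioo_subset_Icc_self ht', rfl⟩)
  obtain ⟨S, S1, S2⟩ := refine_list (Inv := Inv) (p := fun (m : ℤ) i => ℓ (m * (δ / 2)) ∉ ins (pj b₀ i)) (fun i hi => hi.1) hst
    (fun m i j hi hj hp h hm => hp ((hi.1.jc b₀).ins_mono (hj.1.jc b₀) (h b₀) hm)) (Finset.Icc (-N : ℤ) N).toList G
    ⟨hG, le_rfl, fun a b h _ => image_subset_iff.2 h.2.1⟩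
  refine ⟨S, S1, fun i hi => ⟨(S2 i hi).1.1, fun u hu v hv h1 h2 => ?_⟩⟩
  obtain ⟨⟨i1, i2, i3⟩, i4⟩ := S2 i hi
  refine leaf hl hφ hz hJ (i1.jc b₀) i2 h0 δ1 hδ (fun a b hab t ht hti => ?_) hu hv h1 h2
  by_contra! hn
  have hm1 : a < (⌊a / (δ / 2)⌋ + 1 : ℤ) * (δ / 2) := by
    rw [← div_lt_iff₀ (by linarith)]; push_cast; exact Int.lt_floor_add_one _
  have hm2 : (⌊a / (δ / 2)⌋ + 1 : ℤ) * (δ / 2) < b := by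
    have := Int.floor_le (a / (δ / 2)); rw [le_div_iff₀ (by linarith)] at this; push_cast; linarith
  have hin := i3 a b hab ⟨t, ht, hti⟩ ⟨_, ⟨hm1, hm2⟩, rfl⟩
  have hb := abs_lt.1 (hR _ (i2 hin))
  have d2 : 0 < δ / 2 := by linarith
  refine i4 (⌊a / (δ / 2)⌋ + 1) ?_ hin
  have e : R = R / (δ / 2) * (δ / 2) := by field_simp
  rw [e] at hb
  have b1 : -(N:ℝ) < (⌊a / (δ / 2)⌋ + 1 : ℤ) := by
    have := hb.1; rw [← neg_mul] at this; have := lt_of_mul_lt_mul_right this d2.le; linarith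
  have b2 : (⌊a / (δ / 2)⌋ + 1 : ℤ) < (N:ℝ) := by
    have := lt_of_mul_lt_mul_right hb.2 d2.le; linarith
  rw [Finset.mem_toList, Finset.mem_Icc]
  constructor
  · have : ((-N : ℤ) : ℝ) < (⌊a / (δ / 2)⌋ + 1 : ℤ) := by push_cast at b1 ⊢; exact b1
    exact (Int.cast_lt.1 this).le
  · exact_mod_cast b2.le
end line
end

section
open Set Filter Topology Metric

def co (d : Bool) (z : ℂ) : ℝ := bif d then z.re else z.im
def li (d : Bool) (c r : ℝ) : ℂ := bif d then ⟨c, r⟩ else ⟨r, c⟩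

lemma mesh {ε : ℝ} (hε : 0 < ε) {G} (hG : Valid G) :
    ∃ S, Sbd G S ∧ ∀ i ∈ S, ∀ b, ∀ x ∈ cl (pj b i), ∀ y ∈ cl (pj b i), dist x y < ε := by
  obtain ⟨η, h0, hη⟩ : ∃ η : ℝ, 0 < η ∧ 8 * η < ε := ⟨ε / 9, by positivity, by linarith⟩
  have hR : ∃ R : ℝ, ∀ b, ∀ x ∈ cl (pj b G), ‖x‖ < R := by
    choose R hR using fun b => ((hG.jc b).cl_compact.isBounded.subset_ball 0)
    refine ⟨max (R true) (R false), fun b x hx => ?_⟩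
    have := hR b hx; rw [mem_ball_zero_iff] at this
    cases b
    · exact this.trans_le (le_max_right _ _)
    · exact this.trans_le (le_max_left _ _)
  obtain ⟨R, hR⟩ := hR
  obtain ⟨N, hN⟩ := exists_nat_gt (R / η + 3)
  have hco : ∀ d z, |co d z| ≤ ‖z‖ := fun d z => by cases d <;> simp [co, Complex.abs_re_le_norm, Complex.abs_im_le_norm]
  have hsub : ∀ d x y, co d x - co d y = co d (x - y) := fun d x y => by cases d <;> simp [co]
  obtain ⟨S, S1, S2⟩ := refine_list (ι := Bool × Bool × ℤ) (Inv := Valid)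
    (p := fun t i => ∀ u ∈ ins (pj t.1 i), ∀ v ∈ ins (pj t.1 i), co t.2.1 u < t.2.2 * η - η → ¬ t.2.2 * η + η < co t.2.1 v) (fun i h => h)
    (fun t i hi => stepB (ℓ := li t.2.1 (t.2.2 * η)) (φ := co t.2.1)
      (Isometry.of_dist_eq fun x y => by
        cases h : t.2.1 <;> simp [li, Complex.dist_eq, Complex.norm_def, Complex.normSq_apply, Real.dist_eq, Real.sqrt_mul_self_eq_abs])
      (fun x y => by rw [hsub, dist_eq_norm]; exact hco _ _)
      (fun z => by cases h : t.2.1 <;> simp [li, co, Complex.ext_iff, eq_comm]) t.1 h0 hi)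
    (fun t i j hi hj hp h u hu v hv => hp u ((hi.jc _).ins_mono (hj.jc _) (h _) hu) v ((hi.jc _).ins_mono (hj.jc _) (h _) hv))
    (Finset.univ ×ˢ Finset.univ ×ˢ Finset.Icc (-N : ℤ) N).toList G hG
  refine ⟨S, S1, fun i hi b => ?_⟩
  have key : ∀ d, ∀ u ∈ ins (pj b i), ∀ v ∈ ins (pj b i), co d v ≤ co d u + 4 * η := fun d u hu v hv => by
    by_contra! hn
    have hu' : |co d u| < R := (hco d u).trans_lt (hR b u (S1.sub i hi b (.inr hu)))
    have f1 := Int.floor_le (co d u / η)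
    have f2 := Int.lt_floor_add_one (co d u / η)
    have hq : |co d u / η| < R / η := by rw [abs_div, abs_of_pos h0]; gcongr
    rw [abs_lt] at hq
    refine (S2 i hi).2 (b, d, ⌊co d u / η⌋ + 2) ?_ u hu v hv ?_ ?_
    · simp only [Finset.mem_toList, Finset.mem_product, Finset.mem_univ, true_and, Finset.mem_Icc]
      constructor
      · have : -(N : ℝ) ≤ (⌊co d u / η⌋ + 2 : ℤ) := by push_cast; linarith
        exact_mod_cast this
      · have : ((⌊co d u / η⌋ + 2 : ℤ) : ℝ) ≤ N := by push_cast; linarith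
        exact_mod_cast this
    · push_cast; rw [div_lt_iff₀ h0] at f2; linarith
    · push_cast; rw [le_div_iff₀ h0] at f1; linarith
  have hd : diam (cl (pj b i)) ≤ 8 * η := by
    rw [((S1.val i hi).jc b).cl_closure, diam_closure]
    refine diam_le_of_forall_dist_le (by linarith) fun u hu v hv => ?_
    rw [dist_eq_norm]
    refine (Complex.norm_le_abs_re_add_abs_im _).trans ?_
    have k1 := key true u hu v hv; have k2 := key true v hv u hu
    have k3 := key false u hu v hv; have k4 := key false v hv u hu
    simp only [co, cond_true, cond_false] at k1 k2 k3 k4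
    have a1 : |(u - v).re| ≤ 4 * η := abs_le.2 ⟨by simp; linarith, by simp; linarith⟩
    have a2 : |(u - v).im| ≤ 4 * η := abs_le.2 ⟨by simp; linarith, by simp; linarith⟩
    linarith
  exact fun x hx y hy => (dist_le_diam_of_mem ((S1.val i hi).jc b).cl_compact.isBounded hx hy).trans_lt (hd.trans_lt hη)

def rel (S : Set (Set (Bool → ℂ))) : Set (Bool → ℂ) := ⋃ i ∈ S, univ.pi fun b => cl (pj b i)

theorem schoenflies {G} (hG : Valid G) : ∃ R : Set (Bool → ℂ), IsCompact R ∧ (∀ b, InjOn (fun p : Bool → ℂ => p b) R ∧ pj b R = cl (pj b G)) ∧ G ⊆ R := by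
  have hm : ∀ (n : ℕ) (i : Set (Bool → ℂ)), ∃ T : Set (Set (Bool → ℂ)), Valid i → Sbd i T ∧ ∀ j ∈ T, ∀ b, ∀ x ∈ cl (pj b j), ∀ y ∈ cl (pj b j), dist x y < 1 / ((n : ℝ) + 1) := fun n i => by
    by_cases h : Valid i
    · obtain ⟨T, hT⟩ := mesh (ε := 1 / ((n : ℝ) + 1)) (by positivity) h; exact ⟨T, fun _ => hT⟩
    · exact ⟨∅, fun h' => absurd h' h⟩
  choose T hT using hm
  let S : ℕ → Set (Set (Bool → ℂ)) := fun n => Nat.rec {G} (fun n s => ⋃ i ∈ s, T n i) n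
  have hS' : ∀ n, S (n + 1) = ⋃ i ∈ S n, T n i := fun n => rfl
  have hS : ∀ n, Sbd G (S n) := fun n => by
    induction n with
    | zero => exact Sbd.self hG
    | succ n ih => exact ih.trans fun i hi => (hT n i (ih.val i hi)).1
  have hsm : ∀ n, ∀ j ∈ S (n + 1), ∀ b, ∀ x ∈ cl (pj b j), ∀ y ∈ cl (pj b j), dist x y < 1 / ((n : ℝ) + 1) := fun n j hj => by
    rw [hS'] at hj; simp only [mem_iUnion] at hj; obtain ⟨i, hi, hj⟩ := hj
    exact (hT n i ((hS n).val i hi)).2 j hj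
  have hC : ∀ n, IsCompact (rel (S n)) := fun n => (hS n).fin.isCompact_biUnion fun i hi => isCompact_univ_pi fun b => (((hS n).val i hi).jc b).cl_compact
  have hmono : ∀ n, rel (S (n + 1)) ⊆ rel (S n) := fun n p hp => by
    simp only [rel, hS', mem_iUnion] at hp ⊢; obtain ⟨j, ⟨i, hi, hj⟩, hp⟩ := hp
    exact ⟨i, hi, fun b hb => (hT n i ((hS n).val i hi)).1.sub j hj b (hp b hb)⟩
  have hcl : IsClosed (⋂ n, rel (S n)) := isClosed_iInter fun n => (hC n).isClosed
  refine ⟨⋂ n, rel (S n), (hC 0).of_isClosed_subset hcl (iInter_subset (fun n => rel (S n)) 0), fun b => ⟨?_, ?_⟩, ?_⟩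
  · intro p hp q hq e
    have hd : ∀ b' (n : ℕ), dist (p b') (q b') ≤ 2 * (1 / ((n : ℝ) + 1)) := fun b' n => by
      have hp' := mem_iInter.1 hp (n + 1); have hq' := mem_iInter.1 hq (n + 1)
      simp only [rel, mem_iUnion, mem_univ_pi] at hp' hq'
      obtain ⟨i, hi, hp'⟩ := hp'; obtain ⟨j, hj, hq'⟩ := hq'
      by_cases hij : i = j
      · subst hij
        have := hsm n i hi b' _ (hp' b') _ (hq' b')
        have : 0 < 1 / ((n : ℝ) + 1) := by positivity
        linarith
      · obtain ⟨r, r1, r2, -⟩ := (hS (n + 1)).link b i hi j hj hij (p b) (hp' b) (by rw [show p b = q b from e]; exact hq' b)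
        have h1 := hsm n i hi b' _ (hp' b') (r b') (.inl ⟨r, r1, rfl⟩)
        have h2 := hsm n j hj b' (r b') (.inl ⟨r, r2, rfl⟩) _ (hq' b')
        linarith [dist_triangle (p b') (r b') (q b')]
    funext b'
    have ht : Tendsto (fun n : ℕ => 2 * (1 / ((n : ℝ) + 1))) atTop (𝓝 (2 * 0)) := tendsto_one_div_add_atTop_nhds_zero_nat.const_mul 2
    exact dist_le_zero.1 (by simpa using ge_of_tendsto' ht (hd b'))
  · apply Subset.antisymm
    · rintro _ ⟨p, hp, rfl⟩
      have := mem_iInter.1 hp 0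
      simp only [rel, mem_iUnion, mem_univ_pi] at this
      obtain ⟨i, hi, h⟩ := this; exact (hS 0).sub i hi b (h b)
    · intro x hx
      have hcx : IsClosed {p : Bool → ℂ | p b = x} := isClosed_eq (continuous_apply b) continuous_const
      obtain ⟨p, hp⟩ := IsCompact.nonempty_iInter_of_sequence_nonempty_isCompact_isClosed (fun n => rel (S n) ∩ {p : Bool → ℂ | p b = x})
        (fun n => inter_subset_inter_left _ (hmono n)) (fun n => by
          obtain ⟨i, hi, h⟩ := (hS n).cov b x hx
          have hne : ∀ b', (cl (pj b' i)).Nonempty := fun b' => (((hS n).val i hi).jc b').ins_nonempty.mono subset_union_right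
          choose q hq using hne
          refine ⟨Function.update q b x, mem_biUnion hi fun b' _ => ?_, by simp⟩
          by_cases hb : b' = b
          · subst hb; simpa using h
          · simpa [Function.update_of_ne hb] using hq b') ((hC 0).inter_right hcx) (fun n => (hC n).isClosed.inter hcx)
      rw [mem_iInter] at hp
      exact ⟨p, mem_iInter.2 fun n => (hp n).1, (hp 0).2⟩
  · refine fun p hp => mem_iInter.2 fun n => ?_
    obtain ⟨i, hi, h⟩ := (hS n).cov true (p true) (.inl ⟨p, hp, rfl⟩)
    exact mem_biUnion hi fun b _ => .inl ⟨p, (hS n).inh true p hp i hi h, rfl⟩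
end

section
open Set Filter Topology Metric

def tr (l : ℂ) (S : Set ℂ) : Set ℂ := {z | z - l ∈ S}
lemma mem_tr {l z : ℂ} {S} : z ∈ tr l S ↔ z - l ∈ S := Iff.rfl
lemma add_mem_tr {l z : ℂ} {S} : z + l ∈ tr l S ↔ z ∈ S := by simp [mem_tr]
lemma tr_eq (l : ℂ) (S) : tr l S = (fun z => z + l) '' S := by
  ext z; exact ⟨fun h => ⟨_, h, by simp⟩, by rintro ⟨w, h, rfl⟩; simpa [mem_tr] using h⟩
lemma tr_tr (l m : ℂ) (S) : tr l (tr m S) = tr (m + l) S := by ext z; simp [mem_tr, sub_sub, add_comm]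
@[simp] lemma tr_zero (S) : tr 0 S = S := by ext z; simp [mem_tr]
lemma tr_union (l : ℂ) (S T) : tr l (S ∪ T) = tr l S ∪ tr l T := rfl
lemma IsArc.tr {A : Set ℂ} {x y} (h : IsArc A x y) (l : ℂ) : IsArc (tr l A) (x + l) (y + l) := by
  rw [tr_eq]; exact h.image (by fun_prop) (add_left_injective l).injOn
lemma IsJC.tr {J : Set ℂ} (h : IsJC J) (l : ℂ) : IsJC (tr l J) := by
  rw [tr_eq]; exact h.image (by fun_prop) (add_left_injective l).injOn

lemma tr_ins (l : ℂ) (K) : ins (tr l K) = tr l (ins K) := by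
  have key : ∀ (l : ℂ) K p, p ∈ ins K → p + l ∈ ins (tr l K) := fun l K p hp => by
    refine ⟨fun h => hp.1 (add_mem_tr.1 h), ?_⟩
    have := (Homeomorph.addRight l).image_connectedComponentIn (s := Kᶜ) (x := p) hp.1
    have e : (Homeomorph.addRight l : ℂ → ℂ) = fun z => z + l := rfl
    rw [image_compl_eq (Homeomorph.bijective _), e, ← tr_eq l K] at this
    change Bornology.IsBounded (connectedComponentIn (tr l K)ᶜ ((fun z => z + l) p))
    rw [← this]
    exact (isometry_add_right l).lipschitz.isBounded_image hp.2
  ext p; constructor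
  · intro h
    have := key (-l) _ _ h
    rwa [tr_tr, add_neg_cancel, tr_zero, ← sub_eq_add_neg] at this
  · intro h; simpa using key l K _ h
lemma tr_cl (l : ℂ) (K) : cl (tr l K) = tr l (cl K) := by rw [cl, tr_ins]; rfl

lemma three {J J' c A B : Set ℂ} {y z} (h : JS J y z c A) (h' : JS J' y z c B) (hAB : A ∩ B = {y, z}) (hA : ∀ x ∈ A, x ∉ ins J')
    (hB : ∀ x ∈ B, x ∉ ins J) : c \ {y, z} ⊆ ins (A ∪ B) := by
  have hc : c \ {y, z} ⊆ (A ∪ B)ᶜ := by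
    rintro x ⟨x1, x2⟩ (x3 | x3)
    exacts [x2 (h.2.2.1 ▸ ⟨x1, x3⟩), x2 (h'.2.2.1 ▸ ⟨x1, x3⟩)]
  intro x hx
  by_contra hn
  have hxe := (ext_or_ins (hc hx)).resolve_right hn
  have hce := ext_of_conn h.1.diff_conn hc hx hxe
  have hj : JS (A ∪ B) y z A B := ⟨h.2.1, h'.2.1, hAB, rfl⟩
  have hpc : ∀ p ∈ ins (A ∪ B), p ∉ c := fun p hp hpc => by
    by_cases hh : p ∈ ({y, z} : Set ℂ)
    · rw [← hAB] at hh; exact hp.1 (.inl hh.1)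
    · exact ins_not_ext hp (hce ⟨hpc, hh⟩)
  have key : ∀ {J A B}, JS J y z c A → JS (A ∪ B) y z A B → c ∩ B = {y, z} → (∀ x ∈ B, x ∉ ins J) → (∀ p ∈ ins (A ∪ B), p ∉ c) → ∀ p ∈ ins (A ∪ B), p ∉ ins J := by
    intro J A B h hj hcB hB hpc p hp hpJ
    have s1 := ins_of_conn hj.jordan.ins_conn (fun q hq hqJ => by
      rw [← h.2.2.2] at hqJ; rcases hqJ with g | g
      exacts [hpc q hq g, hq.1 (.inl g)]) hp hpJ
    have s2 := closure_mono s1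
    rw [← hj.jordan.cl_closure, ← h.jordan.cl_closure] at s2
    obtain ⟨b, b1, b2⟩ := hj.2.1.mid
    have b3 := (s2 (.inl (.inr b1))).resolve_right (hB b b1)
    rw [← h.2.2.2] at b3; rcases b3 with g | g
    exacts [b2 (hcB ▸ ⟨g, b1⟩), b2 (hj.2.2.1 ▸ ⟨g, b1⟩)]
  obtain ⟨p, hp⟩ := hj.jordan.ins_nonempty
  have p1 := key h hj h'.2.2.1 hB hpc p hp
  have p2 := key h' (B := A) (by rw [union_comm]; exact ⟨hj.2.1, hj.1, by rw [inter_comm]; exact hAB, by rw [union_comm]⟩) h.2.2.1 hA (by rwa [union_comm]) p (by rwa [union_comm])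
  have e1 := (ext_or_ins (K := J) (p := p) (by rw [← h.2.2.2]; rintro (g | g); exacts [hpc p hp g, hp.1 (.inl g)])).resolve_right p1
  have e2 := (ext_or_ins (K := J') (p := p) (by rw [← h'.2.2.2]; rintro (g | g); exacts [hpc p hp g, hp.1 (.inr g)])).resolve_right p2
  have hJJ : J ∩ J' = c := by
    rw [← h.2.2.2, ← h'.2.2.2, ← union_inter_distrib_left, hAB, ← h.2.2.1]; exact union_eq_left.2 inter_subset_left
  have e3 := ext_union h.jordan.compact h'.jordan.compact (by rw [hJJ]; exact h.1.conn)
  have e4 : p ∈ ext (J ∪ J') := by rw [e3]; exact ⟨e1, e2⟩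
  refine ins_not_ext hp (ext_mono (h.jordan.compact.union h'.jordan.compact) (union_subset ?_ ?_) e4)
  · rw [← h.2.2.2]; exact subset_union_right.trans subset_union_left
  · rw [← h'.2.2.2]; exact subset_union_right.trans subset_union_right
end

section
open Set Filter Topology Metric

noncomputable def uu : Fin 3 → ℂ := ![0, -1, -Complex.I]
def tt : Fin 3 → ℂ → ℝ := ![fun z => 1 + z.re + z.im, fun z => -z.re, fun z => -z.im]
def dl (k l : Fin 3) : ℕ := if k = l then 1 else 0

lemma tt_uu (k l) : tt k (uu l) = dl k l := by fin_cases k <;> fin_cases l <;> simp [tt, uu, dl]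
lemma tt_aff (m p q : Fin 3) (z : ℂ) (r : ℝ) : tt m (z + r * (uu p - uu q)) = tt m z + r * (dl m p - dl m q) := by
  fin_cases m <;> fin_cases p <;> fin_cases q <;> simp [tt, uu, dl] <;> ring
lemma tt_sum (z) : tt 0 z + tt 1 z + tt 2 z = 1 := by simp [tt]; ring
lemma uu3 {p q m p' q' m' : Fin 3} (h : uu p + uu q + uu m = uu p' + uu q' + uu m') (r : Fin 3) :
    dl r p + dl r q + dl r m = dl r p' + dl r q' + dl r m' := by
  have : ∀ r : Fin 3, ∃ A B : ℝ, ∀ p, (dl r p : ℝ) = A + B * (uu p).re + (if r = 1 then 0 else if r = 0 then 1 else -1) * (uu p).im := fun r => by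
    fin_cases r
    · exact ⟨1, 1, fun p => by fin_cases p <;> simp [uu, dl]⟩
    · exact ⟨0, -1, fun p => by fin_cases p <;> simp [uu, dl]⟩
    · exact ⟨0, 0, fun p => by fin_cases p <;> simp [uu, dl]⟩
  obtain ⟨A, B, hA⟩ := this r
  have h1 := congrArg Complex.re h; have h2 := congrArg Complex.im h
  simp only [Complex.add_re, Complex.add_im] at h1 h2
  have : (dl r p + dl r q + dl r m : ℝ) = dl r p' + dl r q' + dl r m' := by
    simp only [hA]; linear_combination B * h1 + (if r = 1 then 0 else if r = 0 then 1 else -1) * h2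
  exact_mod_cast this
lemma uu2 {p q p' q' : Fin 3} (h : uu p + uu q = uu p' + uu q') : (p = p' ∧ q = q') ∨ (p = q' ∧ q = p') := by
  have := uu3 (p := p) (q := q) (p' := p') (q' := q') (m := 0) (m' := 0) (by rw [h]); clear h; revert p q p' q'; unfold dl; decide
lemma uu_inj : Function.Injective uu := fun p q h => by
  rcases uu2 (p := p) (q := p) (p' := q) (q' := p) (by rw [h]) with h | h
  exacts [h.1, h.2]

lemma unb {S : Set ℂ} (hS : Bornology.IsBounded S) {x d : ℂ} (h : ∀ n : ℕ, x + n * d ∈ S) : d = 0 := by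
  by_contra hd
  obtain ⟨R, hR⟩ := hS.subset_ball x
  obtain ⟨n, hn⟩ := exists_nat_gt (R / ‖d‖)
  have := hR (h n)
  rw [mem_ball, dist_eq_norm, add_sub_cancel_left, norm_mul, Complex.norm_natCast] at this
  rw [div_lt_iff₀ (norm_pos_iff.2 hd)] at hn; linarith

lemma IsArc.diff_right {E : Type*} [TopologicalSpace E] {A : Set E} {y z} (h : IsArc A y z) : IsPreconnected (A \ {z}) :=
  h.diff_conn.subset_closure (sdiff_subset_sdiff_right (by simp)) (sdiff_subset.trans h.subset_closure)

lemma ins_arc {J A : Set ℂ} {y z} (hJ : IsJC J) (h : IsArc A y z) (hy : y ∈ ext J) (hA : A \ {z} ⊆ Jᶜ) {x} (hx : x ∈ A) : x ∉ ins J := fun hi => by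
  have s := ext_of_conn h.diff_right hA ⟨h.left, h.ne⟩ hy
  obtain ⟨w, w1, w2⟩ := mem_closure_iff.1 (closure_mono ((sdiff_subset_sdiff_right (by simp)).trans s) (h.subset_closure hx)) _ hJ.ins_open hi
  exact ins_not_ext w1 w2

structure Th (L : AddSubgroup ℂ) (a b : ℂ) (e : Fin 3 → Set ℂ) : Prop where
  mem : ∀ k, uu k ∈ L
  arc : ∀ k, IsArc (e k) a (b + uu k)
  dj : ∀ k k' x, ∀ l ∈ L, x ∈ e k → x + l ∈ e k' → (k = k' ∧ l = 0) ∨ (l = 0 ∧ x = a) ∨ (l = uu k' - uu k ∧ x = b + uu k)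

namespace Th
variable {L : AddSubgroup ℂ} {a b : ℂ} {e : Fin 3 → Set ℂ}

def T (e : Fin 3 → Set ℂ) (p q : Fin 3) : Set ℂ := tr (uu q) (e p)
def J (e : Fin 3 → Set ℂ) : Set ℂ := ⋃ (p : Fin 3) (q : Fin 3) (_ : p ≠ q), T e p q
def Rs (e : Fin 3 → Set ℂ) (k l m : Fin 3) : Set ℂ := T e m l ∪ (T e l m ∪ (T e k m ∪ (T e m k ∪ T e l k)))

lemma dj' (h : Th L a b e) {k k' x l l'} (hl : l ∈ L) (hl' : l' ∈ L) (h1 : x ∈ tr l (e k)) (h2 : x ∈ tr l' (e k')) :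
    (k = k' ∧ l = l') ∨ (l = l' ∧ x = a + l) ∨ (l + uu k = l' + uu k' ∧ x = b + uu k + l) := by
  rcases h.dj k k' (x - l) (l - l') (L.sub_mem hl hl') h1 (by simpa [mem_tr] using h2) with ⟨h, h'⟩ | ⟨h, h'⟩ | ⟨h, h'⟩
  · exact .inl ⟨h, sub_eq_zero.1 h'⟩
  · exact .inr (.inl ⟨sub_eq_zero.1 h, by rw [← h']; ring⟩)
  · exact .inr (.inr ⟨by linear_combination h, by rw [← h']; ring⟩)

lemma meet (h : Th L a b e) {p q p' q' x} (h1 : x ∈ T e p q) (h2 : x ∈ T e p' q') (_ : p ≠ q) :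
    (p = p' ∧ q = q') ∨ (q = q' ∧ x = a + uu q) ∨ (p = q' ∧ q = p' ∧ x = b + (uu p + uu q)) := by
  rcases h.dj' (h.mem _) (h.mem _) h1 h2 with ⟨g, g'⟩ | ⟨g, g'⟩ | ⟨g, g'⟩
  · exact .inl ⟨g, uu_inj g'⟩
  · exact .inr (.inl ⟨uu_inj g, g'⟩)
  · rcases uu2 g with g | g
    · exact .inl ⟨g.2, g.1⟩
    · exact .inr (.inr ⟨g.2, g.1, by rw [g', add_assoc]⟩)

lemma Tarc (h : Th L a b e) (p q) : IsArc (T e p q) (a + uu q) (b + (uu p + uu q)) := by rw [← add_assoc]; exact (h.arc p).tr _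

lemma js (h : Th L a b e) {k l m : Fin 3} (kl : k ≠ l) (lm : l ≠ m) (mk : m ≠ k) : JS (J e) (a + uu l) (b + (uu k + uu l)) (T e k l) (Rs e k l m) := by
  have t1 := h.Tarc m l
  have t2 := (h.Tarc l m).symm; rw [add_comm (uu l)] at t2
  have t3 := h.Tarc k m
  have t4 := (h.Tarc m k).symm; rw [add_comm (uu m)] at t4
  have t5 := h.Tarc l k; rw [add_comm (uu l)] at t5
  have s4 := t4.concat t5 (by
    rintro x ⟨x1, x2⟩; rcases h.meet x1 x2 mk with g | g | g
    exacts [absurd g.1 lm.symm, g.2, absurd g.1 mk])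
  have s3 := t3.concat s4 (by
    rintro x ⟨x1, x2 | x2⟩ <;> rcases h.meet x1 x2 mk.symm with g | g | g
    exacts [absurd g.1 mk.symm, absurd g.1 mk, g.2.2, absurd g.1 kl, absurd g.1 mk, absurd g.2.1 lm.symm])
  have s2 := t2.concat s3 (by
    rintro x ⟨x1, x2 | x2 | x2⟩ <;> rcases h.meet x1 x2 lm with g | g | g
    exacts [absurd g.1 kl.symm, g.2, absurd g.1 lm, absurd g.1 lm, absurd g.1 mk, absurd g.1 kl.symm, absurd g.2 mk, absurd g.1 mk, absurd g.1 kl.symm])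
  have s1 := t1.concat s2 (by
    rintro x ⟨x1, x2 | x2 | x2 | x2⟩ <;> rcases h.meet x1 x2 lm.symm with g | g | g
    exacts [absurd g.1 lm.symm, absurd g.1 lm, by rw [g.2.2]; rfl, absurd g.1 mk, absurd g.1 lm, absurd g.2.1 kl.symm, absurd g.2 kl.symm, absurd g.1 kl.symm, absurd g.1 mk,
      absurd g.1 lm.symm, absurd g.1 kl.symm, absurd g.1 mk])
  refine ⟨h.Tarc k l, s1, ?_, ?_⟩
  · apply Subset.antisymm
    · rintro x ⟨x1, x2 | x2 | x2 | x2 | x2⟩ <;> rcases h.meet x1 x2 kl with g | g | g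
      exacts [absurd g.1 mk.symm, .inl g.2, absurd g.1 kl, absurd g.1 kl, absurd g.1 lm, absurd g.1 mk.symm, absurd g.2 lm, absurd g.1 lm, absurd g.1 mk.symm,
        absurd g.1 mk.symm, absurd g.1 kl.symm, absurd g.2.1 lm, absurd g.1 kl, absurd g.1 kl.symm, .inr g.2.2]
    · exact pair_subset ⟨(h.Tarc k l).left, s1.left⟩ ⟨(h.Tarc k l).right, s1.right⟩
  · apply Subset.antisymm
    · have : ∀ {p q}, p ≠ q → T e p q ⊆ J e := fun {p q} hpq => by intro x hx; simp only [J, mem_iUnion]; exact ⟨p, q, hpq, hx⟩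
      exact union_subset (this kl) (union_subset (this lm.symm) (union_subset (this lm) (union_subset (this mk.symm) (union_subset (this mk) (this kl.symm)))))
    · intro x hx; simp only [J, mem_iUnion] at hx
      obtain ⟨p, q, hpq, hx⟩ := hx
      have : (p = k ∧ q = l) ∨ (p = m ∧ q = l) ∨ (p = l ∧ q = m) ∨ (p = k ∧ q = m) ∨ (p = m ∧ q = k) ∨ (p = l ∧ q = k) := by
        clear * - kl lm mk hpq; revert k l m p q; decide
      simp only [Rs, mem_union]
      rcases this with ⟨rfl, rfl⟩ | ⟨rfl, rfl⟩ | ⟨rfl, rfl⟩ | ⟨rfl, rfl⟩ | ⟨rfl, rfl⟩ | ⟨rfl, rfl⟩ <;> tauto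

lemma jc (h : Th L a b e) : IsJC (J e) := (h.js (k := 0) (l := 1) (m := 2) (by decide) (by decide) (by decide)).jordan

lemma mem_J {x} : x ∈ J e ↔ ∃ p q, p ≠ q ∧ x ∈ tr (uu q) (e p) := by simp only [J, mem_iUnion, exists_prop]; rfl

lemma esc (h : Th L a b e) {w} (hw : w ∈ L) (hU : ∀ p, w ≠ uu p) : a + w ∈ ext (J e) := by
  obtain ⟨k, l, kl, hk⟩ : ∃ k l, k ≠ l ∧ ∀ n : ℕ, (∀ p, w + n * (uu k - uu l) ≠ uu p) ∧ ∀ p q, p ≠ q → w + n * (uu k - uu l) + uu k ≠ uu p + uu q := by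
    have ev : ∀ k l p m (n : ℕ), w + n * (uu k - uu l) = uu p → tt m w + n * ((dl m k : ℝ) - dl m l) = dl m p := fun k l p m n g => by
      rw [← tt_uu m p, ← g]; have := tt_aff m k l w n; push_cast at this; exact this.symm
    have ev' : ∀ k l p q m (n : ℕ), w + n * (uu k - uu l) + uu k = uu p + uu q → tt m w + n * ((dl m k : ℝ) - dl m l) + dl m k = dl m p + dl m q := fun k l p q m n g => by
      have g' : w + n * (uu k - uu l) = uu p + ((1 : ℝ) : ℂ) * (uu q - uu k) := by push_cast; linear_combination g
      have := tt_aff m k l w n; push_cast at this; rw [g', tt_aff, tt_uu] at this; linarith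
    have d2 : ∀ {p q : Fin 3} (m), p ≠ q → (dl m p : ℝ) + dl m q ≤ 1 := fun {p q} m hpq => by
      have : dl m p + dl m q ≤ 1 := by revert p q m; unfold dl; decide
      exact_mod_cast this
    have d1 : ∀ (m p : Fin 3), (dl m p : ℝ) ≤ 1 := fun m p => by exact_mod_cast (show dl m p ≤ 1 by unfold dl; split <;> simp)
    have ds : ∀ m, (dl m m : ℝ) = 1 := fun m => by simp [dl]
    have dn : ∀ {m p}, m ≠ p → (dl m p : ℝ) = 0 := fun {m p} hh => by simp [dl, hh]
    have hn : ∀ {n : ℕ}, n ≠ 0 → (1 : ℝ) ≤ n := fun {n} hh => by exact_mod_cast Nat.one_le_iff_ne_zero.2 hh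
    by_cases c1 : ∃ k, 1 ≤ tt k w
    · obtain ⟨k, hk⟩ := c1
      obtain ⟨l, kl⟩ : ∃ l : Fin 3, k ≠ l := by clear * -; revert k; decide
      refine ⟨k, l, kl, fun n => ⟨fun p g => ?_, fun p q hpq g => ?_⟩⟩
      · by_cases h0 : n = 0
        · subst h0; exact hU p (by simpa using g)
        · have := ev k l p k n g; rw [ds, dn kl] at this; linarith [d1 k p, hn h0]
      · have := ev' k l p q k n g; rw [ds, dn kl] at this; linarith [d2 k hpq, (Nat.cast_nonneg n : (0:ℝ) ≤ n)]
    by_cases c2 : ∃ l, tt l w < 0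
    · obtain ⟨l, hl⟩ := c2
      obtain ⟨k, kl⟩ : ∃ k : Fin 3, l ≠ k := by clear * -; revert l; decide
      refine ⟨k, l, kl.symm, fun n => ⟨fun p g => ?_, fun p q hpq g => ?_⟩⟩
      · have := ev k l p l n g; rw [ds, dn kl] at this; linarith [(Nat.cast_nonneg n : (0:ℝ) ≤ n), (Nat.cast_nonneg (dl l p) : (0:ℝ) ≤ _)]
      · have := ev' k l p q l n g; rw [ds, dn kl] at this
        linarith [(Nat.cast_nonneg n : (0:ℝ) ≤ n), (Nat.cast_nonneg (dl l p) : (0:ℝ) ≤ _), (Nat.cast_nonneg (dl l q) : (0:ℝ) ≤ _)]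
    push Not at c1 c2
    have n0 : ∀ {n : ℕ} {r : ℝ}, 0 ≤ r → tt 1 w - n = r → n = 0 := fun {n r} hr g => by
      by_contra h0; linarith [c1 1, hn h0]
    refine ⟨0, 1, by decide, fun n => ⟨fun p g => ?_, fun p q hpq g => ?_⟩⟩
    · have := ev 0 1 p 1 n g; rw [ds, dn (by decide)] at this
      obtain rfl := n0 (n := n) (Nat.cast_nonneg (dl 1 p)) (by linarith)
      exact hU p (by simpa using g)
    · have g1 := ev' 0 1 p q 1 n g; rw [ds, dn (by decide)] at g1
      obtain rfl := n0 (n := n) (add_nonneg (Nat.cast_nonneg (dl 1 p)) (Nat.cast_nonneg (dl 1 q))) (by linarith)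
      have g0 := ev' 0 1 p q 0 0 g; rw [ds, dn (by decide)] at g0
      have i1 : dl 1 p + dl 1 q = 0 ∨ 1 ≤ dl 1 p + dl 1 q := by omega
      push_cast at g1 g0
      rcases i1 with i1 | i1
      · have : (dl 1 p : ℝ) + dl 1 q = 0 := by exact_mod_cast i1
        linarith [d2 0 hpq, c1 2, c2 0, tt_sum w]
      · have : (1:ℝ) ≤ (dl 1 p : ℝ) + dl 1 q := by exact_mod_cast i1
        linarith [c1 1]
  have hm : ∀ n : ℕ, w + n * (uu k - uu l) ∈ L := fun n => L.add_mem hw (by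
    have := L.nsmul_mem (L.sub_mem (h.mem k) (h.mem l)) n; rwa [nsmul_eq_mul] at this)
  have av : ∀ r ∈ L, ∀ i, (∀ p, r ≠ uu p) → (∀ p q, p ≠ q → r + uu i ≠ uu p + uu q) → tr r (e i) ⊆ (J e)ᶜ := fun r hr i h1 h2 x hx hxJ => by
    obtain ⟨p, q, hpq, hx'⟩ := mem_J.1 hxJ
    rcases h.dj' hr (h.mem _) hx hx' with g | g | g
    exacts [h1 q g.2, h1 q g.1, h2 q p hpq.symm g.1]
  let S : ℕ → Set ℂ := fun n => tr (w + n * (uu k - uu l)) (e k) ∪ tr (w + (n + 1 : ℕ) * (uu k - uu l)) (e l)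
  have e1 : ∀ n : ℕ, w + (n + 1 : ℕ) * (uu k - uu l) + uu l = w + n * (uu k - uu l) + uu k := fun n => by push_cast; ring
  have hS1 : ∀ n, S n ⊆ (J e)ᶜ := fun n => union_subset (av _ (hm n) _ (hk n).1 (hk n).2) (av _ (hm _) _ (hk _).1 (by rw [e1]; exact (hk n).2))
  have l1 : ∀ n : ℕ, a + (w + n * (uu k - uu l)) ∈ S n := fun n => .inl ((h.arc k).tr _).left
  have hS2 : IsPreconnected (⋃ n, S n) := IsPreconnected.iUnion_of_chain (fun n => by
    refine ((h.arc k).tr _).conn.union (b + uu k + (w + n * (uu k - uu l))) ((h.arc k).tr _).right ?_ ((h.arc l).tr _).conn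
    have := ((h.arc l).tr (w + (n + 1 : ℕ) * (uu k - uu l))).right
    rwa [add_assoc, add_comm (uu l), e1, add_comm _ (uu k), ← add_assoc] at this)
    fun n => ⟨_, .inr ((h.arc l).tr _).left, l1 (n + 1)⟩
  have l0 := l1 0; simp only [Nat.cast_zero, zero_mul, add_zero] at l0
  refine (ext_or_ins (hS1 0 l0)).resolve_right fun hi => kl (uu_inj (sub_eq_zero.1 ?_))
  refine unb h.jc.ins_bdd (x := a + w) fun n => ins_of_conn hS2 (iUnion_subset hS1) (mem_iUnion_of_mem 0 l0) hi (mem_iUnion_of_mem n ?_)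
  rw [add_assoc]; exact l1 n

lemma off (h : Th L a b e) {w} (hw : w ∈ L) {k x} (hx : x ∈ tr w (e k)) : x ∉ ins (J e) := by
  have key : ∀ {w}, w ∈ L → (∀ p, w ≠ uu p) → ∀ {k x}, x ∈ tr w (e k) → x ∉ ins (J e) := fun {w} hw hU {k x} hx => by
    refine ins_arc h.jc ((h.arc k).tr w) (h.esc hw hU) ?_ hx
    rintro y ⟨y1, y2⟩ y3
    obtain ⟨p, q, hpq, y4⟩ := mem_J.1 y3
    rcases h.dj' hw (h.mem _) y1 y4 with g | g | g
    exacts [hU q g.2, hU q g.1, y2 g.2]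
  by_cases hU : ∀ p, w ≠ uu p
  · exact key hw hU hx
  push Not at hU; obtain ⟨l, rfl⟩ := hU
  by_cases kl : k = l
  swap
  · exact fun hi => hi.1 (mem_J.2 ⟨k, l, kl, hx⟩)
  subst kl
  have h2 : ∀ {p q}, p ≠ q → uu k + uu k ≠ uu q + uu p := fun {p q} hpq g => by
    rcases uu2 g with g | g
    exacts [hpq (g.2.symm.trans g.1), hpq (g.1.symm.trans g.2)]
  have hb : b + uu k + uu k ∉ J e := fun g => by
    obtain ⟨p, q, hpq, y4⟩ := mem_J.1 g
    rcases h.dj' (h.mem _) (h.mem _) ((h.arc k).tr _).right y4 with g | g | g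
    exacts [hpq (g.1.symm.trans (uu_inj g.2)), ((h.arc k).tr _).ne.symm g.2, h2 hpq g.1]
  obtain ⟨l, kl⟩ : ∃ l : Fin 3, k ≠ l := by clear * -; revert k; decide
  have hb2 : b + uu k + uu k ∉ ins (J e) := by
    refine key (w := uu k + uu k - uu l) (L.sub_mem (L.add_mem hw hw) (h.mem l)) (fun p g => h2 kl.symm ?_) (k := l) ?_
    · have g' : uu k + uu k = uu l + uu p := by linear_combination g
      rcases uu2 g' with g | g <;> exact absurd (by tauto) kl
    · have := ((h.arc l).tr (uu k + uu k - uu l)).right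
      rwa [show b + uu l + (uu k + uu k - uu l) = b + uu k + uu k by ring] at this
  refine ins_arc h.jc ((h.arc k).tr (uu k)).symm ((ext_or_ins hb).resolve_right hb2) ?_ hx
  rintro y ⟨y1, y2⟩ y3
  obtain ⟨p, q, hpq, y4⟩ := mem_J.1 y3
  rcases h.dj' hw (h.mem _) y1 y4 with g | g | g
  exacts [hpq (g.1.symm.trans (uu_inj g.2)), y2 g.2, h2 hpq g.1]

end Th
end

section
open Set Filter Topology Metric

def io (m : ℤ × ℤ) : ℂ := ⟨m.1, m.2⟩
lemma io_add (m n) : io (m + n) = io m + io n := by simp [io, Complex.ext_iff]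
lemma io_neg (m) : io (-m) = -io m := by simp [io, Complex.ext_iff]
lemma io_sub (m n) : io (m - n) = io m - io n := by simp [io, Complex.ext_iff]
@[simp] lemma io_zero : io 0 = 0 := by simp [io, Complex.ext_iff]
lemma io_inj : Function.Injective io := fun m n h => by simpa [io, Complex.ext_iff, Prod.ext_iff] using h
def ZI : AddSubgroup ℂ where
  carrier := range io
  zero_mem' := ⟨0, io_zero⟩
  add_mem' := by rintro _ _ ⟨m, rfl⟩ ⟨n, rfl⟩; exact ⟨_, io_add m n⟩
  neg_mem' := by rintro _ ⟨m, rfl⟩; exact ⟨_, io_neg m⟩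
lemma io_mem (m) : io m ∈ ZI := ⟨m, rfl⟩
lemma uu_mem (k) : uu k ∈ ZI := by
  fin_cases k
  exacts [⟨(0, 0), by simp [io, uu, Complex.ext_iff]⟩, ⟨(-1, 0), by simp [io, uu, Complex.ext_iff]⟩, ⟨(0, -1), by simp [io, uu, Complex.ext_iff]⟩]

lemma lf {K : Set ℂ} (hK : Bornology.IsBounded K) : LocallyFinite fun m => tr (io m) K := fun x => by
  obtain ⟨R, hR⟩ := hK.subset_ball 0
  obtain ⟨N, hN⟩ := exists_nat_gt (‖x‖ + 1 + R)
  refine ⟨ball x 1, ball_mem_nhds _ one_pos, (Finset.Icc (-N : ℤ) N ×ˢ Finset.Icc (-N : ℤ) N).finite_toSet.subset ?_⟩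
  rintro m ⟨z, z1, z2⟩
  have h1 := hR z1; rw [mem_ball_zero_iff] at h1; rw [mem_ball, dist_eq_norm] at z2
  have h2 : ‖io m‖ < N := by
    calc ‖io m‖ = ‖x + (z - x) - (z - io m)‖ := by congr 1; ring
      _ ≤ ‖x + (z - x)‖ + ‖z - io m‖ := norm_sub_le _ _
      _ ≤ ‖x‖ + ‖z - x‖ + ‖z - io m‖ := by gcongr; exact norm_add_le _ _
      _ < N := by linarith
  have h3 := abs_le.1 ((Complex.abs_re_le_norm (io m)).trans h2.le)
  have h4 := abs_le.1 ((Complex.abs_im_le_norm (io m)).trans h2.le)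
  simp only [io] at h3 h4
  simp only [Finset.coe_product, mem_prod, Finset.coe_Icc, mem_Icc]
  exact ⟨⟨by exact_mod_cast h3.1, by exact_mod_cast h3.2⟩, by exact_mod_cast h4.1, by exact_mod_cast h4.2⟩

lemma JS.tr {J A B : Set ℂ} {x y} (h : JS J x y A B) (l : ℂ) : JS (tr l J) (x + l) (y + l) (tr l A) (tr l B) := by
  simp only [tr_eq]; exact h.image (by fun_prop) (add_left_injective l).injOn

namespace Th
variable {L : AddSubgroup ℂ} {a b : ℂ} {e : Fin 3 → Set ℂ}

lemma nbd (h : Th L a b e) {k l} (kl : k ≠ l) {x} (hx : x ∈ T e k l) (hxa : x ≠ a + uu l) (hxb : x ≠ b + (uu k + uu l)) :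
    ∃ m, cl (J e) ∪ tr (uu l - uu m) (cl (J e)) ∈ 𝓝 x := by
  obtain ⟨m, lm, mk⟩ : ∃ m : Fin 3, l ≠ m ∧ m ≠ k := by clear * - kl; revert k l; decide
  have j1 := h.js kl lm mk
  have j2 := (h.js mk.symm lm.symm kl.symm).tr (uu l - uu m)
  have eT : ∀ q p, tr q (T e k p) = tr (uu p + q) (e k) := fun q p => tr_tr _ _ _
  rw [show Th.T e k m = tr (uu m) (e k) from rfl, tr_tr, show uu m + (uu l - uu m) = uu l by ring, show a + uu m + (uu l - uu m) = a + uu l by ring,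
    show b + (uu k + uu m) + (uu l - uu m) = b + (uu k + uu l) by ring] at j2
  have hR : ∀ {k l m}, k ≠ l → l ≠ m → m ≠ k → ∀ {x}, x ∈ Rs e k l m → ∃ p q, p ≠ q ∧ ¬ (p = k ∧ q = l) ∧ x ∈ tr (uu q) (e p) := by
    rintro k l m kl lm mk x (x1 | x1 | x1 | x1 | x1)
    exacts [⟨m, l, lm.symm, fun g => mk g.1, x1⟩, ⟨l, m, lm, fun g => kl g.1.symm, x1⟩, ⟨k, m, mk.symm, fun g => lm g.2.symm, x1⟩, ⟨m, k, mk, fun g => mk g.1, x1⟩,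
      ⟨l, k, kl.symm, fun g => kl g.2, x1⟩]
  have hs := L.sub_mem (h.mem l) (h.mem m)
  have hAB : Rs e k l m ∩ tr (uu l - uu m) (Rs e k m l) = {a + uu l, b + (uu k + uu l)} := by
    apply Subset.antisymm
    · rintro x ⟨x1, x2⟩
      obtain ⟨p, q, pq, n1, x1⟩ := hR kl lm mk x1
      obtain ⟨p', q', pq', n2, x2⟩ := hR mk.symm lm.symm kl.symm x2
      have x3 : x ∈ tr (uu q' + (uu l - uu m)) (e p') := by rw [← tr_tr]; exact x2
      have ql : uu q = uu q' + (uu l - uu m) → q = l ∧ q' = m := fun g => by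
        rcases uu2 (show uu q + uu m = uu l + uu q' by linear_combination g) with g | g
        exacts [⟨g.1, g.2.symm⟩, absurd g.2.symm lm]
      rcases h.dj' (h.mem _) (L.add_mem (h.mem _) hs) x1 x3 with g | g | g
      · obtain ⟨g1, g2⟩ := g; obtain ⟨rfl, rfl⟩ := ql g2; subst g1
        exact absurd ⟨by clear * - kl lm mk pq pq'; revert k p q q'; decide, rfl⟩ n1
      · obtain ⟨rfl, -⟩ := ql g.1; exact .inl g.2
      · have g1 := uu3 (show uu q + uu p + uu m = uu q' + uu p' + uu l by linear_combination g.1)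
        have : (p = k ∧ q = l) ∨ (p = l ∧ q = k) := by clear * - g1 kl lm mk pq pq'; unfold dl at g1; revert k l m p q p' q'; decide
        rcases this with ⟨rfl, rfl⟩ | ⟨rfl, rfl⟩
        · exact absurd ⟨rfl, rfl⟩ n1
        · right; rw [g.2, mem_singleton_iff]; ring
    · exact pair_subset ⟨j1.2.1.left, j2.2.1.left⟩ ⟨j1.2.1.right, j2.2.1.right⟩
  have j3 := three j1 j2 hAB (fun x hx hi => by
      obtain ⟨p, q, -, -, x1⟩ := hR kl lm mk hx
      rw [tr_ins] at hi
      refine h.off (L.sub_mem (h.mem q) hs) (k := p) ?_ hi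
      rwa [mem_tr, show x - (uu l - uu m) - (uu q - (uu l - uu m)) = x - uu q by ring])
    (fun x hx hi => by
      obtain ⟨p, q, -, -, x1⟩ := hR mk.symm lm.symm kl.symm hx
      refine h.off (L.add_mem (h.mem q) hs) (k := p) ?_ hi
      rw [← tr_tr]; exact x1)
  have j4 : JS _ _ _ _ _ := ⟨j1.2.1, j2.2.1, hAB, rfl⟩
  have j5 := th_cl j4 j1.1 j3
  rw [union_comm _ (T e k l), j1.2.2.2, union_comm _ (T e k l)] at j5
  have j6 := j2.2.2.2; unfold T at j5; rw [j6, tr_cl] at j5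
  refine ⟨m, ?_⟩
  rw [← j5]
  exact mem_of_superset (j4.jordan.ins_open.mem_nhds (j3 ⟨hx, by simp [hxa, hxb]⟩)) subset_union_right

lemma cover (h : Th L a b e) (x : ℂ) : ∃ m, x ∈ tr (io m) (cl (J e)) := by
  set X := ⋃ m, tr (io m) (cl (J e)) with hX
  have hcl : IsClosed X := (lf h.jc.cl_compact.isBounded).isClosed_iUnion fun m => by
    rw [← tr_cl]; exact (h.jc.tr _).cl_closed
  have hXt : ∀ m, tr (io m) X ⊆ X := fun m z hz => by
    obtain ⟨n, hn⟩ := mem_iUnion.1 hz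
    exact mem_iUnion.2 ⟨m + n, by rw [io_add, mem_tr, ← sub_sub]; exact hn⟩
  set V : Set ℂ := range (fun m => a + io m) ∪ range (fun m => b + io m)
  have hV : V.Countable := (countable_range _).union (countable_range _)
  have hin : ∀ x ∈ X, x ∉ V → x ∈ interior X := fun x hx hxV => by
    obtain ⟨m, hm⟩ := mem_iUnion.1 hx
    have hc : Tendsto (fun z => z - io m) (𝓝 x) (𝓝 (x - io m)) := (continuous_sub_right _).tendsto x
    rw [mem_interior_iff_mem_nhds]
    rcases hm with hm | hm
    · obtain ⟨p, q, pq, hx2⟩ := mem_J.1 hm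
      obtain ⟨r, hr⟩ := uu_mem p; obtain ⟨s, hs⟩ := uu_mem q
      obtain ⟨m', hm'⟩ := h.nbd pq hx2 (fun g => hxV (.inl ⟨m + s, by simp only [io_add]; rw [hs]; linear_combination -g⟩))
        (fun g => hxV (.inr ⟨m + (r + s), by simp only [io_add]; rw [hs, hr]; linear_combination -g⟩))
      obtain ⟨t, ht⟩ := ZI.sub_mem (uu_mem q) (uu_mem m')
      filter_upwards [hc hm'] with z hz
      refine hXt m ?_
      rcases hz with hz | hz
      · exact mem_iUnion.2 ⟨0, by simpa using hz⟩
      · exact mem_iUnion.2 ⟨t, by rw [ht]; exact hz⟩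
    · filter_upwards [hc (h.jc.ins_open.mem_nhds hm)] with z hz
      exact mem_iUnion.2 ⟨m, .inr hz⟩
  have hVc : IsPreconnected Vᶜ := (hV.isPathConnected_compl_of_one_lt_rank (by rw [Complex.rank_real_complex]; norm_num)).isConnected.isPreconnected
  have hd : Dense Vᶜ := hV.dense_compl ℝ
  obtain ⟨p, p1, p2⟩ := hd.inter_open_nonempty _ h.jc.ins_open h.jc.ins_nonempty
  have hsub : Vᶜ ⊆ X := fun q hq => by
    by_contra hqX
    obtain ⟨y, y1, y2⟩ := conn_frontier hVc p2 (mem_iUnion.2 ⟨0, by simpa using .inr p1⟩) hq hqX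
    rw [hcl.frontier_eq] at y2
    exact y2.2 (hin y y2.1 y1)
  have : x ∈ X := hcl.closure_subset_iff.2 hsub (by rw [hd.closure_eq]; trivial)
  exact mem_iUnion.1 this

lemma ZI_le (h : Th L a b e) : ZI ≤ L := by
  rintro _ ⟨m, rfl⟩
  have : io m = -((m.1 : ℤ) • uu 1 + (m.2 : ℤ) • uu 2) := by simp [io, uu, Complex.ext_iff]
  rw [this]; exact L.neg_mem (L.add_mem (L.zsmul_mem (h.mem 1) _) (L.zsmul_mem (h.mem 2) _))

lemma L_eq (h : Th L a b e) : L = ZI := by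
  refine le_antisymm (fun n hn => ?_) h.ZI_le
  obtain ⟨m, hm⟩ := h.cover (a + n)
  have hs := L.sub_mem hn (h.ZI_le (io_mem m))
  have hx : a + n - io m ∈ tr (n - io m) (e 0) := by
    have := ((h.arc 0).tr (n - io m)).left; rwa [← add_sub_assoc] at this
  obtain ⟨p, q, pq, hx2⟩ := mem_J.1 (hm.resolve_right fun g => h.off hs hx g)
  have : n - io m ∈ ZI := by
    rcases h.dj' hs (h.mem _) hx hx2 with g | g | g
    · rw [g.2]; exact uu_mem _
    · rw [g.1]; exact uu_mem _
    · rw [eq_sub_of_add_eq g.1]; exact ZI.sub_mem (ZI.add_mem (uu_mem _) (uu_mem _)) (uu_mem _)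
  simpa using ZI.add_mem this (io_mem m)

lemma disj (h : Th L a b e) {w} (hw : w ∈ L) (h0 : w ≠ 0) {x} (hx : x ∈ ins (J e)) : x ∉ tr w (cl (J e)) := by
  have hav : ins (J e) ⊆ (tr w (J e))ᶜ := fun y hy hyJ => by
    obtain ⟨p, q, pq, hy2⟩ := mem_J.1 hyJ
    exact h.off (L.add_mem (h.mem q) hw) (k := p) (by rw [← tr_tr]; exact hy2) hy
  rintro (g | g)
  · exact hav hx g
  have hs : ins (J e) ⊆ tr w (ins (J e)) := by
    rw [← tr_ins]; exact ins_of_conn h.jc.ins_conn hav hx (by rw [tr_ins]; exact g)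
  refine h0 (neg_eq_zero.1 (unb h.jc.ins_bdd (x := x) fun n => ?_))
  induction n with
  | zero => simpa using hx
  | succ n ih => have := hs ih; rw [mem_tr] at this; push_cast; rwa [show x + n * -w - w = x + (n + 1) * -w by ring] at this

end Th
end

section
open Set Filter Topology Metric

structure Lft (L : AddSubgroup ℂ) (M : Fin 3 → Fin 3 → ℂ) (a b : Fin 3 → ℂ) (E : Fin 3 → Fin 3 → Set ℂ) : Prop where
  mem : ∀ i j, M i j ∈ L
  arc : ∀ i j, IsArc (E i j) (a i) (b j + M i j)
  dj : ∀ i j i' j' x, ∀ l ∈ L, x ∈ E i j → x + l ∈ E i' j' →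
    (i = i' ∧ j = j' ∧ l = 0) ∨ (i = i' ∧ l = 0 ∧ x = a i) ∨ (j = j' ∧ l = M i' j' - M i j ∧ x = b j + M i j)

structure Nrm (M : Fin 3 → Fin 3 → ℂ) : Prop where
  row : ∀ j, M 0 j = 0
  col : ∀ i, M i 0 = 0
  dg : ∀ k, M k k = -uu k

@[simp] lemma uu_zero : uu 0 = 0 := by simp [uu]
def te (E : Fin 3 → Fin 3 → Set ℂ) (k : Fin 3) : Set ℂ := E 0 k ∪ (tr (uu k) (E k k) ∪ tr (uu k) (E k 0))

namespace Lft
variable {L : AddSubgroup ℂ} {M : Fin 3 → Fin 3 → ℂ} {a b : Fin 3 → ℂ} {E : Fin 3 → Fin 3 → Set ℂ}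

lemma dj' (h : Lft L M a b E) {i j i' j' x l l'} (hl : l ∈ L) (hl' : l' ∈ L) (h1 : x ∈ tr l (E i j)) (h2 : x ∈ tr l' (E i' j')) :
    (i = i' ∧ j = j' ∧ l = l') ∨ (i = i' ∧ l = l' ∧ x = a i + l) ∨ (j = j' ∧ l + M i j = l' + M i' j' ∧ x = b j + M i j + l) := by
  rcases h.dj i j i' j' (x - l) (l - l') (L.sub_mem hl hl') h1 (by simpa [mem_tr] using h2) with ⟨g, g', g''⟩ | ⟨g, g', g''⟩ | ⟨g, g', g''⟩
  · exact .inl ⟨g, g', sub_eq_zero.1 g''⟩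
  · exact .inr (.inl ⟨g, sub_eq_zero.1 g', by rw [← g'']; ring⟩)
  · exact .inr (.inr ⟨g, by linear_combination g', by rw [← g'']; ring⟩)

lemma aa (h : Lft L M a b E) {i i' l l'} (hl : l ∈ L) (hl' : l' ∈ L) (g : a i + l = a i' + l') : i = i' ∧ l = l' := by
  rcases h.dj' hl hl' (x := a i + l) (i := i) (i' := i') (j := 0) (j' := 0) (by simpa [mem_tr] using (h.arc i 0).left)
    (by rw [g]; simpa [mem_tr] using (h.arc i' 0).left) with g | g | g
  · exact ⟨g.1, g.2.2⟩
  · exact ⟨g.1, g.2.1⟩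
  · exact absurd (add_right_cancel g.2.2) (h.arc i 0).ne

lemma ab (h : Lft L M a b E) {i j l l'} (hl : l ∈ L) (hl' : l' ∈ L) : a i + l ≠ b j + l' := fun g => by
  have hs := L.sub_mem hl' (h.mem i j)
  have : l = l' - M i j := by
    rcases h.dj' hl hs (x := a i + l) (i := i) (i' := i) (j := j) (j' := j) (by simpa [mem_tr] using (h.arc i j).left)
      (by rw [g, mem_tr, show b j + l' - (l' - M i j) = b j + M i j by ring]; exact (h.arc i j).right) with g | g | g
    exacts [g.2.2, g.2.1, by linear_combination g.2.1]
  exact (h.arc i j).ne (by linear_combination g - this)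

lemma bb (h : Lft L M a b E) {j j' l l'} (hl : l ∈ L) (hl' : l' ∈ L) (g : b j + l = b j' + l') : j = j' ∧ l = l' := by
  have r : ∀ j l, b j + l ∈ tr (l - M 0 j) (E 0 j) := fun j l => by
    rw [mem_tr, show b j + l - (l - M 0 j) = b j + M 0 j by ring]; exact (h.arc 0 j).right
  rcases h.dj' (L.sub_mem hl (h.mem 0 j)) (L.sub_mem hl' (h.mem 0 j')) (r j l) (g ▸ r j' l') with g | g | g
  · refine ⟨g.2.1, ?_⟩; obtain ⟨-, rfl, g⟩ := g; exact sub_left_injective g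
  · exact absurd g.2.2.symm (h.ab (L.sub_mem hl (h.mem 0 j)) hl)
  · exact ⟨g.1, by linear_combination g.2.1⟩

noncomputable def ps (k c : Fin 3) : Fin 3 × Fin 3 × ℂ := (![0, k, k] c, ![k, k, 0] c, ![0, uu k, uu k] c)

lemma mem_te {k x} : x ∈ te E k ↔ ∃ c, x ∈ tr (ps k c).2.2 (E (ps k c).1 (ps k c).2.1) := by
  constructor
  · rintro (g | g | g)
    exacts [⟨0, by simpa [ps, tr_zero] using g⟩, ⟨1, g⟩, ⟨2, g⟩]
  · rintro ⟨c, g⟩; fin_cases c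
    exacts [.inl (by simpa [ps, tr_zero] using g), .inr (.inl g), .inr (.inr g)]

lemma uu_L (h : Lft L M a b E) (n : Nrm M) (k) : uu k ∈ L := by have := L.neg_mem (h.mem k k); rwa [n.dg, neg_neg] at this

lemma ps_mem (h : Lft L M a b E) (n : Nrm M) (k c) : (ps k c).2.2 ∈ L := by
  fin_cases c
  exacts [L.zero_mem, h.uu_L n k, h.uu_L n k]

lemma th (h : Lft L M a b E) (n : Nrm M) : Th L (a 0) (b 0) (te E) where
  mem := h.uu_L n
  arc k := by
    rcases eq_or_ne k 0 with rfl | hk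
    · have := h.arc 0 0; simpa [te, tr_zero, n.row] using this
    have u := h.uu_L n k
    have h1 := h.arc 0 k; rw [n.row, add_zero] at h1
    have h2 := ((h.arc k k).tr (uu k)).symm; rw [n.dg, neg_add_cancel_right] at h2
    have h3 := (h.arc k 0).tr (uu k); rw [n.col, add_zero] at h3
    refine h1.concat (h2.concat h3 ?_) ?_
    · rintro x ⟨x1, x2⟩
      rcases h.dj' u u x1 x2 with g | g | g
      exacts [absurd g.2.1 hk, g.2.2, absurd g.1 hk]
    · rintro x ⟨x1, x2⟩
      rw [← tr_zero (E 0 k)] at x1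
      rcases x2 with x2 | x2
      · rcases h.dj' L.zero_mem u x1 x2 with g | g | g
        exacts [absurd g.1.symm hk, absurd g.1.symm hk, by simpa [n.row] using g.2.2]
      · rcases h.dj' L.zero_mem u x1 x2 with g | g | g
        exacts [absurd g.1.symm hk, absurd g.1.symm hk, absurd g.1 hk]
  dj k k' x l hl x1 x2 := by
    obtain ⟨c, x1⟩ := mem_te.1 x1
    obtain ⟨c', x2⟩ := mem_te.1 x2
    have x3 : x ∈ tr ((ps k' c').2.2 - l) (E (ps k' c').1 (ps k' c').2.1) := by
      rw [mem_tr] at x2 ⊢; rwa [show x - ((ps k' c').2.2 - l) = x + l - (ps k' c').2.2 by ring]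
    have z : ∀ {k k' : Fin 3}, k = k' ↔ k' = k := ⟨Eq.symm, Eq.symm⟩
    have n0 := n.row; have n1 := n.col; have n2 := n.dg
    have l0 : ∀ z : ℂ, z = z - l ↔ l = 0 := fun z => by rw [eq_comm, sub_eq_self]
    rcases eq_or_ne k 0 with hk | hk <;> rcases eq_or_ne k' 0 with hk' | hk' <;>
    rcases h.dj' (h.ps_mem n k c) (L.sub_mem (h.ps_mem n k' c') hl) x1 x3 with ⟨g1, g2, g3⟩ | ⟨g1, g2, g3⟩ | ⟨g1, g2, g3⟩ <;>
    fin_cases c <;> fin_cases c' <;> simp [ps, n0, n1, n2] at g1 g2 g3 <;> grind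
end Lft
end

section
open Set Filter Topology Metric

lemma Sbd.glue {G S} (h : Sbd G S) : ∃ R : Set (Bool → ℂ), IsCompact R ∧ (∀ b, InjOn (fun p => p b) R ∧ pj b R = cl (pj b G)) ∧ G ⊆ R ∧ ∀ i ∈ S, i ⊆ R := by
  choose! R R1 R2 R3 using fun i (hi : i ∈ S) => schoenflies (h.val i hi)
  refine ⟨⋃ i ∈ S, R i, h.fin.isCompact_biUnion R1, fun b => ⟨?_, ?_⟩, ?_, fun i hi => (R3 i hi).trans (subset_biUnion_of_mem hi)⟩
  · intro p hp q hq e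
    simp only [mem_iUnion] at hp hq
    obtain ⟨i, hi, hp⟩ := hp; obtain ⟨j, hj, hq⟩ := hq
    rcases eq_or_ne i j with rfl | ne
    · exact (R2 i hi b).1 hp hq e
    have e1 : p b ∈ cl (pj b i) := by rw [← (R2 i hi b).2]; exact ⟨p, hp, rfl⟩
    have e2 : p b ∈ cl (pj b j) := by rw [← (R2 j hj b).2]; exact ⟨q, hq, e.symm⟩
    obtain ⟨r, r1, r2, r3⟩ := h.link b i hi j hj ne _ e1 e2
    rw [← (R2 i hi b).1 (R3 i hi r1) hp r3, ← (R2 j hj b).1 (R3 j hj r2) hq (r3.trans e)]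
  · apply Subset.antisymm
    · rintro _ ⟨p, hp, rfl⟩
      simp only [mem_iUnion] at hp
      obtain ⟨i, hi, hp⟩ := hp
      exact h.sub i hi b (by rw [← (R2 i hi b).2]; exact ⟨p, hp, rfl⟩)
    · intro x hx
      obtain ⟨i, hi, hx⟩ := h.cov b x hx
      rw [← (R2 i hi b).2] at hx
      obtain ⟨p, hp, rfl⟩ := hx
      exact ⟨p, mem_biUnion hi hp, rfl⟩
  · intro p hp
    obtain ⟨i, hi, hx⟩ := h.cov true (p true) (.inl ⟨p, hp, rfl⟩)
    exact mem_biUnion hi (R3 i hi (h.inh true p hp i hi hx))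

lemma sch2 {G} (h : Valid G) {C C' : Set (Bool → ℂ)} {p q p' q'} (hp : p ∈ G) (hq : q ∈ G) (hp' : p' ∈ G) (hq' : q' ∈ G)
    (C1 : IsArc C p q) (C2 : ∀ b, InjOn (fun p : Bool → ℂ => p b) C) (C3 : ∀ b, pj b C \ {p b, q b} ⊆ ins (pj b G))
    (D1 : IsArc C' p' q') (D2 : ∀ b, InjOn (fun p : Bool → ℂ => p b) C') (D3 : ∀ b, pj b C' \ {p' b, q' b} ⊆ ins (pj b G))
    (dis : ∀ b x, x ∈ pj b C → x ∉ pj b C') :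
    ∃ R : Set (Bool → ℂ), IsCompact R ∧ (∀ b, InjOn (fun p => p b) R ∧ pj b R = cl (pj b G)) ∧ G ⊆ R ∧ C ⊆ R ∧ C' ⊆ R := by
  obtain ⟨A, B, hj⟩ := h.1.split hp hq C1.ne
  wlog hA : p' ∈ A generalizing A B
  · exact this B A hj.swap (by rw [← hj.2.2.2] at hp'; exact hp'.resolve_left hA)
  obtain ⟨k0, k1, k2⟩ := h.cutC hp hq C1 (fun b => ⟨rfl, C2 b⟩) C3 hj
  have hjb := fun b => hj.image (f := fun p : Bool → ℂ => p b) (by fun_prop) (h.2 b)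
  have c1 : ∀ b, IsArc (pj b C) (p b) (q b) := fun b => C1.image (by fun_prop) (C2 b)
  have d1 : ∀ b, IsArc (pj b C') (p' b) (q' b) := fun b => D1.image (by fun_prop) (D2 b)
  have hin : ∀ b, pj b C' \ {p' b, q' b} ⊆ ins (pj b (A ∪ C)) := fun b => by
    have h1 := th_ins (hjb b) (c1 b) (C3 b)
    have h2 : pj b C' \ {p' b, q' b} ⊆ ins (pj b (A ∪ C)) ∪ ins (pj b (B ∪ C)) := by
      rw [k1, k2]; exact fun x hx => h1 ▸ ⟨D3 b hx, fun g => dis b x g hx.1⟩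
    have v1 := (k0.val _ (.inl rfl)).jc b
    have v2 := (k0.val _ (.inr rfl)).jc b
    obtain ⟨x, hx⟩ := (d1 b).mid
    rcases h2 hx with g | g
    · refine (d1 b).diff_conn.subset_left_of_subset_union v1.ins_open v2.ins_open ?_ h2 ⟨x, hx, g⟩
      rw [k1, k2]; exact th_disj (hjb b) (c1 b) (C3 b)
    · exfalso
      have h3 : pj b C' \ {p' b, q' b} ⊆ ins (pj b (B ∪ C)) := by
        refine (d1 b).diff_conn.subset_right_of_subset_union v1.ins_open v2.ins_open ?_ h2 ⟨x, hx, g⟩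
        rw [k1, k2]; exact th_disj (hjb b) (c1 b) (C3 b)
      have h4 : p' b ∈ cl (pj b (B ∪ C)) := by rw [v2.cl_closure]; exact closure_mono h3 ((d1 b).subset_closure (d1 b).left)
      have h5 : p' ∉ C := fun g => dis b _ ⟨p', g, rfl⟩ (d1 b).left
      have h6 := (k0.inh b p' hp' _ (.inr rfl) h4).resolve_right h5
      have h7 : p' ∈ A ∩ B := ⟨hA, h6⟩
      rw [hj.2.2.1] at h7
      rcases h7 with rfl | rfl
      exacts [h5 C1.left, h5 C1.right]
  have hpA : p' ∈ A ∪ C := .inl hA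
  have hqA : q' ∈ A ∪ C := k0.inh true q' hq' _ (.inl rfl) (by
    rw [((k0.val _ (.inl rfl)).jc true).cl_closure]; exact closure_mono (hin true) ((d1 true).subset_closure (d1 true).right))
  have v := k0.val _ (.inl rfl)
  obtain ⟨A', B', hj'⟩ := v.1.split hpA hqA D1.ne
  obtain ⟨m0, -, -⟩ := v.cutC hpA hqA D1 (fun b => ⟨rfl, D2 b⟩) hin hj'
  classical
  have s := k0.trans (T := fun i => if i = A ∪ C then {A' ∪ C', B' ∪ C'} else {i}) (by
    intro i hi
    by_cases g : i = A ∪ C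
    · subst g; simpa using m0
    · simp only [g, if_false]; exact Sbd.self (k0.val i hi))
  obtain ⟨R, R1, R2, R3, R4⟩ := s.glue
  have hC' : C' ⊆ R := subset_union_right.trans (R4 (A' ∪ C') (mem_biUnion (.inl rfl) (by simp)))
  have hAC : A ∪ C ⊆ R := by
    rw [← hj'.2.2.2]
    exact union_subset (subset_union_left.trans (R4 (A' ∪ C') (mem_biUnion (.inl rfl) (by simp)))) (subset_union_left.trans (R4 (B' ∪ C') (mem_biUnion (.inl rfl) (by simp))))
  exact ⟨R, R1, R2, R3, subset_union_right.trans hAC, hC'⟩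
end

section
open Set Filter Topology Metric

namespace Lft
variable {L : AddSubgroup ℂ} {M : Fin 3 → Fin 3 → ℂ} {a b : Fin 3 → ℂ} {E : Fin 3 → Fin 3 → Set ℂ}

lemma a_te (h : Lft L M a b E) (n : Nrm M) {i k w} (hi : i ≠ 0) (hw : w ∈ L) (g : a i + w ∈ te E k) : k = i ∧ w = uu i := by
  obtain ⟨c, g⟩ := mem_te.1 g
  have hc := h.ps_mem n k c
  rcases h.dj' hw hc (x := a i + w) (i := i) (j := 0) (by simpa [mem_tr] using (h.arc i 0).left) g with ⟨g1, g2, g3⟩ | ⟨g1, g2, g3⟩ | ⟨g1, g2, g3⟩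
  · fin_cases c <;> simp [ps] at g1 g2 g3 <;> grind
  · fin_cases c <;> simp [ps] at g1 g2 <;> grind
  · rw [add_assoc] at g3; exact absurd g3 (h.ab hw (L.add_mem (h.mem _ _) hw))

lemma b_te (h : Lft L M a b E) (n : Nrm M) {j k w} (hj : j ≠ 0) (hw : w ∈ L) (g : b j + w ∈ te E k) : k = j ∧ w = 0 := by
  obtain ⟨c, g⟩ := mem_te.1 g
  have hc := h.ps_mem n k c
  have n0 := n.row; have n2 := n.dg
  rcases h.dj' hw hc (x := b j + w) (i := 0) (j := j) (by simpa [mem_tr, n.row] using (h.arc 0 j).right) g with ⟨g1, g2, g3⟩ | ⟨g1, g2, g3⟩ | ⟨g1, g2, g3⟩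
  · fin_cases c <;> simp [ps] at g1 g2 g3 <;> grind
  · exact absurd g3.symm (h.ab hw hw)
  · fin_cases c <;> simp [ps, n0, n2] at g1 g2 <;> grind

lemma te_nmem (h : Lft L M a b E) (n : Nrm M) {i j k} (hi : i ≠ 0) (hj : j ≠ 0) (ij : i ≠ j) {x w} (hw : w ∈ L) (hx : x ∈ E i j \ {a i, b j + M i j}) :
    x ∉ tr w (te E k) := fun g => by
  obtain ⟨c, g⟩ := mem_te.1 g
  have g : x ∈ tr ((ps k c).2.2 + w) (E (ps k c).1 (ps k c).2.1) := by rw [← tr_tr]; exact g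
  rcases h.dj' L.zero_mem (L.add_mem (h.ps_mem n k c) hw) (x := x) (i := i) (j := j) (by simpa [tr_zero] using hx.1) g with ⟨g1, g2, g3⟩ | ⟨g1, g2, g3⟩ | ⟨g1, g2, g3⟩
  · fin_cases c <;> simp [ps] at g1 g2 <;> grind
  · exact hx.2 (.inl (by simpa using g3))
  · exact hx.2 (.inr (by simpa using g3))

lemma chord (h : Lft L M a b E) (n : Nrm M) {i j} (hi : i ≠ 0) (hj : j ≠ 0) (ij : i ≠ j) : ∃ q q', q ≠ i ∧ q' ≠ j ∧ M i j = uu q' - uu i - uu q ∧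
    a i + (uu i + uu q) ∈ Th.J (te E) ∧ b j + M i j + (uu i + uu q) ∈ Th.J (te E) ∧
    tr (uu i + uu q) (E i j) \ {a i + (uu i + uu q), b j + M i j + (uu i + uu q)} ⊆ ins (Th.J (te E)) := by
  have t := h.th n
  have A := h.arc i j
  obtain ⟨x, hx⟩ := A.mid
  obtain ⟨m, hm⟩ := t.cover x
  have hmL := t.ZI_le (io_mem m)
  have av : E i j \ {a i, b j + M i j} ⊆ (tr (io m) (Th.J (te E)))ᶜ := fun y hy g => by
    obtain ⟨p, q, -, g⟩ := Th.mem_J.1 g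
    exact h.te_nmem n hi hj ij (k := p) (L.add_mem (t.mem q) hmL) hy (by rw [← tr_tr]; exact g)
  have S : E i j \ {a i, b j + M i j} ⊆ ins (tr (io m) (Th.J (te E))) := by
    refine ins_of_conn A.diff_conn av hx ?_
    rw [← tr_cl] at hm; exact hm.resolve_left (av hx)
  have en : ∀ y ∈ E i j, ∀ w ∈ L, ∀ k, y ∈ tr w (te E k) → y - io m ∈ Th.J (te E) := fun y hy w hw k hk => by
    have : y ∈ cl (tr (io m) (Th.J (te E))) := by rw [(t.jc.tr _).cl_closure]; exact closure_mono S (A.subset_closure hy)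
    rw [tr_cl] at this
    refine this.resolve_right fun g => t.off (L.sub_mem hw hmL) (k := k) (x := y - io m) ?_ g
    rw [mem_tr] at hk ⊢; rwa [show y - io m - (w - io m) = y - w by ring]
  have e1 := en _ A.left (-uu i) (L.neg_mem (t.mem i)) i (.inr (.inl (by simpa [mem_tr] using (h.arc i i).left)))
  have e2 := en _ A.right (M i j) (h.mem i j) j (.inl (by simpa [mem_tr, n.row] using (h.arc 0 j).right))
  obtain ⟨p, q, pq, f1⟩ := Th.mem_J.1 e1
  obtain ⟨p', q', pq', f2⟩ := Th.mem_J.1 e2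
  rw [mem_tr, sub_sub, sub_eq_add_neg] at f1
  rw [mem_tr, sub_sub, add_sub_assoc] at f2
  obtain ⟨rfl, g1⟩ := h.a_te n hi (L.neg_mem (L.add_mem hmL (t.mem q))) f1
  obtain ⟨rfl, g2⟩ := h.b_te n hj (L.sub_mem (h.mem _ _) (L.add_mem hmL (t.mem q'))) f2
  have em : uu p + uu q = -io m := by rw [← g1]; ring
  refine ⟨q, q', pq.symm, pq'.symm, by linear_combination g2 - g1, ?_, ?_, ?_⟩ <;> rw [em]
  · exact e1
  · exact e2
  · rintro y ⟨y1, y2⟩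
    have := @S (y + io m) ⟨by simpa [mem_tr] using y1, fun g => y2 ?_⟩
    · rw [tr_ins, mem_tr] at this; simpa using this
    · rcases g with g | g
      exacts [.inl (by rw [← g]; ring), .inr (by rw [mem_singleton_iff, ← mem_singleton_iff.1 g]; ring)]
end Lft

lemma inv_cont {X Y : Type*} [TopologicalSpace X] [TopologicalSpace Y] [T2Space Y] [Nonempty X] {K : Set X} (hK : IsCompact K) {f : X → Y} (hf : ContinuousOn f K)
    (hi : InjOn f K) : ContinuousOn (Function.invFunOn f K) (f '' K) := by
  rw [continuousOn_iff_isClosed]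
  refine fun t ht => ⟨f '' (K ∩ t), ((hK.inter_right ht).image_of_continuousOn (hf.mono inter_subset_left)).isClosed, ?_⟩
  ext y; constructor
  · rintro ⟨h, x, hx, rfl⟩; rw [mem_preimage, hi.leftInvOn_invFunOn hx] at h; exact ⟨⟨x, ⟨hx, h⟩, rfl⟩, x, hx, rfl⟩
  · rintro ⟨⟨x, hx, rfl⟩, h⟩; exact ⟨by rw [mem_preimage, hi.leftInvOn_invFunOn hx.1]; exact hx.2, h⟩

lemma IsJC.of_image {X Y : Type*} [TopologicalSpace X] [TopologicalSpace Y] [T2Space Y] [Nonempty X] {K : Set X} (hK : IsCompact K) {f : X → Y} (hf : ContinuousOn f K)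
    (hi : InjOn f K) (h : IsJC (f '' K)) : IsJC K := by
  have := h.image (inv_cont hK hf hi) (Function.invFunOn_injOn_image _ _)
  rwa [hi.invFunOn_image Subset.rfl] at this
end

section
open Set Filter Topology Metric

structure Cv {X : Type*} [TopologicalSpace X] (L : AddSubgroup ℂ) (p : ℂ → X) : Prop where
  cov : IsCoveringMap p
  surj : Function.Surjective p
  ker : ∀ x y, p x = p y ↔ x - y ∈ L

def dg (l : ℂ) : Bool → ℂ := fun _ => l

lemma homeo_of {X : Type*} [TopologicalSpace X] [T2Space X] {K : Set (Bool → X)} (hK : IsCompact K) (hi : ∀ k, InjOn (fun z => z k) K) (hs : ∀ k x, ∃ z ∈ K, z k = x) :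
    ∃ H : X ≃ₜ X, ∀ z ∈ K, H (z true) = z false := by
  have : CompactSpace K := isCompact_iff_compactSpace.1 hK
  let e : ∀ k, K ≃ X := fun k => Equiv.ofBijective (fun z => z.1 k) ⟨fun z w g => Subtype.ext (hi k z.2 w.2 g), fun x => by
    obtain ⟨z, hz, rfl⟩ := hs k x; exact ⟨⟨z, hz⟩, rfl⟩⟩
  let f : ∀ k, K ≃ₜ X := fun k => Continuous.homeoOfEquivCompactToT2 (f := e k) ((continuous_apply k).comp continuous_subtype_val)
  refine ⟨(f true).symm.trans (f false), fun z hz => ?_⟩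
  have : z true = f true ⟨z, hz⟩ := rfl
  rw [this, Homeomorph.trans_apply, Homeomorph.symm_apply_apply]; rfl

lemma rigid {X : Type*} [TopologicalSpace X] [T2Space X] {M} (n : Nrm M) {p : Bool → ℂ → X} (hp : ∀ k, Cv ZI (p k)) {a b : Bool → Fin 3 → ℂ}
    {E : Bool → Fin 3 → Fin 3 → Set ℂ} (h : ∀ k, Lft ZI M (a k) (b k) (E k)) :
    ∃ H : X ≃ₜ X, ∀ i j, H '' (p true '' E true i j) = p false '' E false i j := by
  choose C C1 C2 using fun i j => arc_pair fun k => (h k).arc i j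
  have Cm : ∀ {k i j z}, z ∈ C i j → z k ∈ E k i j := fun {k i j z} hz => by rw [← (C2 i j k).1]; exact ⟨z, hz, rfl⟩
  have key : ∀ k i j i' j' l l' z w, l ∈ ZI → l' ∈ ZI → z ∈ C i j → w ∈ C i' j' → z k + l = w k + l' → z + dg l = w + dg l' := by
    intro k i j i' j' l l' z w hl hl' hz hw g
    rcases (h k).dj' hl hl' (x := z k + l) (by simpa [mem_tr] using Cm hz) (by rw [g]; simpa [mem_tr] using Cm hw) with ⟨rfl, rfl, rfl⟩ | ⟨rfl, rfl, g3⟩ | ⟨rfl, g2, g3⟩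
    · rw [(C2 i j k).2 hz hw (add_right_cancel g)]
    · have := (C2 i j k).2 hz (C1 i j).left (add_right_cancel g3)
      rw [this, (C2 i j' k).2 hw (C1 i j').left (add_right_cancel (g.symm.trans g3))]
    · have e1 := (C2 i j k).2 hz (C1 i j).right (add_right_cancel g3)
      have e2 := (C2 i' j k).2 hw (C1 i' j).right (add_right_cancel (b := l') (g.symm.trans (g3.trans (by linear_combination g2))))
      rw [e1, e2]; funext r; simp only [Pi.add_apply, dg]; linear_combination g2
  have t := fun k => (h k).th n
  set G : Set (Bool → ℂ) := ⋃ (r : Fin 3) (s : Fin 3) (c : Fin 3) (_ : r ≠ s), (fun z => z + dg (uu s + (Lft.ps r c).2.2)) '' C (Lft.ps r c).1 (Lft.ps r c).2.1 with hG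
  have Gm : ∀ {z}, z ∈ G ↔ ∃ r s c, r ≠ s ∧ ∃ w ∈ C (Lft.ps r c).1 (Lft.ps r c).2.1, w + dg (uu s + (Lft.ps r c).2.2) = z := by
    intro z; simp only [hG, mem_iUnion, mem_image, exists_prop]
  have sm : ∀ s r c, uu s + (Lft.ps r c).2.2 ∈ ZI := fun s r c => ZI.add_mem (uu_mem s) ((h true).ps_mem n r c)
  have Gj : ∀ k, pj k G = Th.J (te (E k)) := fun k => by
    ext x; rw [Th.mem_J]; constructor
    · rintro ⟨z, hz, rfl⟩
      obtain ⟨r, s, c, rs, w, hw, rfl⟩ := Gm.1 hz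
      exact ⟨r, s, rs, Lft.mem_te.2 ⟨c, by rw [mem_tr]; simpa [dg, sub_sub] using Cm hw⟩⟩
    · rintro ⟨r, s, rs, g⟩
      obtain ⟨c, g⟩ := Lft.mem_te.1 g
      rw [mem_tr, ← (C2 _ _ k).1] at g
      obtain ⟨w, hw, g⟩ := g
      exact ⟨_, Gm.2 ⟨r, s, c, rs, w, hw, rfl⟩, by simp only [Pi.add_apply, dg] at g ⊢; rw [g]; ring⟩
  have Gc : IsCompact G := isCompact_iUnion fun r => isCompact_iUnion fun s => isCompact_iUnion fun c => isCompact_iUnion fun _ => (C1 _ _).compact.image (by fun_prop)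
  have Gi : ∀ k, InjOn (fun z => z k) G := by
    intro k z hz w hw g
    obtain ⟨r, s, c, -, z, z1, rfl⟩ := Gm.1 hz
    obtain ⟨r', s', c', -, w, w1, rfl⟩ := Gm.1 hw
    exact key k _ _ _ _ _ _ z w (sm _ _ _) (sm _ _ _) z1 w1 g
  have GV : Valid G := ⟨IsJC.of_image (f := fun z => z true) Gc (by fun_prop) (Gi true) (by have := (t true).jc; rw [← Gj] at this; exact this), Gi⟩
  have ch : ∀ i j, i ≠ 0 → j ≠ 0 → i ≠ j → ∃ l ∈ ZI, (fun k => a k i) + dg l ∈ G ∧ (fun k => b k j + M i j) + dg l ∈ G ∧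
      ∀ k, tr l (E k i j) \ {a k i + l, b k j + M i j + l} ⊆ ins (pj k G) := by
    intro i j hi hj ij
    choose q q' h1 h2 h3 h4 h5 h6 using fun k => (h k).chord n hi hj ij
    have e : ∀ k, q k = q true := fun k => by
      rcases uu2 (show uu (q' k) + uu (q true) = uu (q' true) + uu (q k) by linear_combination h3 true - h3 k) with g | g
      · exact g.2.symm
      · have a1 := h1 k; have a2 := h2 k; have a3 := h1 true; have a4 := h2 true; clear * - g a1 a2 a3 a4 hi hj ij
        generalize q k = x at *; generalize q' k = y at *; generalize q true = z at *; generalize q' true = w at *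
        revert i j x y z w; decide
    have em : ∀ (f : Bool → ℂ), (∀ k, f k + (uu i + uu (q true)) ∈ Th.J (te (E k))) → (∃ i' j' , f ∈ C i' j') → f + dg (uu i + uu (q true)) ∈ G := by
      rintro f hf ⟨i', j', hf'⟩
      have := hf true; rw [← Gj] at this
      obtain ⟨z, hz, g⟩ := this
      obtain ⟨r, s, c, rs, w, hw, rfl⟩ := Gm.1 hz
      rwa [← key true _ _ _ _ _ _ w f (sm _ _ _) (ZI.add_mem (uu_mem _) (uu_mem _)) hw hf' g]
    simp only [e] at h4 h5 h6
    exact ⟨uu i + uu (q true), ZI.add_mem (uu_mem _) (uu_mem _), em _ h4 ⟨i, j, (C1 i j).left⟩, em _ h5 ⟨i, j, (C1 i j).right⟩, fun k => by rw [Gj]; exact h6 k⟩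
  obtain ⟨l, hl, f1, f2, f3⟩ := ch 1 2 (by decide) (by decide) (by decide)
  obtain ⟨l', hl', f1', f2', f3'⟩ := ch 2 1 (by decide) (by decide) (by decide)
  have pt : ∀ k i j l, pj k ((fun z => z + dg l) '' C i j) = tr l (E k i j) := fun k i j l => by
    rw [tr_eq, ← (C2 i j k).1]; simp only [pj, image_image]; rfl
  obtain ⟨R, R1, R2, R3, R4, R5⟩ := sch2 GV f1 f2 f1' f2' ((C1 1 2).image (f := fun z => z + dg l) (by fun_prop) (add_left_injective _).injOn)
    (fun k => by rintro _ ⟨z, hz, rfl⟩ _ ⟨w, hw, rfl⟩ g; rw [(C2 1 2 k).2 hz hw (add_right_cancel g)]) (fun k => by rw [pt]; exact f3 k)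
    ((C1 2 1).image (f := fun z => z + dg l') (by fun_prop) (add_left_injective _).injOn)
    (fun k => by rintro _ ⟨z, hz, rfl⟩ _ ⟨w, hw, rfl⟩ g; rw [(C2 2 1 k).2 hz hw (add_right_cancel g)]) (fun k => by rw [pt]; exact f3' k)
    (fun k x => by
      rw [pt, pt]; intro x1 x2
      rcases (h k).dj' hl hl' x1 x2 with g | g | g <;> exact absurd g.1 (by decide))
  have pc : ∀ k, Continuous (p k) := fun k => (hp k).cov.continuous
  have pl : ∀ k x, ∀ l ∈ ZI, p k (x + l) = p k x := fun k x l hl => ((hp k).ker _ _).2 (by simpa using hl)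
  obtain ⟨H, hH⟩ := homeo_of (K := (fun z k => p k (z k)) '' R) (R1.image (by fun_prop)) (by
      rintro k _ ⟨z, hz, rfl⟩ _ ⟨w, hw, rfl⟩ g
      have g := ((hp k).ker _ _).1 g
      have zc : ∀ z ∈ R, z k ∈ cl (Th.J (te (E k))) := fun z hz => by rw [← Gj, ← (R2 k).2]; exact ⟨z, hz, rfl⟩
      by_cases g0 : z k - w k = 0
      · rw [(R2 k).1 hz hw (sub_eq_zero.1 g0)]
      have inG : ∀ z ∈ R, z k ∉ ins (Th.J (te (E k))) → z ∈ G := fun z hz g => by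
        have := (zc z hz).resolve_right g; rw [← Gj] at this
        obtain ⟨w, hw, g⟩ := this
        rwa [← (R2 k).1 (R3 hw) hz g]
      have z1 := inG z hz fun g' => (t k).disj g g0 g' (by rw [mem_tr, sub_sub_cancel]; exact zc w hw)
      have w1 := inG w hw fun g' => (t k).disj (ZI.neg_mem g) (neg_ne_zero.2 g0) g' (by rw [mem_tr, sub_neg_eq_add, add_sub_cancel]; exact zc z hz)
      obtain ⟨r, s, c, -, z, z2, rfl⟩ := Gm.1 z1
      obtain ⟨r', s', c', -, w, w2, rfl⟩ := Gm.1 w1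
      have := key k _ _ _ _ _ _ z w (sm s r c) (ZI.add_mem (sm s' r' c') g) z2 w2 (by simp only [Pi.add_apply, dg]; ring)
      funext k'
      have := congrFun this k'
      show p k' _ = p k' _
      refine ((hp k').ker _ _).2 ?_
      simp only [Pi.add_apply, dg] at this g ⊢
      convert g using 1; linear_combination this) (fun k x => by
      obtain ⟨y, rfl⟩ := (hp k).surj x
      obtain ⟨m, hm⟩ := (t k).cover y
      rw [mem_tr, ← Gj, ← (R2 k).2] at hm
      obtain ⟨z, hz, g⟩ := hm
      exact ⟨_, ⟨z, hz, rfl⟩, by simp only at g ⊢; rw [g, ← pl k (y - io m) _ (io_mem m), sub_add_cancel]⟩)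
  refine ⟨H, fun i j => ?_⟩
  have ex : ∃ l ∈ ZI, ∀ z ∈ C i j, z + dg l ∈ R := by
    have d : (∃ r c, (Lft.ps r c).1 = i ∧ (Lft.ps r c).2.1 = j) ∨ (i = 1 ∧ j = 2) ∨ (i = 2 ∧ j = 1) := by simp only [Lft.ps]; revert i j; decide
    rcases d with ⟨r, c, rfl, rfl⟩ | ⟨rfl, rfl⟩ | ⟨rfl, rfl⟩
    · obtain ⟨s, rs⟩ := exists_ne r
      exact ⟨_, sm s r c, fun z hz => R3 (Gm.2 ⟨r, s, c, rs.symm, z, hz, rfl⟩)⟩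
    · exact ⟨l, hl, fun z hz => R4 ⟨z, hz, rfl⟩⟩
    · exact ⟨l', hl', fun z hz => R5 ⟨z, hz, rfl⟩⟩
  obtain ⟨l, hl, hR⟩ := ex
  have : ∀ z ∈ C i j, H (p true (z true)) = p false (z false) := fun z hz => by
    have := hH _ ⟨_, hR z hz, rfl⟩; simp only [Pi.add_apply, dg, pl _ _ l hl] at this; exact this
  rw [← (C2 i j true).1, ← (C2 i j false).1]
  ext x; constructor
  · rintro ⟨_, ⟨_, ⟨z, hz, rfl⟩, rfl⟩, rfl⟩; exact ⟨_, ⟨z, hz, rfl⟩, (this z hz).symm⟩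
  · rintro ⟨_, ⟨z, hz, rfl⟩, rfl⟩; exact ⟨_, ⟨_, ⟨z, hz, rfl⟩, rfl⟩, this z hz⟩
end

section
open Set Filter Topology Metric

def dt (x y : ℤ × ℤ) : ℤ := x.1 * y.2 - x.2 * y.1
def nz (S T : Fin 3 → Fin 3) (M : Fin 3 → Fin 3 → ℤ × ℤ) (i j : Fin 3) : ℤ × ℤ := M (S i) (T j) - M (S i) (T 0) - M (S 0) (T j) + M (S 0) (T 0)
def ln2 (M : Fin 3 → Fin 3 → ℤ × ℤ) (i j : Fin 3) : ℤ × ℤ := (dt (M 1 1) (M 2 2) * dt (M i j) (M 2 2), dt (M 1 1) (M 2 2) * dt (M 1 1) (M i j))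

section
variable {X : Type*} [TopologicalSpace X] {F : Fin 3 → Fin 3 → Set X} {M : Fin 3 → Fin 3 → ℤ × ℤ}
def Rp (F : Fin 3 → Fin 3 → Set X) (M : Fin 3 → Fin 3 → ℤ × ℤ) : Prop := ∃ p a b E, Cv ZI p ∧ Lft ZI (fun i j => io (M i j)) a b E ∧ ∀ i j, F i j = p '' E i j

lemma Cv.tr {L} {p : ℂ → X} (hp : Cv L p) {l} (hl : l ∈ L) (S) : p '' tr l S = p '' S := by
  rw [tr_eq, image_image]; exact image_congr fun x _ => (hp.ker _ _).2 (by simpa using hl)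

lemma Rp.rel (h : Rp F M) (S T : Equiv.Perm (Fin 3)) : Rp (fun i j => F (S i) (T j)) (nz S T M) := by
  obtain ⟨p, a, b, E, hp, h, hF⟩ := h
  refine ⟨p, fun i => a (S i) - io (M (S i) (T 0)), fun j => b (T j) + (io (M (S 0) (T j)) - io (M (S 0) (T 0))), fun i j => tr (-io (M (S i) (T 0))) (E (S i) (T j)), hp, ⟨fun i j => io_mem _, fun i j => ?_, ?_⟩, fun i j => by beta_reduce; rw [hF, hp.tr (ZI.neg_mem (io_mem _))]⟩
  · convert (h.arc (S i) (T j)).tr _ using 1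
    all_goals simp only [nz, io_add, io_neg, sub_eq_add_neg]; try ring
  · intro i j i' j' x l hl h1 h2
    rcases h.dj' (ZI.neg_mem (io_mem _)) (ZI.add_mem (ZI.neg_mem (io_mem _)) (ZI.neg_mem hl)) h1 (l' := -io (M (S i') (T 0)) + -l) (by rw [mem_tr] at h2 ⊢; convert h2 using 1; ring) with ⟨g, g', k⟩ | ⟨g, k, k'⟩ | ⟨g, k, k'⟩
    · have := S.injective g; have := T.injective g'; subst i'; subst j'; exact .inl ⟨rfl, rfl, by linear_combination k⟩
    · have := S.injective g; subst i'; exact .inr (.inl ⟨rfl, by linear_combination k, by rw [k']; ring⟩)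
    · have := T.injective g; subst j'; exact .inr (.inr ⟨rfl, by simp only [nz, io_add, io_sub]; linear_combination k, by rw [k']; simp only [nz, io_add, io_sub]; ring⟩)

lemma Rp.sw (h : Rp F M) : Rp (fun i j => F j i) (fun i j => -M j i) := by
  obtain ⟨p, a, b, E, hp, h, hF⟩ := h
  refine ⟨p, b, a, fun j i => tr (-io (M i j)) (E i j), hp, ⟨fun i j => io_mem _, fun j i => ?_, ?_⟩, fun i j => by beta_reduce; rw [hF, hp.tr (ZI.neg_mem (io_mem _))]⟩
  · convert ((h.arc i j).tr (-io (M i j))).symm using 1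
    · ring
    · rw [io_neg]
  · intro j i j' i' x l hl h1 h2
    rcases h.dj' (ZI.neg_mem (io_mem _)) (ZI.add_mem (ZI.neg_mem (io_mem _)) (ZI.neg_mem hl)) h1 (l' := -io (M i' j') + -l) (by rw [mem_tr] at h2 ⊢; convert h2 using 1; ring) with ⟨rfl, rfl, k⟩ | ⟨rfl, k, k'⟩ | ⟨rfl, k, k'⟩
    · exact .inl ⟨rfl, rfl, by linear_combination k⟩
    · exact .inr (.inr ⟨rfl, by simp only [io_neg]; linear_combination k, by rw [k']; simp only [io_neg]⟩)
    · exact .inr (.inl ⟨rfl, by linear_combination k, by rw [k']; ring⟩)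

lemma Rp.lin (h : Rp F M) (h0 : ∀ j, M 0 j = 0) (h1 : ∀ i, M i 0 = 0) (d : dt (M 1 1) (M 2 2) ≠ 0) : (dt (M 1 1) (M 2 2) = 1 ∨ dt (M 1 1) (M 2 2) = -1) ∧ Rp F (ln2 M) := by
  obtain ⟨p, a, b, E, hp, h, hF⟩ := h
  have d' : ((M 1 1).1 * (M 2 2).2 - (M 1 1).2 * (M 2 2).1 : ℝ) ≠ 0 := by exact_mod_cast d
  set D := ((M 1 1).1 * (M 2 2).2 - (M 1 1).2 * (M 2 2).1 : ℝ) with hD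
  let B : ℂ ≃ₜ ℂ :=
    { toFun := fun z => (⟨z.re * (M 1 1).1 + z.im * (M 2 2).1, z.re * (M 1 1).2 + z.im * (M 2 2).2⟩ : ℂ)
      invFun := fun z => (⟨(z.re * (M 2 2).2 - z.im * (M 2 2).1) / D, ((M 1 1).1 * z.im - (M 1 1).2 * z.re) / D⟩ : ℂ)
      left_inv := fun z => by apply Complex.ext <;> simp only <;> field_simp <;> rw [hD] <;> ring
      right_inv := fun z => by apply Complex.ext <;> simp only <;> field_simp <;> rw [hD] <;> ring
      continuous_toFun := by simp only [Complex.mk_eq_add_mul_I]; fun_prop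
      continuous_invFun := by simp only [Complex.mk_eq_add_mul_I]; fun_prop }
  have Bd : ∀ z, B z = ⟨z.re * (M 1 1).1 + z.im * (M 2 2).1, z.re * (M 1 1).2 + z.im * (M 2 2).2⟩ := fun z => rfl
  have Ad : ∀ z, B.symm z = ⟨(z.re * (M 2 2).2 - z.im * (M 2 2).1) / D, ((M 1 1).1 * z.im - (M 1 1).2 * z.re) / D⟩ := fun z => rfl
  have Ba : ∀ x y, B (x + y) = B x + B y := fun x y => by apply Complex.ext <;> simp [Bd] <;> ring
  have Bs : ∀ x y, B (x - y) = B x - B y := fun x y => by apply Complex.ext <;> simp [Bd] <;> ring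
  have Aa : ∀ x y, B.symm (x + y) = B.symm x + B.symm y := fun x y => B.injective (by simp [Ba])
  have B0 : B 0 = 0 := by apply Complex.ext <;> simp [Bd]
  let L : AddSubgroup ℂ := ZI.comap (AddMonoidHom.mk' B Ba)
  have hL : ∀ x, x ∈ L ↔ B x ∈ ZI := fun x => Iff.rfl
  have l : Lft L (fun i j => B.symm (io (M i j))) (fun i => B.symm (a i)) (fun j => B.symm (b j)) (fun i j => B.symm '' E i j) := by
    refine ⟨fun i j => by rw [hL, B.apply_symm_apply]; exact io_mem _, fun i j => ?_, ?_⟩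
    · rw [← Aa]; exact (h.arc i j).image B.symm.continuous.continuousOn B.symm.injective.injOn
    · rintro i j i' j' _ l hl ⟨x, hx, rfl⟩ ⟨y, hy, g⟩
      have g : y = x + B l := by rw [← B.apply_symm_apply y, g, Ba, B.apply_symm_apply]
      rcases h.dj i j i' j' x (B l) hl hx (by rwa [← g]) with ⟨k, k', e⟩ | ⟨k, e, k'⟩ | ⟨k, e, k'⟩
      · exact .inl ⟨k, k', B.injective (by rw [e, B0])⟩
      · exact .inr (.inl ⟨k, B.injective (by rw [e, B0]), by rw [k']⟩)
      · exact .inr (.inr ⟨k, B.injective (by rw [e, Bs]; simp), by rw [k', Aa]⟩)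
  have n : Nrm (fun i j => B.symm (io (M i j))) := by
    refine ⟨fun j => ?_, fun i => ?_, fun k => ?_⟩
    · rw [h0, io_zero]; exact B.injective (by simp [B0])
    · rw [h1, io_zero]; exact B.injective (by simp [B0])
    · refine B.injective ?_
      simp only [B.apply_symm_apply]; fin_cases k
      · simp [h0, uu, B0]
      all_goals apply Complex.ext <;> simp [uu, Bd, io]
  have e := (l.th n).L_eq
  have hs : ∀ m, ∃ m', B.symm (io m) = io m' := fun m => by
    have : B.symm (io m) ∈ L := by rw [hL, B.apply_symm_apply]; exact io_mem m
    rw [e] at this; obtain ⟨m', g⟩ := this; exact ⟨m', g.symm⟩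
  have dd : dt (M 1 1) (M 2 2) = 1 ∨ dt (M 1 1) (M 2 2) = -1 := by
    obtain ⟨x, hx⟩ := hs (1, 0)
    obtain ⟨y, hy⟩ := hs (0, 1)
    have hx := congrArg B hx; have hy := congrArg B hy
    rw [B.apply_symm_apply] at hx hy
    have x1 := congrArg Complex.re hx; have x2 := congrArg Complex.im hx
    have y1 := congrArg Complex.re hy; have y2 := congrArg Complex.im hy
    simp only [Bd, io] at x1 x2 y1 y2; norm_cast at x1 x2 y1 y2
    refine Int.isUnit_iff.1 (IsUnit.of_mul_eq_one (dt x y) ?_)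
    simp only [dt]
    linear_combination -(y.1 * (M 1 1).2 + y.2 * (M 2 2).2) * x1 + (y.1 * (M 1 1).1 + y.2 * (M 2 2).1) * x2 - y2
  have Mi : (fun i j => B.symm (io (M i j))) = fun i j => io (ln2 M i j) := by
    have c : (dt (M 1 1) (M 2 2) : ℝ) = D := by simp [dt, hD]
    have c2 : D * D = 1 := by rw [← c]; rcases dd with g | g <;> simp [g]
    funext i j; rw [Ad]; apply Complex.ext <;> simp only [io, ln2, Int.cast_mul, c] <;> rw [div_eq_iff d'] <;> simp only [dt, Int.cast_sub, Int.cast_mul]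
    · linear_combination -((M i j).1 * (M 2 2).2 - (M i j).2 * (M 2 2).1 : ℝ) * c2
    · linear_combination -((M 1 1).1 * (M i j).2 - (M 1 1).2 * (M i j).1 : ℝ) * c2
  rw [e, Mi] at l
  exact ⟨dd, p ∘ B, _, _, _, ⟨hp.cov.comp_homeomorph B, hp.surj.comp B.surjective, fun x y => by
    rw [Function.comp, Function.comp, hp.ker, ← Bs, ← hL, e]⟩, l, fun i j => by rw [hF, image_image]; simp⟩
end
end

section
open Set Filter Topology Metric

lemma IsArc.eq_of {X : Type*} [TopologicalSpace X] [T2Space X] {A C : Set X} {x y} (h : IsArc A x y) (hC : IsPreconnected C) (s : C ⊆ A) (hx : x ∈ C) (hy : y ∈ C) : C = A := by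
  obtain ⟨f, h1, h2, rfl, rfl, rfl⟩ := h
  refine s.antisymm ?_
  have c := (hC.image _ ((inv_cont isCompact_Icc h1 h2).mono s)).ordConnected.out ⟨_, hx, h2.leftInvOn_invFunOn (by simp)⟩ ⟨_, hy, h2.leftInvOn_invFunOn (by simp)⟩
  rintro _ ⟨t, ht, rfl⟩
  obtain ⟨z, hz, rfl⟩ := c ht
  obtain ⟨u, hu, rfl⟩ := s hz
  rwa [h2.leftInvOn_invFunOn hu]

lemma sub_of {X : Type*} [TopologicalSpace X] [T2Space X] {A B S : Set X} {p q y} (hA : IsArc A p y) (hB : IsArc B y q) (hi : A ∩ B = {y}) (hS : IsPreconnected S) (s : S ⊆ A ∪ B)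
    (hy : y ∉ S) (hp : p ∈ S) : S ⊆ A := by
  refine (isPreconnected_iff_subset_of_disjoint_closed.1 hS _ _ hA.closed hB.closed s ?_).resolve_right fun g => hA.ne (hi.le ⟨hA.left, g hp⟩)
  rw [hi, ← disjoint_iff_inter_eq_empty, disjoint_singleton_right]; exact hy

lemma JS.move {J A B A1 A2 B1 B2 : Set ℂ} {p q y z} (h : JS J p q A B) (a1 : IsArc A1 p y) (a2 : IsArc A2 y q) (aa : A1 ∪ A2 = A) (ai : A1 ∩ A2 = {y})
    (b1 : IsArc B1 p z) (b2 : IsArc B2 z q) (bb : B1 ∪ B2 = B) (bi : B1 ∩ B2 = {z}) : JS J y z (A1 ∪ B1) (A2 ∪ B2) := by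
  obtain ⟨-, -, h3, h4⟩ := h
  have pA : p ∉ A2 := fun g => a1.ne (ai.le ⟨a1.left, g⟩)
  have pB : p ∉ B2 := fun g => b1.ne (bi.le ⟨b1.left, g⟩)
  have qA : q ∉ A1 := fun g => a2.ne (ai.le ⟨g, a2.right⟩).symm
  have qB : q ∉ B1 := fun g => b2.ne (bi.le ⟨g, b2.right⟩).symm
  have m : ∀ x, x ∈ A1 ∪ A2 → x ∈ B1 ∪ B2 → x = p ∨ x = q := fun x g g' => h3.le ⟨aa ▸ g, bb ▸ g'⟩
  have ai' : ∀ x, x ∈ A1 → x ∈ A2 → x = y := fun x g g' => ai.le ⟨g, g'⟩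
  have bi' : ∀ x, x ∈ B1 → x ∈ B2 → x = z := fun x g g' => bi.le ⟨g, g'⟩
  refine ⟨a1.symm.concat b1 fun x g => ?_, a2.concat b2.symm fun x g => ?_, ?_, ?_⟩
  · rcases m x (.inl g.1) (.inl g.2) with rfl | rfl
    exacts [rfl, absurd g.1 qA]
  · rcases m x (.inr g.1) (.inr g.2) with rfl | rfl
    exacts [absurd g.1 pA, rfl]
  · ext x; constructor
    · rintro ⟨g | g, g' | g'⟩
      · exact .inl (ai' _ g g')
      · rcases m x (.inl g) (.inr g') with rfl | rfl
        exacts [absurd g' pB, absurd g qA]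
      · rcases m x (.inr g') (.inl g) with rfl | rfl
        exacts [absurd g' pA, absurd g qB]
      · exact .inr (bi' _ g g')
    · rintro (rfl | rfl)
      exacts [⟨.inl a1.right, .inl a2.left⟩, ⟨.inr b1.right, .inr b2.left⟩]
  · rw [← h4, ← aa, ← bb]; ext x; simp only [mem_union]; tauto

namespace Lft
variable {L : AddSubgroup ℂ} {M : Fin 3 → Fin 3 → ℂ} {a b : Fin 3 → ℂ} {E : Fin 3 → Fin 3 → Set ℂ}

lemma a_mem (h : Lft L M a b E) {i i' j' w} (hw : w ∈ L) (g : a i + w ∈ E i' j') : i = i' ∧ w = 0 := by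
  rcases h.dj i j' i' j' (a i) w hw (h.arc _ _).left g with g | g | g
  exacts [⟨g.1, g.2.2⟩, ⟨g.1, g.2.1⟩, absurd g.2.2 (h.arc _ _).ne]
lemma b_mem (h : Lft L M a b E) {j i' j' w} (hw : w ∈ L) (g : b j + w ∈ E i' j') : j = j' ∧ w = M i' j' := by
  rcases h.dj i' j i' j' (b j + M i' j) (w - M i' j) (L.sub_mem hw (h.mem _ _)) (h.arc _ _).right (by convert g using 1; ring) with g | g | g
  exacts [⟨g.2.1, by rw [← g.2.1]; linear_combination g.2.2⟩, absurd g.2.2.symm (h.arc _ _).ne, ⟨g.1, by linear_combination g.2.1⟩]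

lemma no_vw (h : Lft L M a b E) (n : Nrm M) (h1 : M 1 2 = -uu 1) (h2 : M 2 1 = -uu 2) : False := by
  have t := h.th n
  obtain ⟨q, q', c1, c2, c3, c4, c5, c6⟩ := h.chord n (i := 1) (j := 2) (by decide) (by decide) (by decide)
  obtain ⟨r, r', d1, d2, d3, d4, d5, d6⟩ := h.chord n (i := 2) (j := 1) (by decide) (by decide) (by decide)
  have z1 : q = 0 := by
    have : q' = q := uu_inj (by linear_combination h1 - c3)
    subst this; clear * - c1 c2; revert q'; decide
  have z2 : r = 0 := by
    have : r' = r := uu_inj (by linear_combination h2 - d3)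
    subst this; clear * - d1 d2; revert r'; decide
  subst z1 z2
  rw [uu_zero, add_zero] at c4 c5 c6 d4 d5 d6
  rw [h1, neg_add_cancel_right] at c5 c6
  rw [h2, neg_add_cancel_right] at d5 d6
  have u := h.uu_L n
  have js := t.js (k := 1) (l := 0) (m := 2) (by decide) (by decide) (by decide)
  simp only [uu_zero, add_zero] at js
  have y0 : a 1 + uu 1 ≠ a 0 := fun g => absurd (h.aa (u 1) L.zero_mem (by simpa using g)).1 (by decide)
  have z0 : b 2 ≠ a 0 := fun g => h.ab (i := 0) (j := 2) L.zero_mem L.zero_mem (by simpa using g.symm)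
  have y1 : a 1 + uu 1 ≠ b 0 + uu 1 := h.ab (u 1) (u 1)
  have z1 : b 2 ≠ b 0 + uu 1 := fun g => absurd (h.bb L.zero_mem (u 1) (by simpa using g)).1 (by decide)
  have r0 : ∀ k, b k ∈ E 0 k := fun k => by simpa [n.row] using (h.arc 0 k).right
  have y2 : a 1 + uu 1 ∈ Th.T (te E) 1 0 := by
    simp only [Th.T, uu_zero, tr_zero, te]; exact .inr (.inl (by simpa [mem_tr] using (h.arc 1 1).left))
  have s2 : E 0 2 ⊆ Th.Rs (te E) 1 0 2 := fun x hx => .inl (by simp only [Th.T, uu_zero, tr_zero, te]; exact .inl hx)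
  have s1 : E 0 1 ⊆ Th.T (te E) 1 0 := fun x hx => by simp only [Th.T, uu_zero, tr_zero, te]; exact .inl hx
  obtain ⟨A1, A2, a1, a2, aa, ai⟩ := js.1.split y2 y0 y1
  obtain ⟨B1, B2, b1, b2, bb, bi⟩ := js.2.1.split (s2 (r0 2)) z0 z1
  have m := js.move a1 a2 aa ai b1 b2 bb bi
  have e1 : E 0 1 ⊆ A1 := sub_of a1 a2 ai (h.arc 0 1).conn (by rw [aa]; exact s1) (fun g => absurd (h.a_mem (u 1) g).1 (by decide)) (h.arc 0 1).left
  have e2 : E 0 2 = B1 := by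
    have ar := h.arc 0 2; rw [n.row, add_zero] at ar
    refine b1.eq_of ar.conn ?_ ar.left ar.right
    have := sub_of b1 b2 bi ar.diff_right (by rw [bb]; exact sdiff_subset.trans s2) (by simp) ⟨ar.left, ar.ne⟩
    intro x hx
    by_cases g : x = b 2
    · rw [g]; exact b1.right
    · exact this ⟨hx, g⟩
  have f1 : a 2 + uu 2 ∈ A2 ∪ B2 := by
    rcases m.2.2.2.ge d4 with (g | g) | g
    · have g := aa.le (.inl g); simp only [Th.T, uu_zero, tr_zero] at g
      exact absurd (h.a_te n (by decide) (u 2) g).1 (by decide)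
    · rw [← e2] at g; exact absurd (h.a_mem (u 2) g).1 (by decide)
    · exact g
  have u1 : ∀ i j, a i + uu i ≠ b j := fun i j g => h.ab (i := i) (j := j) (u i) L.zero_mem (by simpa using g)
  obtain ⟨p, hp⟩ := t.jc.ins_nonempty
  have I : ins (Th.J (te E)) ⊆ connectedComponentIn (Th.J (te E))ᶜ p := t.jc.ins_conn.subset_connectedComponentIn hp fun x g => g.1
  have C := (h.arc 1 2).tr (uu 1); rw [h1, neg_add_cancel_right] at C
  have D := (h.arc 2 1).tr (uu 2); rw [h2, neg_add_cancel_right] at D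
  obtain ⟨x, x1, x2⟩ := cross m C D.symm (a := b 1) (b := a 2 + uu 2) (.inl (e1 (r0 1))) (by
      rintro (g | g)
      · exact u1 _ _ g.symm
      · exact absurd (h.bb (j := 1) (j' := 2) L.zero_mem L.zero_mem (by rw [mem_singleton_iff.1 g])).1 (by decide)) f1 (by
      rintro (g | g)
      · exact absurd (h.aa (u 2) (u 1) g).1 (by decide)
      · exact u1 _ _ g) (c6.trans I) (by rw [pair_comm]; exact d6.trans I)
  rcases h.dj' (u 1) (u 2) x1 x2 with g | g | g <;> exact absurd g.1 (by decide)

lemma rank (h : Lft ZI M a b E) {c : ℂ} (hc : c ≠ 0) (cm : c ∈ ZI) (hM : ∀ i j, ∃ k : ℤ, M i j = k * c) : False := by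
  set e : ℂ → ℂ := fun z => Complex.exp (2 * Real.pi * Complex.I * (z / c)) with he
  have hk : ∀ x y, e x = e y → ∃ k : ℤ, x = y + k * c := fun x y g => by
    obtain ⟨k, g⟩ := Complex.exp_eq_exp_iff_exists_int.1 g
    refine ⟨k, ?_⟩
    have : x / c = y / c + k := mul_left_cancel₀ Complex.two_pi_I_ne_zero (by linear_combination g)
    field_simp at this; linear_combination this
  have hk' : ∀ x (k : ℤ), e (x + k * c) = e x := fun x k => by
    refine Complex.exp_eq_exp_iff_exists_int.2 ⟨k, ?_⟩; field_simp
  have km : ∀ k : ℤ, (k : ℂ) * c ∈ ZI := fun k => by rw [← zsmul_eq_mul]; exact ZI.zsmul_mem cm k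
  have ce : Continuous e := by fun_prop
  have eb : ∀ i j, e (b j + M i j) = e (b j) := fun i j => by obtain ⟨k, g⟩ := hM i j; rw [g, hk']
  refine PK.false (a := fun i => e (a i)) (b := fun j => e (b j)) (e := fun i j => e '' E i j) ⟨fun i j => ?_, ?_, fun i i' g => ?_, fun j j' g => ?_, fun i j g => ?_⟩
  · rw [← eb i j]; refine (h.arc i j).image ce.continuousOn fun x hx y hy g => ?_
    obtain ⟨k, g⟩ := hk _ _ g
    rcases h.dj i j i j y _ (km k) hy (by rwa [← g]) with q | q | q
    · rw [g, q.2.2, add_zero]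
    · rw [g, q.2.1, add_zero]
    · rw [g, q.2.1, sub_self, add_zero]
  · rintro i j i' j' ne _ ⟨x, hx, rfl⟩ ⟨y, hy, g⟩
    obtain ⟨k, g⟩ := hk _ _ g
    rcases h.dj i j i' j' x _ (km k) hx (by rwa [← g]) with q | q | q
    · exact absurd (Prod.ext q.1 q.2.1) ne
    · exact .inl ⟨q.1, by rw [q.2.2]⟩
    · exact .inr ⟨q.1, by rw [q.2.2, eb]⟩
  · obtain ⟨k, g⟩ := hk _ _ g; exact (h.aa ZI.zero_mem (km k) (by rwa [add_zero])).1
  · obtain ⟨k, g⟩ := hk _ _ g; exact (h.bb ZI.zero_mem (km k) (by rwa [add_zero])).1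
  · obtain ⟨k, g⟩ := hk _ _ g; exact h.ab ZI.zero_mem (km k) (by rwa [add_zero])
end Lft
end

section
open Set Filter Topology Metric

def mkm (p q : ℤ × ℤ) : Fin 3 → Fin 3 → ℤ × ℤ := ![![0, 0, 0], ![0, (1, 0), p], ![0, q, (0, 1)]]
def ok4 (p : ℤ × ℤ) : Bool := p == (0, 0) || p == (1, 0) || p == (0, 1) || p == (1, 1)
def okc (p q : ℤ × ℤ) : Bool := ok4 p && ok4 q && !(p == (1, 0) && q == (0, 1))
def cc : Fin 5 → (ℤ × ℤ) × Fin 3 × Fin 3 := ![((1, 1), 0, 0), ((0, 0), 0, 0), ((0, 0), 0, 1), ((0, 0), 1, 2), ((0, 0), 1, 1)]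
def pm : Fin 6 → Equiv.Perm (Fin 3) := ![1, Equiv.swap 0 1, Equiv.swap 0 2, Equiv.swap 1 2, Equiv.swap 0 1 * Equiv.swap 1 2, Equiv.swap 1 2 * Equiv.swap 0 1]
def mv (s : Bool) (S T : Fin 3 → Fin 3) (M : Fin 3 → Fin 3 → ℤ × ℤ) : Fin 3 → Fin 3 → ℤ × ℤ := nz S T (if s then fun i j => -M j i else M)

def chk (p q : ℤ × ℤ) (i j : Fin 3) (s : Bool) (S T : Fin 6) : Bool :=
  let N := mv s (pm S) (pm T) (mkm p q)
  let d := dt (N 1 1) (N 2 2)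
  let p' := ln2 N 1 2
  let q' := ln2 N 2 1
  d != 0 && (!(d == 1 || d == -1) || !okc p' q' || decide (∃ k, (cc k).1 = p' ∧ (cc k).1 = q' ∧ if s then pm S (cc k).2.1 = j ∧ pm T (cc k).2.2 = i else pm S (cc k).2.1 = i ∧ pm T (cc k).2.2 = j))

lemma chk_all : ∀ p ∈ [((0, 0) : ℤ × ℤ), (1, 0), (0, 1), (1, 1)], ∀ q ∈ [((0, 0) : ℤ × ℤ), (1, 0), (0, 1), (1, 1)], ∀ i j, ∃ s S T, chk p q i j s S T = true := by
  decide +kernel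
end

section
open Set Filter Topology Metric

section
variable {X : Type*} [TopologicalSpace X] {F : Fin 3 → Fin 3 → Set X} {M : Fin 3 → Fin 3 → ℤ × ℤ}

lemma mkm_nrm (p q) : Nrm (fun i j => io (mkm p q i j)) := by
  refine ⟨fun j => ?_, fun i => ?_, fun k => ?_⟩
  · fin_cases j <;> simp [mkm]
  · fin_cases i <;> simp [mkm]
  · fin_cases k <;> apply Complex.ext <;> simp [mkm, io, uu]

lemma Rp.con {p q} (h : Rp F (mkm p q)) : okc p q = true := by
  obtain ⟨P, a, b, E, hp, h, hF⟩ := h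
  have n := mkm_nrm p q
  have e1 : io p = io (mkm p q 1 2) := by simp [mkm]
  have e2 : io q = io (mkm p q 2 1) := by simp [mkm]
  obtain ⟨r, r', c1, c2, c3, -⟩ := h.chord n (i := 1) (j := 2) (by decide) (by decide) (by decide)
  obtain ⟨t, t', d1, d2, d3, -⟩ := h.chord n (i := 2) (j := 1) (by decide) (by decide) (by decide)
  have nv := h.no_vw n
  simp only [← e1, ← e2] at c3 d3 nv
  have k1 : ok4 p = true := by
    have : ∀ x : ℤ × ℤ, io p = io x → ok4 x = true → ok4 p = true := fun x hx hy => io_inj hx ▸ hy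
    fin_cases r <;> fin_cases r' <;> first | exact absurd rfl c1 | exact absurd rfl c2 | skip
    · exact this (1, 0) (c3.trans (by apply Complex.ext <;> simp [io, uu])) (by decide)
    · exact this (0, 0) (c3.trans (by apply Complex.ext <;> simp [io, uu])) (by decide)
    · exact this (1, 1) (c3.trans (by apply Complex.ext <;> simp [io, uu])) (by decide)
    · exact this (0, 1) (c3.trans (by apply Complex.ext <;> simp [io, uu])) (by decide)
  have k2 : ok4 q = true := by
    have : ∀ x : ℤ × ℤ, io q = io x → ok4 x = true → ok4 q = true := fun x hx hy => io_inj hx ▸ hy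
    fin_cases t <;> fin_cases t' <;> first | exact absurd rfl d1 | exact absurd rfl d2 | skip
    · exact this (0, 1) (d3.trans (by apply Complex.ext <;> simp [io, uu])) (by decide)
    · exact this (0, 0) (d3.trans (by apply Complex.ext <;> simp [io, uu])) (by decide)
    · exact this (1, 1) (d3.trans (by apply Complex.ext <;> simp [io, uu])) (by decide)
    · exact this (1, 0) (d3.trans (by apply Complex.ext <;> simp [io, uu])) (by decide)
  have k3 : ¬ (p = (1, 0) ∧ q = (0, 1)) := by
    rintro ⟨rfl, rfl⟩
    exact nv (by apply Complex.ext <;> simp [io, uu]) (by apply Complex.ext <;> simp [io, uu])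
  simpa [okc, k1, k2, ← not_and_or] using k3

lemma par {v : ℤ × ℤ} (hv : v ≠ 0) : ∃ c : ℤ × ℤ, c ≠ 0 ∧ ∀ w, dt v w = 0 → ∃ k : ℤ, w = k • c := by
  obtain ⟨x, y⟩ := v
  have g0 : (Int.gcd x y) ≠ 0 := by
    intro h; rw [Int.gcd_eq_zero_iff] at h; exact hv (Prod.ext h.1 h.2)
  obtain ⟨x', y', hc, hx, hy⟩ := Int.exists_gcd_one (Nat.pos_of_ne_zero g0)
  have g1 : (Int.gcd x y : ℤ) ≠ 0 := by exact_mod_cast g0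
  obtain ⟨s, t, hst⟩ := Int.isCoprime_iff_gcd_eq_one.2 hc
  refine ⟨(x', y'), fun e => ?_, fun w hw => ⟨s * w.1 + t * w.2, ?_⟩⟩
  · simp only [Prod.mk_eq_zero] at e; rw [e.1, e.2] at hst; simp at hst
  have : x' * w.2 = y' * w.1 := by
    simp only [dt] at hw
    apply mul_left_cancel₀ g1; linear_combination hw - w.2 * hx + w.1 * hy
  ext
  · simp; linear_combination -w.1 * hst - t * this
  · simp; linear_combination -w.2 * hst + s * this

lemma Rp.start (h : Rp F M) : ∃ S T : Equiv.Perm (Fin 3), dt (nz S T M 1 1) (nz S T M 2 2) ≠ 0 := by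
  by_contra! hn
  have q1 := hn 1 1
  have q2 := hn 1 (Equiv.swap 1 2)
  have q3 := hn 1 (Equiv.swap 0 1)
  have q4 := hn 1 (Equiv.swap 0 2)
  have q5 := hn (Equiv.swap 0 1) 1
  have q6 := hn (Equiv.swap 0 2) 1
  have e1 : (Equiv.swap 1 2 : Equiv.Perm (Fin 3)) 0 = 0 := by decide
  have e2 : (Equiv.swap 0 1 : Equiv.Perm (Fin 3)) 2 = 2 := by decide
  have e3 : (Equiv.swap 0 2 : Equiv.Perm (Fin 3)) 1 = 1 := by decide
  simp only [nz, Equiv.Perm.coe_one, id, Equiv.swap_apply_left, Equiv.swap_apply_right, e1, e2, e3, dt, Prod.fst_add, Prod.fst_sub, Prod.snd_add, Prod.snd_sub] at q1 q2 q3 q4 q5 q6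
  obtain ⟨p, a, b, E, hp, h, -⟩ := h.rel 1 1
  set V := nz (1 : Equiv.Perm (Fin 3)) (1 : Equiv.Perm (Fin 3)) M with hV
  have r0 : ∀ j, V 0 j = 0 := fun j => by simp [hV, nz]
  have c0 : ∀ i, V i 0 = 0 := fun j => by simp [hV, nz]
  have e : ∀ i j, V i j = M i j - M i 0 - M 0 j + M 0 0 := fun i j => rfl
  have D : ∀ i j i' j', dt (V i j) (V i' j') = 0 := by
    have z0 : ∀ w, dt 0 w = 0 := fun w => by simp [dt]
    have z1 : ∀ w, dt w 0 = 0 := fun w => by simp [dt]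
    have sy : ∀ v w, dt v w = 0 → dt w v = 0 := fun v w h => by simp only [dt] at h ⊢; linarith
    have k1 : dt (V 1 1) (V 2 2) = 0 := by simp only [e, dt, Prod.fst_add, Prod.fst_sub, Prod.snd_add, Prod.snd_sub]; linarith
    have k2 : dt (V 1 2) (V 2 1) = 0 := by simp only [e, dt, Prod.fst_add, Prod.fst_sub, Prod.snd_add, Prod.snd_sub]; linarith
    have k3 : dt (V 1 1) (V 2 1) = 0 := by simp only [e, dt, Prod.fst_add, Prod.fst_sub, Prod.snd_add, Prod.snd_sub]; linarith
    have k4 : dt (V 1 2) (V 2 2) = 0 := by simp only [e, dt, Prod.fst_add, Prod.fst_sub, Prod.snd_add, Prod.snd_sub]; linarith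
    have k5 : dt (V 1 1) (V 1 2) = 0 := by simp only [e, dt, Prod.fst_add, Prod.fst_sub, Prod.snd_add, Prod.snd_sub]; linarith
    have k6 : dt (V 2 1) (V 2 2) = 0 := by simp only [e, dt, Prod.fst_add, Prod.fst_sub, Prod.snd_add, Prod.snd_sub]; linarith
    have ss : ∀ v, dt v v = 0 := fun v => by simp only [dt]; ring
    intro i j i' j'
    have tri : ∀ i : Fin 3, i = 0 ∨ i = 1 ∨ i = 2 := by decide
    rcases tri i with rfl | rfl | rfl <;> rcases tri j with rfl | rfl | rfl <;> rcases tri i' with rfl | rfl | rfl <;> rcases tri j' with rfl | rfl | rfl <;>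
      first | (rw [r0]; exact z0 _) | (rw [c0]; exact z0 _) | (rw [r0 1]; exact z1 _) | (rw [r0 2]; exact z1 _) | (rw [c0 0]; exact z1 _) | (rw [c0 1]; exact z1 _) | (rw [c0 2]; exact z1 _) | assumption | (apply sy; assumption) | exact ss _
  by_cases hz : ∀ i j, V i j = 0
  · exact h.rank one_ne_zero (c := 1) (by convert io_mem (1, 0); simp [io, Complex.ext_iff]) fun i j => ⟨0, by simp [hz]⟩
  push Not at hz
  obtain ⟨i, j, hij⟩ := hz
  obtain ⟨c, hc, hk⟩ := par hij
  refine h.rank (c := io c) (fun e => hc (io_inj (by rw [e, io_zero]))) (io_mem _) fun i' j' => ?_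
  obtain ⟨k, hk⟩ := hk _ (D i j i' j')
  exact ⟨k, by rw [hk]; apply Complex.ext <;> simp [io]⟩

lemma Rp.nrm (h : Rp F M) (S T : Equiv.Perm (Fin 3)) (d : dt (nz S T M 1 1) (nz S T M 2 2) ≠ 0) :
    (dt (nz S T M 1 1) (nz S T M 2 2) = 1 ∨ dt (nz S T M 1 1) (nz S T M 2 2) = -1) ∧ Rp (fun i j => F (S i) (T j)) (mkm (ln2 (nz S T M) 1 2) (ln2 (nz S T M) 2 1)) := by
  obtain ⟨u, v⟩ := (h.rel S T).lin (fun j => by simp [nz]) (fun i => by simp [nz]) d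
  refine ⟨u, ?_⟩
  convert v using 1
  have r0 : ∀ j, nz S T M 0 j = 0 := fun j => by simp [nz]
  have c0 : ∀ i, nz S T M i 0 = 0 := fun i => by simp [nz]
  generalize nz S T M = N at *
  have s : dt (N 1 1) (N 2 2) * dt (N 1 1) (N 2 2) = 1 := by rcases u with u | u <;> rw [u] <;> rfl
  have ss : ∀ v, dt v v = 0 := fun v => by simp only [dt]; ring
  have z0 : ∀ w, dt 0 w = 0 := fun w => by simp [dt]
  have z1 : ∀ w, dt w 0 = 0 := fun w => by simp [dt]
  funext i j
  fin_cases i <;> fin_cases j <;> simp [mkm, ln2, r0, c0, z0, z1, s, ss] <;> rfl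

lemma upper {Q : (Fin 3 → Fin 3 → Set X) → Fin 3 → Fin 3 → Prop} (hrel : ∀ F (S T : Equiv.Perm (Fin 3)) i j, Q (fun i j => F (S i) (T j)) i j → Q F (S i) (T j))
    (hsw : ∀ F i j, Q (fun i j => F j i) j i → Q F i j) (hcan : ∀ F k, Rp F (mkm (cc k).1 (cc k).1) → Q F (cc k).2.1 (cc k).2.2) (h : Rp F M) (i j) : Q F i j := by
  have key : ∀ F p q i j, Rp F (mkm p q) → Q F i j := by
    intro F p q i j h
    have hc := h.con
    have mem : ∀ p, ok4 p = true → p ∈ [((0, 0) : ℤ × ℤ), (1, 0), (0, 1), (1, 1)] := fun p hp => by simpa [ok4, or_assoc] using hp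
    have hc' := hc
    simp only [okc, Bool.and_eq_true] at hc'
    obtain ⟨s, S, T, hs⟩ := chk_all p (mem _ hc'.1.1) q (mem _ hc'.1.2) i j
    have fin : ∀ F M, Rp F M → ∀ i j, (let N := nz (pm S) (pm T) M; dt (N 1 1) (N 2 2) ≠ 0 ∧ (((dt (N 1 1) (N 2 2) ≠ 1 ∧ dt (N 1 1) (N 2 2) ≠ -1) ∨ okc (ln2 N 1 2) (ln2 N 2 1) = false) ∨ ∃ k, (cc k).1 = ln2 N 1 2 ∧ (cc k).1 = ln2 N 2 1 ∧ pm S (cc k).2.1 = i ∧ pm T (cc k).2.2 = j)) → Q F i j := by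
      rintro F M h i j ⟨d, H⟩
      obtain ⟨u, v⟩ := h.nrm _ _ d
      rcases H with (⟨x, y⟩ | y) | ⟨k, k1, k2, k3, k4⟩
      · exact absurd u (by tauto)
      · rw [v.con] at y; cases y
      · rw [← k1, ← k2] at v
        have := hrel _ _ _ _ _ (hcan _ _ v)
        rwa [k3, k4] at this
    cases s
    · refine fin F _ h i j ?_
      simpa [chk, mv] using hs
    · refine hsw _ _ _ (fin _ _ h.sw j i ?_)
      simpa [chk, mv] using hs
  obtain ⟨S, T, d⟩ := h.start
  obtain ⟨-, v⟩ := h.nrm S T d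
  have := hrel F S T (S.symm i) (T.symm j) (key _ _ _ _ _ v)
  simpa using this
end
end

section
open Set Filter Topology Metric

structure Gr {X : Type*} [TopologicalSpace X] (F : Fin 3 → Fin 3 → Set X) (α β : Fin 3 → X) : Prop where
  arc : ∀ i j, IsArc (F i j) (α i) (β j)
  dj : ∀ i j i' j' x, x ∈ F i j → x ∈ F i' j' → (i = i' ∧ j = j') ∨ (i = i' ∧ x = α i) ∨ (j = j' ∧ x = β j)

set_option linter.unusedSectionVars false
section
variable {X : Type*} [TopologicalSpace X] [T2Space X] {F : Fin 3 → Fin 3 → Set X} {M : Fin 3 → Fin 3 → ℤ × ℤ} {α β : Fin 3 → X}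

lemma Cv.inj {p : ℂ → X} (hp : Cv ZI p) {M a b E} (h : Lft ZI M a b E) (i j) : InjOn p (E i j) := fun x hx y hy g => by
  have := (hp.ker _ _).1 g.symm
  rcases h.dj i j i j x _ this hx (by simpa using hy) with k | k | k
  · exact (sub_eq_zero.1 k.2.2).symm
  · exact (sub_eq_zero.1 k.2.1).symm
  · have := k.2.1; rw [sub_self] at this; exact (sub_eq_zero.1 this).symm

lemma gr_of {p : ℂ → X} (hp : Cv ZI p) {M a b E} (h : Lft ZI M a b E) : Gr (fun i j => p '' E i j) (fun i => p (a i)) (fun j => p (b j)) := by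
  have e : ∀ i j, p (b j + M i j) = p (b j) := fun i j => (hp.ker _ _).2 (by simpa using h.mem i j)
  refine ⟨fun i j => ?_, ?_⟩
  · rw [← e i]; exact (h.arc i j).image hp.cov.continuous.continuousOn (hp.inj h i j)
  · rintro i j i' j' _ ⟨x, hx, rfl⟩ ⟨y, hy, g⟩
    rcases h.dj i j i' j' x _ ((hp.ker _ _).1 g) hx (by simpa using hy) with k | k | k
    · exact .inl ⟨k.1, k.2.1⟩
    · exact .inr (.inl ⟨k.1, by rw [k.2.2]⟩)
    · exact .inr (.inr ⟨k.1, by rw [k.2.2, e]⟩)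

lemma Gr.ends {α' β'} (g : Gr F α β) (g' : Gr F α' β') : α = α' ∧ β = β' := by
  constructor <;> funext i
  · rcases g'.dj i 0 i 1 _ (g.arc i 0).left (g.arc i 1).left with k | k | k
    · exact absurd k.2 (by decide)
    · exact k.2
    · exact absurd k.1 (by decide)
  · rcases g'.dj 0 i 1 i _ (g.arc 0 i).right (g.arc 1 i).right with k | k | k
    · exact absurd k.1 (by decide)
    · exact absurd k.1 (by decide)
    · exact k.2

lemma cmp_aux {p p' : ℂ → X} (hp : Cv ZI p) (hp' : Cv ZI p') {M a b E M' a' b' E'} (h : Lft ZI M a b E) (h' : Lft ZI M' a' b' E') (he : ∀ i j, p '' E i j = p' '' E' i j)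
    {φ : ℂ → ℂ} (hc : Continuous φ) (hφ : ∀ x, p' (φ x) = p x) (i j) : φ (a i) - a' i = φ (b j + M i j) - (b' j + M' i j) := by
  obtain ⟨e1, e2⟩ := (gr_of hp h).ends (by simp only [he]; exact gr_of hp' h')
  replace e1 := congrFun e1 i; replace e2 := congrFun e2 j
  beta_reduce at e1 e2
  have e3 : p (b j + M i j) = p' (b' j + M' i j) := by
    rw [(hp.ker _ (b j)).2 (by simpa using h.mem i j), e2]
    exact ((hp'.ker _ _).2 (by simpa using h'.mem i j)).symm
  have inj := hp'.inj h' i j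
  have hcm : φ (a i) - a' i ∈ ZI := (hp'.ker _ _).1 (by rw [hφ, e1])
  have gc := inv_cont (h'.arc i j).compact hp'.cov.continuous.continuousOn inj
  rw [← he] at gc
  have gp : ∀ x ∈ E i j, p' (Function.invFunOn p' (E' i j) (p x)) = p x := fun x hx =>
    Function.invFunOn_eq (by have := mem_image_of_mem p hx; rw [he] at this; exact this)
  have ga : Function.invFunOn p' (E' i j) (p (a i)) = a' i := by rw [e1]; exact inj.leftInvOn_invFunOn (h'.arc i j).left
  have gb : Function.invFunOn p' (E' i j) (p (b j + M i j)) = b' j + M' i j := by rw [e3]; exact inj.leftInvOn_invFunOn (h'.arc i j).right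
  have := hp'.cov.eqOn_of_comp_eqOn (h.arc i j).conn hc.continuousOn (g₂ := fun x => Function.invFunOn p' (E' i j) (p x) + (φ (a i) - a' i))
    ((gc.comp hp.cov.continuous.continuousOn (mapsTo_image _ _)).add continuousOn_const)
    (fun x hx => by simp only [Function.comp]; rw [hφ, (hp'.ker _ (Function.invFunOn p' (E' i j) (p x))).2 (by simpa using hcm), gp x hx]) (h.arc i j).left (by simp only [ga]; ring)
  have := this (h.arc i j).right
  simp only [gb] at this
  rw [this]; ring

def sg (M : Fin 3 → Fin 3 → ℤ × ℤ) (i i' j j' : Fin 3) : ℤ × ℤ := M i j - M i' j + M i' j' - M i j'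

lemma Rp.cmp {M'} (h : Rp F M) (h' : Rp F M') {i i' j j'} (s : sg M i i' j j' = 0) : sg M' i i' j j' = 0 := by
  obtain ⟨p, a, b, E, hp, h, hF⟩ := h
  obtain ⟨p', a', b', E', hp', h', hF'⟩ := h'
  obtain ⟨e, he⟩ := hp'.surj (p 0)
  obtain ⟨φ, ⟨-, hφ⟩, -⟩ := hp'.cov.existsUnique_continuousMap_lifts ⟨p, hp.cov.continuous⟩ 0 e he
  have key : ∀ l ∈ ZI, ∀ i j, φ (a i + l) - a' i = φ (b j + io (M i j) + l) - (b' j + io (M' i j)) := fun l hl i j =>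
    cmp_aux hp hp' h h' (fun i j => by rw [← hF, hF']) (φ := fun x => φ (x + l)) (by fun_prop) (fun x => by
      have := congrFun hφ (x + l); simp only [Function.comp, ContinuousMap.coe_mk] at this; rw [this]; exact (hp.ker _ _).2 (by simpa using hl)) i j
  have hl : io (M i j) - io (M i' j) ∈ ZI := ZI.sub_mem (io_mem _) (io_mem _)
  have k1 := key 0 ZI.zero_mem i j
  have k2 := key _ hl i' j
  have k3 := key _ hl i' j'
  have k4 := key 0 ZI.zero_mem i j'
  apply io_inj
  replace s := congrArg io s
  simp only [sg, io_sub, io_add, io_zero, add_zero] at s k1 k2 k3 k4 ⊢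
  rw [show b j + io (M i' j) + (io (M i j) - io (M i' j)) = b j + io (M i j) by ring] at k2
  rw [show b j' + io (M i' j') + (io (M i j) - io (M i' j)) = b j' + io (M i j') by linear_combination s] at k3
  linear_combination k1 - k2 + k3 - k4
end
end

section
open Set Filter Topology Metric
set_option linter.unusedSectionVars false

section
variable {X : Type*} [TopologicalSpace X] [T2Space X] {F G : Fin 3 → Fin 3 → Set X} {α β α' β' : Fin 3 → X}

lemma IsArc.germ {A U : Set X} {x y} (h : IsArc A x y) (hU : IsOpen U) (hx : x ∈ U) : ∃ C ⊆ A ∩ U, IsPreconnected C ∧ x ∈ C ∧ ∃ z ∈ C, z ≠ x := by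
  obtain ⟨f, h1, h2, rfl, rfl, rfl⟩ := h
  have := h1 0 (by simp) (hU.mem_nhds hx)
  rw [mem_map, mem_nhdsWithin_iff] at this
  obtain ⟨ε, e0, he⟩ := this
  have sub : Icc 0 (min 1 (ε / 2)) ⊆ Icc (0 : ℝ) 1 := Icc_subset_Icc_right (min_le_left _ _)
  have m0 : 0 < min 1 (ε / 2) := by positivity
  refine ⟨f '' Icc 0 (min 1 (ε / 2)), ?_, isPreconnected_Icc.image _ (h1.mono sub), ⟨0, by simp [m0.le], rfl⟩, f (min 1 (ε / 2)), ⟨_, by simp [m0.le], rfl⟩, fun e => ?_⟩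
  · rintro _ ⟨t, ht, rfl⟩
    refine ⟨⟨t, sub ht, rfl⟩, he ⟨?_, sub ht⟩⟩
    rw [Metric.mem_ball, Real.dist_eq, sub_zero, abs_of_nonneg ht.1]; linarith [ht.2.trans (min_le_right _ _)]
  · exact m0.ne' (h2 (sub (by simp [m0.le])) (by simp) e)

lemma no_triod {A : Set X} {x y z} (h : IsArc A x y) {C : Fin 3 → Set X} (hC : ∀ i, C i ⊆ A) (hc : ∀ i, IsPreconnected (C i)) (hz : ∀ i, z ∈ C i)
    (hn : ∀ i, ∃ w ∈ C i, w ≠ z) (hi : ∀ i j, i ≠ j → C i ∩ C j ⊆ {z}) : False := by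
  obtain ⟨f, h1, h2, rfl, rfl, rfl⟩ := h
  set ψ := Function.invFunOn f (Icc 0 1)
  have ψc : ContinuousOn ψ (f '' Icc 0 1) := inv_cont isCompact_Icc h1 h2
  have ψi : InjOn ψ (f '' Icc 0 1) := by
    rintro _ ⟨s, hs, rfl⟩ _ ⟨t, ht, rfl⟩ e
    have := h2.leftInvOn_invFunOn hs; have := h2.leftInvOn_invFunOn ht; simp_all [ψ]
  choose w hw hne using hn
  have oc : ∀ i, OrdConnected (ψ '' C i) := fun i => ((hc i).image _ (ψc.mono (hC i))).ordConnected
  have ne : ∀ i, ψ (w i) ≠ ψ z := fun i e => hne i (ψi (hC i (hw i)) (hC i (hz i)) e)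
  have key : ∀ i j m, i ≠ j → m ∈ ψ '' C i → m ∈ ψ '' C j → m = ψ z := by
    rintro i j _ ij ⟨u, hu, rfl⟩ ⟨v, hv, e⟩
    have := ψi (hC j hv) (hC i hu) e; subst this
    rw [hi i j ij ⟨hu, hv⟩]
  have wi : ∀ i, ψ (w i) ∈ ψ '' C i := fun i => ⟨_, hw i, rfl⟩
  have zi : ∀ i, ψ z ∈ ψ '' C i := fun i => ⟨_, hz i, rfl⟩
  obtain ⟨i, j, ij, e⟩ := Fintype.exists_ne_map_eq_of_card_lt (fun i => decide (ψ (w i) < ψ z)) (by simp)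
  simp only [decide_eq_decide] at e
  rcases lt_or_gt_of_ne (ne i) with g | g
  · have g' := e.1 g
    have := key i j (max (ψ (w i)) (ψ (w j))) ij ((oc i).out (wi i) (zi i) ⟨le_max_left _ _, max_le g.le g'.le⟩) ((oc j).out (wi j) (zi j) ⟨le_max_right _ _, max_le g.le g'.le⟩)
    exact absurd this (max_lt g g').ne
  · have g' : ψ z < ψ (w j) := lt_of_le_of_ne (not_lt.1 fun k => absurd (e.2 k) (not_lt.2 g.le)) (ne j).symm
    have := key i j (min (ψ (w i)) (ψ (w j))) ij ((oc i).out (zi i) (wi i) ⟨le_min g.le g'.le, min_le_left _ _⟩) ((oc j).out (zi j) (wi j) ⟨le_min g.le g'.le, min_le_right _ _⟩)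
    exact absurd this (lt_min g g').ne'

namespace Gr
lemma sw (g : Gr F α β) : Gr (fun i j => F j i) β α :=
  ⟨fun i j => (g.arc j i).symm, fun i j i' j' x h h' => by have := g.dj _ _ _ _ x h h'; tauto⟩

def U (F : Fin 3 → Fin 3 → Set X) (α β : Fin 3 → X) (i j : Fin 3) : Set X := ((⋃ (p : Fin 3 × Fin 3) (_ : p ≠ (i, j)), F p.1 p.2) ∪ {α i, β j})ᶜ

lemma U_open (g : Gr F α β) (i j) : IsOpen (U F α β i j) := by
  refine (IsClosed.union ?_ (toFinite _).isClosed).isOpen_compl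
  exact isClosed_iUnion_of_finite fun p => isClosed_iUnion_of_finite fun _ => (g.arc _ _).closed

lemma U_sub {i j x} (h : x ∈ U F α β i j) (hx : x ∈ ⋃ (i) (j), F i j) : x ∈ F i j := by
  simp only [mem_iUnion] at hx
  obtain ⟨i', j', hx⟩ := hx
  simp only [U, mem_compl_iff, mem_union, not_or, mem_iUnion, not_exists] at h
  by_contra k
  refine h.1 (i', j') (fun e => ?_) hx
  obtain ⟨rfl, rfl⟩ := Prod.mk.inj e; exact k hx

lemma U_mem (g : Gr F α β) {i j x} (h : x ∈ F i j) (h1 : x ≠ α i) (h2 : x ≠ β j) : x ∈ U F α β i j := by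
  simp only [U, mem_compl_iff, mem_union, not_or, mem_iUnion, not_exists]
  refine ⟨fun p hp hx => ?_, by simp [h1, h2]⟩
  rcases g.dj _ _ _ _ x h hx with k | k | k
  exacts [hp (Prod.ext k.1.symm k.2.symm), h1 k.2, h2 k.2]

lemma a_mem (g : Gr F α β) {i i' j'} (h : α i ∈ F i' j') : i = i' := by
  obtain ⟨j, hj⟩ : ∃ j : Fin 3, j ≠ j' := exists_ne j'
  rcases g.dj i j i' j' _ (g.arc i j).left h with k | k | k
  exacts [k.1, k.1, absurd k.1 hj]

lemma b_mem (g : Gr F α β) {j i' j'} (h : β j ∈ F i' j') : j = j' := g.sw.a_mem h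
lemma a_inj (g : Gr F α β) : Function.Injective α := fun i i' e => g.a_mem (j' := 0) (by rw [e]; exact (g.arc i' 0).left)

lemma vert (g : Gr F α β) (g' : Gr G α' β') (e : ⋃ (i) (j), F i j = ⋃ (i) (j), G i j) {i k l} (h : α i ∈ G k l) : α i = α' k ∨ α i = β' l := by
  by_contra! hn
  have hu := g'.U_mem h hn.1 hn.2
  choose C C1 C2 C3 C4 using fun j => (g.arc i j).germ (g'.U_open k l) hu
  refine no_triod (g'.arc k l) (C := C) (fun j x hx => ?_) C2 C3 C4 fun j j' ij x hx => ?_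
  · exact U_sub (C1 j hx).2 (e ▸ mem_iUnion₂.2 ⟨i, j, (C1 j hx).1⟩)
  · rcases g.dj i j i j' x (C1 j hx.1).1 (C1 j' hx.2).1 with k | k | k
    exacts [absurd k.2 ij, k.2, absurd k.1 ij]

lemma edge (g : Gr F α β) (g' : Gr G α' β') (e : ⋃ (i) (j), F i j = ⋃ (i) (j), G i j) (k l) :
    ∃ i j, G k l = F i j ∧ ((α' k = α i ∧ β' l = β j) ∨ (α' k = β j ∧ β' l = α i)) := by
  have O : ∀ x ∈ G k l \ {α' k, β' l}, ∀ i j, x ∈ F i j → x ∈ U F α β i j := by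
    rintro x ⟨hx, hx'⟩ i j h
    refine g.U_mem h ?_ ?_ <;> rintro rfl
    · exact hx' (by simpa using g.vert g' e hx)
    · have := g.sw.vert g'.sw (by rw [iUnion_comm, e, iUnion_comm]) hx
      exact hx' (by simpa [or_comm] using this)
  obtain ⟨x, hx⟩ := (g'.arc k l).mid
  have me : ∀ x ∈ G k l, x ∈ ⋃ (i) (j), F i j := fun x hx => e ▸ mem_iUnion₂.2 ⟨k, l, hx⟩
  obtain ⟨i, j, hij⟩ := mem_iUnion₂.1 (me x hx.1)
  have s1 : G k l \ {α' k, β' l} ⊆ F i j := by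
    intro y hy
    by_contra hn
    obtain ⟨z, hz, z1, z2⟩ := (g'.arc k l).diff_conn _ _ (g.U_open i j) (g.arc i j).closed.isOpen_compl (fun z hz => by
      by_cases hk : z ∈ F i j
      exacts [.inl (O z hz i j hk), .inr hk]) ⟨x, hx, O x hx i j hij⟩ ⟨y, hy, hn⟩
    exact z2 (U_sub z1 (me z hz.1))
  have s2 : G k l ⊆ F i j := (g'.arc k l).subset_closure.trans (closure_minimal s1 (g.arc i j).closed)
  have k1 := g'.vert g e.symm (s2 (g'.arc k l).left)
  have k2 := g'.sw.vert g.sw (by rw [iUnion_comm, ← e, iUnion_comm]) (s2 (g'.arc k l).right)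
  have k3 := (g'.arc k l).ne
  have fin : (α' k = α i ∧ β' l = β j) ∨ (α' k = β j ∧ β' l = α i) := by
    rcases k1 with k1 | k1 <;> rcases k2 with k2 | k2
    exacts [.inl ⟨k1, k2⟩, absurd (k1.trans k2.symm) k3, absurd (k1.trans k2.symm) k3, .inr ⟨k1, k2⟩]
  refine ⟨i, j, (g.arc i j).eq_of (g'.arc k l).conn s2 ?_ ?_, fin⟩
  · rcases fin with m | m
    exacts [m.1 ▸ (g'.arc k l).left, m.2 ▸ (g'.arc k l).right]
  · rcases fin with m | m
    exacts [m.2 ▸ (g'.arc k l).right, m.1 ▸ (g'.arc k l).left]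

lemma lab1 (g : Gr F α β) (g' : Gr G α' β') (e : ⋃ (i) (j), F i j = ⋃ (i) (j), G i j) {i0} (h0 : α' 0 = α i0) :
    ∃ S T : Equiv.Perm (Fin 3), ∀ k l, G k l = F (S k) (T l) := by
  choose i j h1 h2 using g.edge g' e
  have ab : ∀ i j, α i ≠ β j := fun i j => (g.arc i j).ne
  have q1 : ∀ l, β' l = β (j 0 l) := fun l => by
    rcases h2 0 l with k | k
    exacts [k.2, absurd (h0.symm.trans k.1) (ab _ _)]
  have q2 : ∀ k l, α' k = α (i k l) ∧ β' l = β (j k l) := fun k l => by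
    rcases h2 k l with h | h
    exacts [h, absurd (h.2.symm.trans (q1 l)) (ab _ _)]
  have i1 : Function.Injective fun k => i k 0 := fun k k' h => g'.a_inj (by rw [(q2 k 0).1, (q2 k' 0).1]; exact congrArg α h)
  have i2 : Function.Injective fun l => j 0 l := fun k k' h => g'.sw.a_inj (by rw [(q2 0 k).2, (q2 0 k').2]; exact congrArg β h)
  refine ⟨Equiv.ofBijective _ (Finite.injective_iff_bijective.1 i1), Equiv.ofBijective _ (Finite.injective_iff_bijective.1 i2), fun k l => ?_⟩
  rw [h1]
  show F _ _ = F (i k 0) (j 0 l)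
  rw [g.a_inj ((q2 k l).1.symm.trans (q2 k 0).1), g.sw.a_inj ((q2 k l).2.symm.trans (q2 0 l).2)]

lemma lab (g : Gr F α β) (g' : Gr G α' β') (e : ⋃ (i) (j), F i j = ⋃ (i) (j), G i j) :
    ∃ S T : Equiv.Perm (Fin 3), (∀ k l, G k l = F (S k) (T l)) ∨ ∀ k l, G k l = F (T l) (S k) := by
  obtain ⟨i, j, -, h | h⟩ := g.edge g' e 0 0
  · obtain ⟨S, T, h⟩ := g.lab1 g' e h.1
    exact ⟨S, T, .inl h⟩
  · obtain ⟨S, T, h⟩ := g.sw.lab1 g' (by rw [iUnion_comm, e]) h.1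
    exact ⟨S, T, .inr h⟩
end Gr
end
end

section
open Set Filter Topology Metric
set_option linter.unusedSectionVars false

abbrev cm (k : Fin 5) : Fin 3 → Fin 3 → ℤ × ℤ := mkm (cc k).1 (cc k).1
def inc (k k' : Fin 5) (s : Bool) (S T : Fin 6) : Prop :=
  (if s then pm T (cc k').2.2 = (cc k).2.1 ∧ pm S (cc k').2.1 = (cc k).2.2 else pm S (cc k').2.1 = (cc k).2.1 ∧ pm T (cc k').2.2 = (cc k).2.2) ∧
  ∀ i i' j j', sg (mv s (pm S) (pm T) (cm k)) i i' j j' = 0 ↔ sg (cm k') i i' j j' = 0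
instance (k k' s S T) : Decidable (inc k k' s S T) := by unfold inc; infer_instance
lemma inc_all : ∀ k k' s S T, inc k k' s S T → k = k' := by decide +kernel
lemma pm_surj : Function.Surjective pm := by decide +kernel

section
variable {X : Type*} [TopologicalSpace X] [T2Space X] {F G : Fin 3 → Fin 3 → Set X} {α β α' β' : Fin 3 → X} {M : Fin 3 → Fin 3 → ℤ × ℤ}

lemma Rp.gr (h : Rp F M) : ∃ α β, Gr F α β := by
  obtain ⟨p, a, b, E, hp, h, hF⟩ := h
  exact ⟨_, _, by convert gr_of hp h using 1; funext i j; exact hF i j⟩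

lemma Rp.map (h : Rp F M) (H : X ≃ₜ X) : Rp (fun i j => H '' F i j) M := by
  obtain ⟨p, a, b, E, hp, h, hF⟩ := h
  refine ⟨H ∘ p, a, b, E, ⟨?_, H.surjective.comp hp.surj, fun x y => by simp [hp.ker]⟩, h, fun i j => by beta_reduce; rw [hF, image_image]; rfl⟩
  exact hp.cov.homeomorph_comp H

lemma Gr.edge_inj (g : Gr F α β) {i j i' j'} (e : F i j = F i' j') : i = i' ∧ j = j' := by
  obtain ⟨x, hx, hn⟩ := (g.arc i j).mid
  simp only [mem_insert_iff, mem_singleton_iff, not_or] at hn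
  rcases g.dj i j i' j' x hx (e ▸ hx) with k | k | k
  exacts [k, absurd k.2 hn.1, absurd k.2 hn.2]

lemma distinct {k k'} (h : Rp F (cm k)) (h' : Rp G (cm k')) (H : X ≃ₜ X) (e : H '' (⋃ (i) (j), G i j) = ⋃ (i) (j), F i j)
    (e' : H '' G (cc k').2.1 (cc k').2.2 = F (cc k).2.1 (cc k).2.2) : k = k' := by
  have h'' := h'.map H
  obtain ⟨α, β, g⟩ := h.gr
  obtain ⟨α', β', g'⟩ := h''.gr
  obtain ⟨S, T, hl⟩ := g.lab g' (by rw [← e]; simp only [image_iUnion])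
  obtain ⟨S, rfl⟩ := pm_surj S
  obtain ⟨T, rfl⟩ := pm_surj T
  rcases hl with hl | hl
  · refine inc_all k k' false S T ⟨?_, ?_⟩
    · rw [hl] at e'; simpa using g.edge_inj e'
    · have := h.rel (pm S) (pm T)
      simp only [← hl] at this
      intro i i' j j'; exact ⟨this.cmp h'', h''.cmp this⟩
  · refine inc_all k k' true S T ⟨?_, ?_⟩
    · rw [hl] at e'; simpa using g.edge_inj e'
    · have := h.sw.rel (pm S) (pm T)
      simp only [← hl] at this
      intro i i' j j'; exact ⟨this.cmp h'', h''.cmp this⟩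
end
end

section
open Set Filter Topology Metric
set_option linter.unusedSectionVars false

lemma arc_of_path {X : Type*} [TopologicalSpace X] (γ : C(unitInterval, X)) (h : Function.Injective γ) : IsArc (range γ) (γ 0) (γ 1) := by
  refine ⟨fun t => γ (projIcc 0 1 zero_le_one t), (γ.continuous.comp continuous_projIcc).continuousOn, fun s hs t ht e => ?_, by simp, by simp, ?_⟩
  · have := h e
    rw [projIcc_of_mem _ hs, projIcc_of_mem _ ht] at this; exact congrArg Subtype.val this
  · ext x; constructor
    · rintro ⟨t, -, rfl⟩; exact ⟨_, rfl⟩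
    · rintro ⟨t, rfl⟩; exact ⟨t, t.2, by simp⟩

lemma IsArc.path {X : Type*} [TopologicalSpace X] {A : Set X} {x y} (h : IsArc A x y) : ∃ γ : C(unitInterval, X), Function.Injective γ ∧ γ 0 = x ∧ γ 1 = y ∧ range γ = A := by
  obtain ⟨f, h1, h2, rfl, rfl, rfl⟩ := h
  refine ⟨⟨fun t => f t, continuousOn_iff_continuous_domRestrict.1 h1⟩, fun s t e => Subtype.ext (h2 s.2 t.2 e), rfl, rfl, ?_⟩
  ext x; constructor
  · rintro ⟨t, rfl⟩; exact ⟨t, t.2, rfl⟩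
  · rintro ⟨t, ht, rfl⟩; exact ⟨⟨t, ht⟩, rfl⟩

lemma Gr.rp {X : Type*} [TopologicalSpace X] {F : Fin 3 → Fin 3 → Set X} {α β} (g : Gr F α β) {p : ℂ → X} (hp : Cv ZI p) : ∃ M, Rp F M := by
  choose a ha using fun i => hp.surj (α i)
  choose b hb using fun j => hp.surj (β j)
  choose γ γi γ0 γ1 γr using fun i j => (g.arc i j).path
  choose Γ Γl Γ0 using fun i j => hp.cov.exists_path_lifts (γ i j) (a i) (by rw [γ0, ha])
  have Γp : ∀ i j t, p (Γ i j t) = γ i j t := fun i j t => congrFun (Γl i j) t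
  have Γi : ∀ i j, Function.Injective (Γ i j) := fun i j s t e => γi i j (by rw [← Γp, ← Γp, e])
  have hM : ∀ i j, Γ i j 1 - b j ∈ ZI := fun i j => (hp.ker _ _).1 (by rw [Γp, γ1, hb])
  choose M hM using hM
  have Γ1 : ∀ i j, Γ i j 1 = b j + io (M i j) := fun i j => by rw [hM]; ring
  have hF : ∀ i j, F i j = p '' range (Γ i j) := fun i j => by
    rw [← γr, ← range_comp, Γl]
  have inj : ∀ i j, InjOn p (range (Γ i j)) := by
    rintro i j _ ⟨s, rfl⟩ _ ⟨t, rfl⟩ e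
    rw [Γp, Γp] at e; rw [γi i j e]
  refine ⟨M, p, a, b, fun i j => range (Γ i j), hp, ⟨fun i j => io_mem _, fun i j => ?_, ?_⟩, hF⟩
  · have := arc_of_path _ (Γi i j); rwa [Γ0, Γ1] at this
  · intro i j i' j' x l hl hx hx'
    have pe : p (x + l) = p x := (hp.ker _ _).2 (by simpa using hl)
    have m1 : p x ∈ F i j := by rw [hF]; exact ⟨x, hx, rfl⟩
    have m2 : p x ∈ F i' j' := by rw [hF]; exact ⟨_, hx', pe⟩
    rcases g.dj _ _ _ _ _ m1 m2 with ⟨rfl, rfl⟩ | ⟨rfl, k⟩ | ⟨rfl, k⟩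
    · exact .inl ⟨rfl, rfl, by simpa using inj i j hx' hx pe⟩
    · have e1 := inj i j hx ⟨0, Γ0 i j⟩ (by rw [k, ha])
      have e2 := inj i j' hx' ⟨0, Γ0 i j'⟩ (by rw [pe, k, ha])
      exact .inr (.inl ⟨rfl, by rw [e1] at e2; simpa using e2, e1⟩)
    · have e1 := inj i j hx ⟨1, rfl⟩ (by rw [k, Γp, γ1])
      have e2 := inj i' j hx' ⟨1, rfl⟩ (by rw [pe, k, Γp, γ1])
      rw [Γ1] at e1 e2
      exact .inr (.inr ⟨rfl, by linear_combination e2 - e1, e1⟩)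

def tp (z : ℂ) : UnitAddCircle × UnitAddCircle := (z.re, z.im)

lemma cv_tp : Cv ZI tp := by
  have o : IsOpenQuotientMap tp := by
    have h : IsOpenQuotientMap (QuotientAddGroup.mk : ℝ → UnitAddCircle) := QuotientAddGroup.isOpenQuotientMap_mk
    exact (h.prodMap h).comp Complex.equivRealProdCLM.toHomeomorph.isOpenQuotientMap
  have ker : ∀ x y, tp x = tp y ↔ x - y ∈ ZI := fun x y => by
    have c : ∀ s t : ℝ, (s : UnitAddCircle) = t ↔ ∃ n : ℤ, (n : ℝ) = s - t := fun s t => by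
      rw [← sub_eq_zero, ← AddCircle.coe_sub, AddCircle.coe_eq_zero_iff]; simp
    simp only [tp, Prod.mk.injEq, c]
    constructor
    · rintro ⟨⟨m, hm⟩, n, hn⟩; exact ⟨(m, n), by apply Complex.ext <;> simp [io, hm, hn]⟩
    · rintro ⟨⟨m, n⟩, h⟩; exact ⟨⟨m, by simpa [io] using congrArg Complex.re h⟩, n, by simpa [io] using congrArg Complex.im h⟩
  have d : IsDiscrete (ZI : Set ℂ) := by
    rw [isDiscrete_iff_forall_mem_exists_isOpen]
    rintro _ ⟨m, rfl⟩
    refine ⟨ball (io m) 1, isOpen_ball, ?_⟩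
    ext x; simp only [mem_inter_iff, mem_singleton_iff]
    refine ⟨?_, by rintro rfl; exact ⟨mem_ball_self one_pos, io_mem m⟩⟩
    rintro ⟨h, n, rfl⟩
    rw [Metric.mem_ball, dist_eq_norm, ← io_sub] at h
    have h1 := (Complex.abs_re_le_norm _).trans_lt h
    have h2 := (Complex.abs_im_le_norm _).trans_lt h
    simp only [io] at h1 h2
    have h1' : |(n - m).1| < 1 := by exact_mod_cast h1
    have h2' : |(n - m).2| < 1 := by exact_mod_cast h2
    rw [Int.abs_lt_one_iff] at h1' h2'
    congr 1; exact sub_eq_zero.1 (Prod.ext h1' h2')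
  exact ⟨(o.isQuotientMap.isAddQuotientCoveringMap_of_addSubgroup ZI d (fun {x y} => by rw [eq_comm, ker, sub_eq_add_neg])).isCoveringMap, o.surjective, ker⟩
end

section
open Set Filter Topology Metric
set_option linter.unusedSectionVars false

def dU : List (ℤ × ℤ) := [(3, -1), (-3, 1), (-1, -3), (1, 3), (-1, 3), (1, -3), (-3, -2), (2, 1)]

def dX (A B : Fin 3 → ℤ × ℤ) (s : ℤ × ℤ) (M : Fin 3 → Fin 3 → ℤ × ℤ) : Prop :=
  ∀ i j i' j' : Fin 3, ∀ m ∈ [(-1 : ℤ), 0, 1], ∀ n ∈ [(-1 : ℤ), 0, 1], (i = i' ∧ j = j' ∧ m = 0 ∧ n = 0) ∨ ∃ u ∈ dU,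
    let p := u.1 * (A i).1 + u.2 * (A i).2
    let q := u.1 * ((B j).1 + s.1 * (M i j).1) + u.2 * ((B j).2 + s.2 * (M i j).2)
    let p' := u.1 * ((A i').1 - s.1 * m) + u.2 * ((A i').2 - s.2 * n)
    let q' := u.1 * ((B j').1 + s.1 * (M i' j').1 - s.1 * m) + u.2 * ((B j').2 + s.2 * (M i' j').2 - s.2 * n)
    let c := max p q
    c ≤ p' ∧ c ≤ q' ∧ ((c < p' ∧ c < q') ∨ (i = i' ∧ m = 0 ∧ n = 0 ∧ (q < c ∨ c < q')) ∨
      (j = j' ∧ m = (M i' j').1 - (M i j).1 ∧ n = (M i' j').2 - (M i j).2 ∧ (p < c ∨ c < p')))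

def bX (A B : Fin 3 → ℤ × ℤ) (s o : ℤ × ℤ) (M : Fin 3 → Fin 3 → ℤ × ℤ) : Prop :=
  0 < s.1 ∧ 0 < s.2 ∧ ∀ i j, A i ≠ B j + s * M i j ∧ (o.1 ≤ (A i).1 ∧ (A i).1 < o.1 + 2 * s.1 ∧ o.2 ≤ (A i).2 ∧ (A i).2 < o.2 + 2 * s.2) ∧
    (o.1 ≤ (B j).1 + s.1 * (M i j).1 ∧ (B j).1 + s.1 * (M i j).1 < o.1 + 2 * s.1 ∧ o.2 ≤ (B j).2 + s.2 * (M i j).2 ∧ (B j).2 + s.2 * (M i j).2 < o.2 + 2 * s.2)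

def xA : Fin 3 → ℤ × ℤ := ![(0, 0), (1, 1), (-1, 1)]
def xB : Fin 3 → ℤ × ℤ := ![(0, 1), (-1, 0), (1, 0)]
def yA : Fin 3 → ℤ × ℤ := ![(0, 0), (2, 1), (1, 2)]
def yB : Fin 3 → ℤ × ℤ := ![(1, 1), (-1, 0), (0, -1)]

lemma x1 : dX xA xB (3, 2) (mkm (0, 0) (0, 0)) := by unfold dX; decide +kernel
lemma x2 : bX xA xB (3, 2) (-1, 0) (mkm (0, 0) (0, 0)) := by unfold bX; decide +kernel
lemma y1 : dX yA yB (3, 3) (mkm (1, 1) (1, 1)) := by unfold dX; decide +kernel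
lemma y2 : bX yA yB (3, 3) (-1, -1) (mkm (1, 1) (1, 1)) := by unfold bX; decide +kernel

lemma box1 {o s p q p' q' m : ℤ} {t t' x : ℝ} (hs : 0 < s) (ht : 0 ≤ t) (ht1 : t ≤ 1) (ht' : 0 ≤ t') (ht1' : t' ≤ 1)
    (hp : o ≤ p ∧ p < o + 2 * s) (hq : o ≤ q ∧ q < o + 2 * s) (hp' : o ≤ p' ∧ p' < o + 2 * s) (hq' : o ≤ q' ∧ q' < o + 2 * s)
    (h : s * x = (1 - t) * p + t * q) (h' : s * (x + m) = (1 - t') * p' + t' * q') : m ∈ [(-1 : ℤ), 0, 1] := by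
  have key : ∀ {a b : ℤ} {r : ℝ}, 0 ≤ r → r ≤ 1 → (o ≤ a ∧ a < o + 2 * s) → (o ≤ b ∧ b < o + 2 * s) → (o : ℝ) ≤ (1 - r) * a + r * b ∧ (1 - r) * a + r * b ≤ o + 2 * s - 1 := by
    intro a b r h0 h1 ⟨ha, ha'⟩ ⟨hb, hb'⟩
    have e1 : (o : ℝ) ≤ a := by exact_mod_cast ha
    have e2 : (o : ℝ) ≤ b := by exact_mod_cast hb
    have e3 : (a : ℝ) ≤ o + 2 * s - 1 := by exact_mod_cast (by omega : a ≤ o + 2 * s - 1)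
    have e4 : (b : ℝ) ≤ o + 2 * s - 1 := by exact_mod_cast (by omega : b ≤ o + 2 * s - 1)
    constructor <;> nlinarith
  obtain ⟨k1, k2⟩ := key ht ht1 hp hq
  obtain ⟨k3, k4⟩ := key ht' ht1' hp' hq'
  have l1 : (s : ℝ) * m < 2 * s := by linarith
  have l2 : -(2 * s : ℝ) < s * m := by linarith
  have l1' : s * m < 2 * s := by exact_mod_cast l1
  have l2' : -(2 * s) < s * m := by exact_mod_cast l2
  have : m < 2 := by nlinarith
  have : -2 < m := by nlinarith
  simp; omega

lemma sep1 {p q c p' q' : ℤ} {t t' : ℝ} (ht : 0 ≤ t) (ht1 : t ≤ 1) (ht' : 0 ≤ t') (ht1' : t' ≤ 1)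
    (h1 : p ≤ c) (h2 : q ≤ c) (h3 : c ≤ p') (h4 : c ≤ q') (h : (1 - t) * p + t * q = (1 - t') * p' + t' * q') :
    (p = c ∨ t = 1) ∧ (q = c ∨ t = 0) ∧ (p' = c ∨ t' = 1) ∧ (q' = c ∨ t' = 0) := by
  have g1 : (p : ℝ) ≤ c := by exact_mod_cast h1
  have g2 : (q : ℝ) ≤ c := by exact_mod_cast h2
  have g3 : (c : ℝ) ≤ p' := by exact_mod_cast h3
  have g4 : (c : ℝ) ≤ q' := by exact_mod_cast h4
  have k1 := mul_nonneg (sub_nonneg.2 ht1) (sub_nonneg.2 g1)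
  have k2 := mul_nonneg ht (sub_nonneg.2 g2)
  have k3 := mul_nonneg (sub_nonneg.2 ht1') (sub_nonneg.2 g3)
  have k4 := mul_nonneg ht' (sub_nonneg.2 g4)
  refine ⟨?_, ?_, ?_, ?_⟩
  · rcases mul_eq_zero.1 (by linarith : (1 - t) * ((c : ℝ) - p) = 0) with e | e
    · right; linarith
    · left; exact_mod_cast (by linarith : (p : ℝ) = c)
  · rcases mul_eq_zero.1 (by linarith : t * ((c : ℝ) - q) = 0) with e | e
    · right; linarith
    · left; exact_mod_cast (by linarith : (q : ℝ) = c)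
  · rcases mul_eq_zero.1 (by linarith : (1 - t') * ((p' : ℝ) - c) = 0) with e | e
    · right; linarith
    · left; exact_mod_cast (by linarith : (p' : ℝ) = c)
  · rcases mul_eq_zero.1 (by linarith : t' * ((q' : ℝ) - c) = 0) with e | e
    · right; linarith
    · left; exact_mod_cast (by linarith : (q' : ℝ) = c)

noncomputable def pt (s p : ℤ × ℤ) : ℂ := ⟨p.1 / s.1, p.2 / s.2⟩

lemma seg_co {s P B M : ℤ × ℤ} (h1 : 0 < s.1) (h2 : 0 < s.2) {x : ℂ} (h : x ∈ segment ℝ (pt s P) (pt s B + io M)) :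
    ∃ t : ℝ, 0 ≤ t ∧ t ≤ 1 ∧ s.1 * x.re = (1 - t) * P.1 + t * (B.1 + s.1 * M.1 : ℤ) ∧ s.2 * x.im = (1 - t) * P.2 + t * (B.2 + s.2 * M.2 : ℤ) ∧ (t = 0 → x = pt s P) ∧ (t = 1 → x = pt s B + io M) := by
  have n1 : (s.1 : ℝ) ≠ 0 := by exact_mod_cast h1.ne'
  have n2 : (s.2 : ℝ) ≠ 0 := by exact_mod_cast h2.ne'
  rw [segment_eq_image] at h
  obtain ⟨t, ⟨h0, h1⟩, rfl⟩ := h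
  refine ⟨t, h0, h1, ?_, ?_, ?_, ?_⟩
  · simp [pt, io]; field_simp
  · simp [pt, io]; field_simp
  · rintro rfl; simp
  · rintro rfl; simp

lemma lft_of {A B : Fin 3 → ℤ × ℤ} {s o : ℤ × ℤ} {M : Fin 3 → Fin 3 → ℤ × ℤ} (hd : dX A B s M) (hb : bX A B s o M) :
    Lft ZI (fun i j => io (M i j)) (fun i => pt s (A i)) (fun j => pt s (B j)) (fun i j => segment ℝ (pt s (A i)) (pt s (B j) + io (M i j))) := by
  obtain ⟨s1, s2, hb⟩ := hb
  have n1 : (s.1 : ℝ) ≠ 0 := by exact_mod_cast s1.ne'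
  have n2 : (s.2 : ℝ) ≠ 0 := by exact_mod_cast s2.ne'
  refine ⟨fun i j => io_mem _, fun i j => isArc_segment fun e => ?_, ?_⟩
  · refine (hb i j).1 ?_
    simp only [pt, io, Complex.ext_iff, Complex.add_re, Complex.add_im] at e
    obtain ⟨e1, e2⟩ := e
    field_simp at e1 e2
    exact Prod.ext (by simp; exact_mod_cast e1) (by simp; exact_mod_cast e2)
  · rintro i j i' j' x _ ⟨⟨m, n⟩, rfl⟩ hx hx'
    obtain ⟨t, t0, t1, c1, c2, z, w⟩ := seg_co s1 s2 hx
    obtain ⟨t', t0', t1', c1', c2', z', w'⟩ := seg_co s1 s2 hx'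
    simp only [Complex.add_re, Complex.add_im, io] at c1' c2'
    obtain ⟨-, ⟨b1, b2, b3, b4⟩, b5, b6, b7, b8⟩ := hb i j
    obtain ⟨-, ⟨d1, d2, d3, d4⟩, d5, d6, d7, d8⟩ := hb i' j'
    have hm := box1 s1 t0 t1 t0' t1' ⟨b1, b2⟩ ⟨b5, b6⟩ ⟨d1, d2⟩ ⟨d5, d6⟩ c1 c1'
    have hn := box1 s2 t0 t1 t0' t1' ⟨b3, b4⟩ ⟨b7, b8⟩ ⟨d3, d4⟩ ⟨d7, d8⟩ c2 c2'
    rcases hd i j i' j' m hm n hn with ⟨rfl, rfl, rfl, rfl⟩ | ⟨u, -, k1, k2, k3⟩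
    · exact .inl ⟨rfl, rfl, io_zero⟩
    have S := sep1 t0 t1 t0' t1' (le_max_left _ _) (le_max_right _ _) k1 k2 (by
      push_cast at c1 c2 c1' c2' ⊢
      linear_combination (-u.1 : ℝ) * c1 - u.2 * c2 + u.1 * c1' + u.2 * c2')
    obtain ⟨S1, S2, S3, S4⟩ := S
    rcases k3 with ⟨k3, k4⟩ | ⟨rfl, rfl, rfl, k3⟩ | ⟨rfl, rfl, rfl, k3⟩
    · exfalso
      rcases S3 with e | e
      · omega
      · rcases S4 with e' | e'
        · omega
        · rw [e] at e'; norm_num at e'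
    · refine .inr (.inl ⟨rfl, io_zero, ?_⟩)
      rcases k3 with k | k
      · exact z (S2.resolve_left k.ne)
      · have := z' (S4.resolve_left k.ne')
        rwa [show ((0 : ℤ), (0 : ℤ)) = 0 from rfl, io_zero, add_zero] at this
    · have hl : io ((M i' j).1 - (M i j).1, (M i' j).2 - (M i j).2) = io (M i' j) - io (M i j) := io_sub _ _
      refine .inr (.inr ⟨rfl, hl, ?_⟩)
      rcases k3 with k | k
      · exact w (S1.resolve_left k.ne)
      · have := w' (S3.resolve_left k.ne')
        rw [hl] at this; linear_combination this

lemma canL (k : Fin 5) : ∃ a b E, Lft ZI (fun i j => io (cm k i j)) a b E := by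
  have hx := lft_of x1 x2
  have hy := lft_of y1 y2
  fin_cases k
  · exact ⟨_, _, _, hy⟩
  all_goals exact ⟨_, _, _, hx⟩
end

open Set Filter Topology Metric
set_option linter.unusedSectionVars false

def ed (i j : Fin 3) : K33.edgeSet := ⟨s(Sum.inl i, Sum.inr j), by simp [K33]⟩

lemma ed_surj (e : K33.edgeSet) : ∃ i j, e = ed i j := by
  obtain ⟨e, he⟩ := e
  induction e using Sym2.ind with
  | _ u v =>
    rcases u with i | i <;> rcases v with j | j <;> simp [K33] at he
    · exact ⟨i, j, rfl⟩
    · exact ⟨j, i, Subtype.ext Sym2.eq_swap⟩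

lemma ed_inj {i j i' j'} (h : ed i j = ed i' j') : i = i' ∧ j = j' := by
  simpa [ed] using h

def Fe (D : TorusEmbedding K33) (i j : Fin 3) : Set Torus := range (D.edge (ed i j))

lemma Fe_im (D : TorusEmbedding K33) : D.image = ⋃ (i) (j), Fe D i j := by
  ext x; simp only [TorusEmbedding.image, mem_iUnion]; constructor
  · rintro ⟨e, h⟩; obtain ⟨i, j, rfl⟩ := ed_surj e; exact ⟨i, j, h⟩
  · rintro ⟨i, j, h⟩; exact ⟨_, h⟩

lemma Fe_gr (D : TorusEmbedding K33) : Gr (Fe D) (fun i => D.vert (.inl i)) (fun j => D.vert (.inr j)) := by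
  refine ⟨fun i j => ?_, ?_⟩
  · obtain ⟨u, v, h, h0, h1⟩ := D.edge_ends (ed i j)
    have := arc_of_path _ (D.edge_inj (ed i j))
    rw [h0, h1] at this
    simp only [ed, Sym2.eq_iff] at h
    rcases h with ⟨rfl, rfl⟩ | ⟨rfl, rfl⟩
    · exact this
    · exact this.symm
  · rintro i j i' j' x ⟨t, rfl⟩ ⟨t', h⟩
    by_cases e : ed i j = ed i' j'
    · exact .inl (ed_inj e)
    · obtain ⟨w, h1, h2, h3⟩ := D.edge_disjoint _ _ e t t' h.symm
      simp only [ed, Sym2.mem_iff] at h1 h2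
      rcases h1 with rfl | rfl <;> simp at h2
      · exact .inr (.inl ⟨h2, h3⟩)
      · exact .inr (.inr ⟨h2, h3⟩)

lemma emb_of {F : Fin 3 → Fin 3 → Set Torus} {α β} (g : Gr F α β) : ∃ D : TorusEmbedding K33, ∀ i j, Fe D i j = F i j := by
  choose γ γi γ0 γ1 γr using fun i j => (g.arc i j).path
  choose I J hIJ using ed_surj
  have hI : ∀ i j, I (ed i j) = i ∧ J (ed i j) = j := fun i j => by
    obtain ⟨h1, h2⟩ := ed_inj (hIJ (ed i j)); exact ⟨h1.symm, h2.symm⟩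
  have mem : ∀ i j t, γ i j t ∈ F i j := fun i j t => by rw [← γr]; exact ⟨t, rfl⟩
  have ab : ∀ i j, α i ≠ β j := fun i j => (g.arc i j).ne
  refine ⟨⟨Sum.elim α β, ?_, fun e => γ (I e) (J e), fun e => ⟨.inl (I e), .inr (J e), congrArg Subtype.val (hIJ e), γ0 _ _, γ1 _ _⟩, fun e => γi _ _, ?_, ?_⟩, fun i j => ?_⟩
  · rw [Sum.elim_injective]
    exact ⟨g.a_inj, g.sw.a_inj, ab⟩
  · rintro e t ⟨v, hv⟩
    have hm := mem (I e) (J e) t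
    have k : γ (I e) (J e) t = α (I e) ∨ γ (I e) (J e) t = β (J e) := by
      rcases v with i | j
      · have h' : γ (I e) (J e) t ∈ F i (J e) := by rw [← hv]; exact (g.arc i (J e)).left
        rcases g.dj _ _ _ _ _ hm h' with ⟨h, -⟩ | ⟨-, h⟩ | ⟨-, h⟩
        · left; rw [← hv, h]; rfl
        · exact .inl h
        · exact .inr h
      · have h' : γ (I e) (J e) t ∈ F (I e) j := by rw [← hv]; exact (g.arc (I e) j).right
        rcases g.dj _ _ _ _ _ hm h' with ⟨-, h⟩ | ⟨-, h⟩ | ⟨-, h⟩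
        · right; rw [← hv, h]; rfl
        · exact .inl h
        · exact .inr h
    rcases k with k | k
    · exact .inl (γi _ _ (k.trans (γ0 _ _).symm))
    · exact .inr (γi _ _ (k.trans (γ1 _ _).symm))
  · intro e e' ne t t' h
    have h1 : ∀ e : K33.edgeSet, (e : Sym2 (Fin 3 ⊕ Fin 3)) = s(.inl (I e), .inr (J e)) := fun e => congrArg Subtype.val (hIJ e)
    have hm := mem (I e) (J e) t
    have hm' := mem (I e') (J e') t'
    rw [← h] at hm'
    rcases g.dj _ _ _ _ _ hm hm' with ⟨k, k'⟩ | ⟨k, k'⟩ | ⟨k, k'⟩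
    · exact absurd (by rw [hIJ e, hIJ e', k, k']) ne
    · exact ⟨.inl (I e), by rw [h1]; simp, by rw [h1, k]; simp, k'⟩
    · exact ⟨.inr (J e), by rw [h1]; simp, by rw [h1, k]; simp, k'⟩
  · show range (γ (I (ed i j)) (J (ed i j))) = _
    rw [(hI i j).1, (hI i j).2, γr]

lemma canD (k : Fin 5) : ∃ D : TorusEmbedding K33, Rp (Fe D) (cm k) ∧ ∃ a b E, Lft ZI (fun i j => io (cm k i j)) a b E ∧ ∀ i j, Fe D i j = tp '' E i j := by
  obtain ⟨a, b, E, h⟩ := canL k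
  obtain ⟨D, hD⟩ := emb_of (gr_of cv_tp h)
  exact ⟨D, ⟨tp, a, b, E, cv_tp, h, hD⟩, a, b, E, h, hD⟩

lemma eqv_refl (D) : EdgedEquiv D D := ⟨Homeomorph.refl _, by simp, by simp⟩
lemma eqv_symm {D D'} : EdgedEquiv D D' → EdgedEquiv D' D := by
  rintro ⟨h, h1, h2⟩
  exact ⟨h.symm, by rw [← h1, ← image_comp]; simp, by rw [← h2, ← image_comp]; simp⟩
lemma eqv_trans {D D' D''} : EdgedEquiv D D' → EdgedEquiv D' D'' → EdgedEquiv D D'' := by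
  rintro ⟨h, h1, h2⟩ ⟨k, k1, k2⟩
  exact ⟨k.trans h, by rw [← h1, ← k1, ← image_comp]; rfl, by rw [← h2, ← k2, ← image_comp]; rfl⟩

theorem five_edged_embeddings_of_K33_in_torus :
    Nat.card (Quot EdgedEquiv) = 5 := by
  choose C hC a b E hL hE using canD
  let c : Fin 5 → EdgedEmbedding := fun k => ⟨C k, ed (cc k).2.1 (cc k).2.2⟩
  have sur : ∀ D : EdgedEmbedding, ∃ k, EdgedEquiv (c k) D := by
    rintro ⟨D, e⟩
    obtain ⟨i, j, rfl⟩ := ed_surj e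
    obtain ⟨M, hM⟩ := (Fe_gr D).rp cv_tp
    have := upper (Q := fun F i j => ∃ k, ∃ H : Torus ≃ₜ Torus, H '' (⋃ (i) (j), F i j) = (⋃ (i) (j), Fe (C k) i j) ∧ H '' F i j = Fe (C k) (cc k).2.1 (cc k).2.2) ?_ ?_ ?_ hM i j
    · obtain ⟨k, H, h1, h2⟩ := this
      exact ⟨k, H, by rw [Fe_im, Fe_im]; exact h1, h2⟩
    · rintro F S T i j ⟨k, H, h1, h2⟩
      refine ⟨k, H, ?_, h2⟩
      rw [← h1]; congr 1
      ext x; simp only [mem_iUnion]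
      constructor
      · rintro ⟨i, j, h⟩; exact ⟨S.symm i, T.symm j, by simpa using h⟩
      · rintro ⟨i, j, h⟩; exact ⟨_, _, h⟩
    · rintro F i j ⟨k, H, h1, h2⟩
      refine ⟨k, H, ?_, h2⟩
      rw [← h1, iUnion_comm]
    · rintro F k ⟨p, a', b', E', hp, hl, hF⟩
      obtain ⟨H, hH⟩ := rigid (M := fun i j => io (cm k i j)) (p := fun t => if t then p else tp)
        (a := fun t => if t then a' else a k) (b := fun t => if t then b' else b k) (E := fun t => if t then E' else E k) (mkm_nrm _ _)
        (by rintro (_ | _); exacts [cv_tp, hp]) (by rintro (_ | _); exacts [hL k, hl])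
      have hH' : ∀ i j, H '' F i j = Fe (C k) i j := fun i j => by rw [hF, hE]; simpa using hH i j
      refine ⟨k, H, ?_, hH' _ _⟩
      simp only [image_iUnion, hH']
  have inj : ∀ k k', EdgedEquiv (c k) (c k') → k = k' := by
    rintro k k' ⟨H, h1, h2⟩
    rw [Fe_im, Fe_im] at h1
    exact distinct (hC k) (hC k') H h1 h2
  have : Function.Bijective fun k => Quot.mk EdgedEquiv (c k) := by
    refine ⟨fun k k' h => inj k k' ?_, fun q => ?_⟩
    · have e : Equivalence EdgedEquiv := ⟨eqv_refl, eqv_symm, eqv_trans⟩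
      exact e.eqvGen_iff.1 (Quot.eqvGen_exact h)
    · induction q using Quot.ind with
      | _ D => obtain ⟨k, hk⟩ := sur D; exact ⟨k, Quot.sound hk⟩
  rw [← Nat.card_eq_of_bijective _ this]; simp
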